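/- (Kac's Theorem) Let k be an algebraically closed field and Q an arbitrary finite quiver. A vector α ∈ Z_{≥0}^{Q_0} is the dimension vector of some indecomposable finite-dimensional representation of Q if and only if Σ_{i∈Q_0} α(i)α_i is a positive root of the root system of the Kac–Moody algebra associated to the Cartan matrix of Q. In particular, the set of dimension vectors of indecomposable representations of Q depends only on the underlying undirected graph of Q and not on the orientation of its arrows. -/

import Mathlib

/-! Statement 12 (Kac's theorem): a nonnegative vector α is the dimension vector of an
indecomposable representation of a finite quiver Q iff it is a positive root of the root
system of the Kac–Moody algebra attached to the Cartan matrix of Q; in particular this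
set of dimension vectors is independent of the orientation of the arrows. -/

/-- A finite-dimensional representation of the quiver `(I, E, s, t)` over the field `k`:
a finite-dimensional `k`-vector space `V i` for each vertex `i` and a `k`-linear map
`f e : V (s e) → V (t e)` for each arrow `e`. -/
structure QRep (k : Type) [Field k] (I E : Type) (s t : E → I) where
  V : I → Type
  [acg : ∀ i, AddCommGroup (V i)]
  [mod : ∀ i, Module k (V i)]
  [fd : ∀ i, FiniteDimensional k (V i)]
  f : ∀ e : E, V (s e) →ₗ[k] V (t e)

attribute [instance] QRep.acg QRep.mod QRep.fd

namespace QRep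

variable {k : Type} [Field k] {I E : Type} {s t : E → I}

/-- Isomorphism of quiver representations: a collection of linear equivalences commuting
with the structure maps. -/
def Iso (M N : QRep k I E s t) : Prop :=
  ∃ φ : ∀ i, M.V i ≃ₗ[k] N.V i,
    ∀ (e : E) (v : M.V (s e)), φ (t e) (M.f e v) = N.f e (φ (s e) v)

/-- Direct sum of two quiver representations, defined vertexwise and arrowwise. -/
def dsum (M N : QRep k I E s t) : QRep k I E s t where
  V i := M.V i × N.V i
  f e := (M.f e).prodMap (N.f e)

/-- The trivial (zero) representation. -/
def zero (k : Type) [Field k] (I E : Type) (s t : E → I) : QRep k I E s t where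
  V _ := PUnit
  f _ := 0

/-- A representation is trivial if all its vector spaces are zero. -/
def IsTrivial (M : QRep k I E s t) : Prop := ∀ i, Subsingleton (M.V i)

/-- A representation is indecomposable if it is nontrivial and not isomorphic to a direct
sum of two nontrivial representations. -/
def Indecomposable (M : QRep k I E s t) : Prop :=
  ¬ M.IsTrivial ∧
    ∀ A B : QRep k I E s t, ¬ A.IsTrivial → ¬ B.IsTrivial → ¬ M.Iso (A.dsum B)

/-- Finite direct sums of quiver representations. -/
def dsumFin : (n : ℕ) → (Fin n → QRep k I E s t) → QRep k I E s t
  | 0, _ => zero k I E s t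
  | n + 1, F => (F 0).dsum (dsumFin n fun a => F a.succ)

/-- The dimension vector of a representation. -/
noncomputable def dimVec (M : QRep k I E s t) : I → ℕ := fun i => Module.finrank k (M.V i)

end QRep

/-- The (generalized) Cartan matrix of the quiver `(I, E, s, t)`:
`c_{ij} = 2δ_{ij} − #{edges between i and j in the underlying graph}` (loops counted
twice on the diagonal); equivalently `c_{ij} = a_{ij} + a_{ji}` where
`a_{ij} = δ_{ij} − #{arrows from i to j}`. -/
noncomputable def cartanMatrix {I E : Type} [DecidableEq I] (s t : E → I) (i j : I) : ℤ :=
  (if i = j then 2 else 0) -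
    ((Nat.card {e : E // s e = i ∧ t e = j} : ℤ) + (Nat.card {e : E // s e = j ∧ t e = i} : ℤ))

/-- The simple reflection `s_i` of the root lattice `ℤ^I` associated to the generalized
Cartan matrix `C`: `s_i(α) = α − ⟨α, α_i^∨⟩ α_i` with `⟨α, α_i^∨⟩ = Σ_l C i l · α l`. -/
def simpleRefl {I : Type} [Fintype I] [DecidableEq I] (C : I → I → ℤ) (i : I) (α : I → ℤ) :
    I → ℤ :=
  fun j => α j - (if j = i then ∑ l : I, C i l * α l else 0)

/-- `β` and `α` lie in the same orbit of the Weyl group generated by the simple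
reflections. -/
def WeylEquiv {I : Type} [Fintype I] [DecidableEq I] (C : I → I → ℤ) (β α : I → ℤ) : Prop :=
  Relation.ReflTransGen (fun γ δ => ∃ i, δ = simpleRefl C i γ) β α

/-- The support of `β` is connected in the Dynkin diagram of `C` (vertices `a ≠ b` joined
iff `C a b < 0`). -/
def SuppConnected {I : Type} (C : I → I → ℤ) (β : I → ℤ) : Prop :=
  ∀ i j : I, β i ≠ 0 → β j ≠ 0 →
    Relation.ReflTransGen (fun a b => β a ≠ 0 ∧ β b ≠ 0 ∧ C a b < 0) i j

/-- `α` is a positive root of the Kac–Moody root system associated to the symmetric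
generalized Cartan matrix `C` (Kac's description): `α` is a nonzero nonnegative vector that
is either in the Weyl orbit of a simple root (a positive real root) or in the Weyl orbit
of a vector of the fundamental imaginary region — a nonzero nonnegative `β` with connected
support satisfying `Σ_l C i l · β l ≤ 0` for all `i` (a positive imaginary root). -/
def IsPosRoot {I : Type} [Fintype I] [DecidableEq I] (C : I → I → ℤ) (α : I → ℤ) : Prop :=
  (∀ i, 0 ≤ α i) ∧ α ≠ 0 ∧
    ((∃ i : I, WeylEquiv C (fun j => if j = i then 1 else 0) α) ∨
     (∃ β : I → ℤ, (∀ i, 0 ≤ β i) ∧ β ≠ 0 ∧ SuppConnected C β ∧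
        (∀ i, ∑ l : I, C i l * β l ≤ 0) ∧ WeylEquiv C β α))

namespace QRep

variable {k : Type} [Field k] {I E : Type} {s t : E → I}

/-- The coboundary map whose kernel is `Hom` and whose cokernel is `Ext¹`. -/
def dmap (M N : QRep k I E s t) :
    (∀ i, M.V i →ₗ[k] N.V i) →ₗ[k] (∀ e, M.V (s e) →ₗ[k] N.V (t e)) where
  toFun φ e := φ (t e) ∘ₗ M.f e - N.f e ∘ₗ φ (s e)
  map_add' φ ψ := by
    funext e; ext v; simp; abel
  map_smul' c φ := by
    funext e; ext v; simp [smul_sub]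

/-- Morphisms of representations. -/
def IsHom (M N : QRep k I E s t) (φ : ∀ i, M.V i →ₗ[k] N.V i) : Prop :=
  ∀ e v, φ (t e) (M.f e v) = N.f e (φ (s e) v)

def homs (M N : QRep k I E s t) : Submodule k (∀ i, M.V i →ₗ[k] N.V i) :=
  LinearMap.ker (dmap M N)

theorem mem_homs {M N : QRep k I E s t} {φ : ∀ i, M.V i →ₗ[k] N.V i} :
    φ ∈ homs M N ↔ IsHom M N φ := by
  unfold homs IsHom
  rw [LinearMap.mem_ker, funext_iff]
  refine forall_congr' fun e => ?_
  simp [dmap, LinearMap.ext_iff, sub_eq_zero]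

theorem IsHom.comp {M N P : QRep k I E s t} {φ : ∀ i, M.V i →ₗ[k] N.V i}
    {ψ : ∀ i, N.V i →ₗ[k] P.V i} (hψ : IsHom N P ψ) (hφ : IsHom M N φ) :
    IsHom M P (fun i => ψ i ∘ₗ φ i) := by
  intro e v; simp [hφ e v, hψ e]

theorem isHom_id (M : QRep k I E s t) : IsHom M M (fun _ => LinearMap.id) := by
  intro e v; simp

theorem IsHom.add {M N : QRep k I E s t} {φ ψ : ∀ i, M.V i →ₗ[k] N.V i}
    (hφ : IsHom M N φ) (hψ : IsHom M N ψ) : IsHom M N (fun i => φ i + ψ i) := by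
  intro e v; simp [hφ e v, hψ e v]

theorem IsHom.sub {M N : QRep k I E s t} {φ ψ : ∀ i, M.V i →ₗ[k] N.V i}
    (hφ : IsHom M N φ) (hψ : IsHom M N ψ) : IsHom M N (fun i => φ i - ψ i) := by
  intro e v; simp [hφ e v, hψ e v]

theorem IsHom.smul {M N : QRep k I E s t} {φ : ∀ i, M.V i →ₗ[k] N.V i}
    (c : k) (hφ : IsHom M N φ) : IsHom M N (fun i => c • φ i) := by
  intro e v; simp [hφ e v]

theorem Iso.refl (M : QRep k I E s t) : M.Iso M :=
  ⟨fun _ => LinearEquiv.refl k _, fun _ _ => rfl⟩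

theorem Iso.symm {M N : QRep k I E s t} (h : M.Iso N) : N.Iso M := by
  obtain ⟨φ, h⟩ := h
  refine ⟨fun i => (φ i).symm, fun e v => ?_⟩
  rw [LinearEquiv.symm_apply_eq, h]; simp

theorem Iso.trans {M N P : QRep k I E s t} (h : M.Iso N) (h' : N.Iso P) : M.Iso P := by
  obtain ⟨φ, h⟩ := h
  obtain ⟨ψ, h'⟩ := h'
  exact ⟨fun i => (φ i).trans (ψ i), fun e v => by simp [h, h']⟩

theorem Iso.dimVec {M N : QRep k I E s t} (h : M.Iso N) : M.dimVec = N.dimVec := by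
  obtain ⟨φ, -⟩ := h
  funext i; exact (φ i).finrank_eq

theorem Iso.isTrivial {M N : QRep k I E s t} (h : M.Iso N) (hM : M.IsTrivial) :
    N.IsTrivial := by
  obtain ⟨φ, -⟩ := h
  intro i
  have := hM i
  exact (φ i).symm.toEquiv.subsingleton

theorem Iso.indec {M N : QRep k I E s t} (h : M.Iso N) (hM : M.Indecomposable) :
    N.Indecomposable :=
  ⟨fun hN => hM.1 (h.symm.isTrivial hN), fun A B hA hB hAB => hM.2 A B hA hB (h.trans hAB)⟩

/-- Isomorphism from a pair of mutually inverse morphisms. -/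
theorem iso_of_inv {M N : QRep k I E s t} {φ : ∀ i, M.V i →ₗ[k] N.V i}
    {ψ : ∀ i, N.V i →ₗ[k] M.V i} (hφ : IsHom M N φ)
    (h1 : ∀ i, ψ i ∘ₗ φ i = LinearMap.id) (h2 : ∀ i, φ i ∘ₗ ψ i = LinearMap.id) : M.Iso N :=
  ⟨fun i => LinearEquiv.ofLinearMap (φ i) (ψ i) (h2 i) (h1 i), fun e v => hφ e v⟩

/-- Subrepresentation. -/
def subrep (M : QRep k I E s t) (U : ∀ i, Submodule k (M.V i))
    (hU : ∀ e, ∀ v ∈ U (s e), M.f e v ∈ U (t e)) : QRep k I E s t where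
  V i := U i
  f e := (M.f e).restrict (hU e)

theorem dimVec_dsum (A B : QRep k I E s t) (i : I) :
    (A.dsum B).dimVec i = A.dimVec i + B.dimVec i := by
  simp only [dimVec, dsum]
  exact Module.finrank_prod

theorem isTrivial_iff (M : QRep k I E s t) : M.IsTrivial ↔ M.dimVec = 0 := by
  unfold IsTrivial dimVec
  rw [funext_iff]
  refine forall_congr' fun i => ?_
  simp [Module.finrank_zero_iff]


section
variable (A B : QRep k I E s t)
def dInl (i : I) : A.V i →ₗ[k] (A.dsum B).V i := LinearMap.inl k (A.V i) (B.V i)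
def dInr (i : I) : B.V i →ₗ[k] (A.dsum B).V i := LinearMap.inr k (A.V i) (B.V i)
def dFst (i : I) : (A.dsum B).V i →ₗ[k] A.V i := LinearMap.fst k (A.V i) (B.V i)
def dSnd (i : I) : (A.dsum B).V i →ₗ[k] B.V i := LinearMap.snd k (A.V i) (B.V i)
theorem dFst_dInl (i : I) (v : A.V i) : dFst A B i (dInl A B i v) = v := rfl
theorem dSnd_dInr (i : I) (v : B.V i) : dSnd A B i (dInr A B i v) = v := rfl
theorem dsum_add (i : I) (v : (A.dsum B).V i) :
    dInl A B i (dFst A B i v) + dInr A B i (dSnd A B i v) = v :=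
  Prod.ext (add_zero (v : A.V i × B.V i).1) (zero_add (v : A.V i × B.V i).2)
theorem isHom_dInl : IsHom A (A.dsum B) (dInl A B) := fun e _ =>
  Prod.ext rfl (map_zero (B.f e)).symm
theorem isHom_dInr : IsHom B (A.dsum B) (dInr A B) := fun e _ =>
  Prod.ext (map_zero (A.f e)).symm rfl
theorem isHom_dFst : IsHom (A.dsum B) A (dFst A B) := fun _ _ => rfl
theorem isHom_dSnd : IsHom (A.dsum B) B (dSnd A B) := fun _ _ => rfl
end

/-- Biproduct data. -/
structure Bip (M A B : QRep k I E s t) where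
  ia : ∀ i, A.V i →ₗ[k] M.V i
  pa : ∀ i, M.V i →ₗ[k] A.V i
  ib : ∀ i, B.V i →ₗ[k] M.V i
  pb : ∀ i, M.V i →ₗ[k] B.V i
  hia : IsHom A M ia
  hpa : IsHom M A pa
  hib : IsHom B M ib
  hpb : IsHom M B pb
  paia : ∀ i v, pa i (ia i v) = v
  pbib : ∀ i v, pb i (ib i v) = v
  tot : ∀ i v, ia i (pa i v) + ib i (pb i v) = v

theorem Bip.paib {M A B : QRep k I E s t} (h : Bip M A B) (i : I) (v : B.V i) :
    h.pa i (h.ib i v) = 0 := by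
  have := congrArg (h.pa i) (h.tot i (h.ib i v))
  rw [map_add, h.paia, h.pbib] at this
  simpa using this

theorem Bip.pbia {M A B : QRep k I E s t} (h : Bip M A B) (i : I) (v : A.V i) :
    h.pb i (h.ia i v) = 0 := by
  have := congrArg (h.pb i) (h.tot i (h.ia i v))
  rw [map_add, h.paia, h.pbib] at this
  simpa using this

def dsumBip (A B : QRep k I E s t) : Bip (A.dsum B) A B :=
  ⟨dInl A B, dFst A B, dInr A B, dSnd A B, isHom_dInl A B, isHom_dFst A B, isHom_dInr A B,
    isHom_dSnd A B, dFst_dInl A B, dSnd_dInr A B, dsum_add A B⟩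

def Bip.swap {M A B : QRep k I E s t} (h : Bip M A B) : Bip M B A :=
  ⟨h.ib, h.pb, h.ia, h.pa, h.hib, h.hpb, h.hia, h.hpa, h.pbib, h.paia,
    fun i v => by rw [add_comm]; exact h.tot i v⟩

theorem Bip.iso_of {M N A B A' B' : QRep k I E s t} (h : Bip M A B) (h' : Bip N A' B')
    (hA : A.Iso A') (hB : B.Iso B') : M.Iso N := by
  obtain ⟨f, hf⟩ := hA
  obtain ⟨g, hg⟩ := hB
  refine iso_of_inv (φ := fun i => h'.ia i ∘ₗ (f i).toLinearMap ∘ₗ h.pa i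
      + h'.ib i ∘ₗ (g i).toLinearMap ∘ₗ h.pb i)
    (ψ := fun i => h.ia i ∘ₗ (f i).symm.toLinearMap ∘ₗ h'.pa i
      + h.ib i ∘ₗ (g i).symm.toLinearMap ∘ₗ h'.pb i) ?_ ?_ ?_
  · have hf' : IsHom A A' (fun i => (f i).toLinearMap) := hf
    have hg' : IsHom B B' (fun i => (g i).toLinearMap) := hg
    exact (h'.hia.comp (hf'.comp h.hpa)).add (h'.hib.comp (hg'.comp h.hpb))
  · intro i; ext v
    simp [h'.paia, h'.pbib, h'.paib, h'.pbia, h.tot]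
  · intro i; ext v
    simp [h.paia, h.pbib, h.paib, h.pbia, h'.tot]

theorem Bip.iso {M A B : QRep k I E s t} (h : Bip M A B) : M.Iso (A.dsum B) :=
  h.iso_of (dsumBip A B) (Iso.refl _) (Iso.refl _)

theorem Iso.bip {M A B : QRep k I E s t} (h : M.Iso (A.dsum B)) : Nonempty (Bip M A B) := by
  obtain ⟨φ, hφ⟩ := h
  have hφ' : IsHom (A.dsum B) M (fun i => (φ i).symm.toLinearMap) := by
    intro e v
    change (φ (t e)).symm _ = M.f e ((φ (s e)).symm v)
    rw [LinearEquiv.symm_apply_eq, hφ, LinearEquiv.apply_symm_apply]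
  have hφ2 : IsHom M (A.dsum B) (fun i => (φ i).toLinearMap) := hφ
  refine ⟨⟨_, _, _, _, hφ'.comp (isHom_dInl A B), (isHom_dFst A B).comp hφ2,
    hφ'.comp (isHom_dInr A B), (isHom_dSnd A B).comp hφ2, ?_, ?_, ?_⟩⟩
  · intro i v; simp [dFst_dInl]
  · intro i v; simp [dSnd_dInr]
  · intro i v
    simp only [LinearMap.comp_apply, LinearEquiv.coe_coe]
    rw [← map_add, dsum_add, LinearEquiv.symm_apply_apply]

/-- Inclusion of a subrepresentation. -/
def subInc (M : QRep k I E s t) (U : ∀ i, Submodule k (M.V i))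
    (hU : ∀ e, ∀ v ∈ U (s e), M.f e v ∈ U (t e)) (i : I) : (M.subrep U hU).V i →ₗ[k] M.V i :=
  (U i).subtype

theorem isHom_subInc (M : QRep k I E s t) (U : ∀ i, Submodule k (M.V i))
    (hU : ∀ e, ∀ v ∈ U (s e), M.f e v ∈ U (t e)) : IsHom _ M (subInc M U hU) :=
  fun _ _ => rfl

theorem subInc_inj (M : QRep k I E s t) (U : ∀ i, Submodule k (M.V i))
    (hU : ∀ e, ∀ v ∈ U (s e), M.f e v ∈ U (t e)) (i : I) :
    Function.Injective (subInc M U hU i) := Subtype.val_injective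

/-- Lift of a morphism landing in a subrepresentation. -/
def subLift (M : QRep k I E s t) (U : ∀ i, Submodule k (M.V i))
    (hU : ∀ e, ∀ v ∈ U (s e), M.f e v ∈ U (t e)) {N : QRep k I E s t}
    (φ : ∀ i, N.V i →ₗ[k] M.V i) (h : ∀ i v, φ i v ∈ U i) (i : I) :
    N.V i →ₗ[k] (M.subrep U hU).V i := (φ i).codRestrict (U i) (h i)

theorem subInc_subLift (M : QRep k I E s t) (U : ∀ i, Submodule k (M.V i))
    (hU : ∀ e, ∀ v ∈ U (s e), M.f e v ∈ U (t e)) {N : QRep k I E s t}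
    (φ : ∀ i, N.V i →ₗ[k] M.V i) (h : ∀ i v, φ i v ∈ U i) (i : I) (v : N.V i) :
    subInc M U hU i (subLift M U hU φ h i v) = φ i v := rfl

theorem isHom_subLift (M : QRep k I E s t) (U : ∀ i, Submodule k (M.V i))
    (hU : ∀ e, ∀ v ∈ U (s e), M.f e v ∈ U (t e)) {N : QRep k I E s t}
    (φ : ∀ i, N.V i →ₗ[k] M.V i) (h : ∀ i v, φ i v ∈ U i) (hφ : IsHom N M φ) :
    IsHom N _ (subLift M U hU φ h) := fun e v => Subtype.ext (hφ e v)

theorem exists_bip_of_idem (M : QRep k I E s t) (p : ∀ i, M.V i →ₗ[k] M.V i) (hp : IsHom M M p)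
    (hpp : ∀ i v, p i (p i v) = p i v) :
    ∃ (A B : QRep k I E s t) (h : Bip M A B), ∀ i v, h.ia i (h.pa i v) = p i v := by
  have hA : ∀ e, ∀ v ∈ LinearMap.range (p (s e)), M.f e v ∈ LinearMap.range (p (t e)) := by
    rintro e _ ⟨v, rfl⟩
    exact ⟨M.f e v, hp e v⟩
  have hB : ∀ e, ∀ v ∈ LinearMap.ker (p (s e)), M.f e v ∈ LinearMap.ker (p (t e)) := by
    intro e v hv
    simp only [LinearMap.mem_ker] at hv ⊢
    rw [hp, hv, map_zero]
  let U := fun i => LinearMap.range (p i)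
  let W := fun i => LinearMap.ker (p i)
  refine ⟨subrep M U hA, subrep M W hB, ⟨subInc M U hA, subLift M U hA p (fun i v => ⟨v, rfl⟩),
    subInc M W hB, subLift M W hB (fun i => LinearMap.id - p i)
      (fun i v => by simp [W, hpp]), isHom_subInc _ _ _, isHom_subLift _ _ _ _ _ hp,
      isHom_subInc _ _ _, isHom_subLift _ _ _ _ _ ((isHom_id M).sub hp), ?_, ?_, ?_⟩, ?_⟩
  · rintro i ⟨_, w, rfl⟩
    exact Subtype.ext (hpp i w)
  · rintro i ⟨v, hv⟩
    refine Subtype.ext ?_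
    change v - p i v = v
    rw [LinearMap.mem_ker.1 hv, sub_zero]
  · intro i v
    change p i v + (v - p i v) = v
    abel
  · intro i v; rfl

theorem indec_iff (M : QRep k I E s t) : M.Indecomposable ↔ ¬ M.IsTrivial ∧
    ∀ p : ∀ i, M.V i →ₗ[k] M.V i, IsHom M M p → (∀ i v, p i (p i v) = p i v) →
      (∀ i v, p i v = 0) ∨ (∀ i v, p i v = v) := by
  constructor
  · rintro ⟨h1, h2⟩
    refine ⟨h1, fun p hp hpp => ?_⟩
    obtain ⟨A, B, h, hh⟩ := exists_bip_of_idem M p hp hpp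
    by_contra hcon
    push Not at hcon
    obtain ⟨⟨a, v, ha⟩, ⟨b, w, hb⟩⟩ := hcon
    refine h2 A B ?_ ?_ h.iso
    · intro hA
      have := hA a
      apply ha
      rw [← hh, Subsingleton.elim (h.pa a v) 0, map_zero]
    · intro hB
      have := hB b
      apply hb
      have := h.tot b w
      rw [Subsingleton.elim (h.pb b w) 0, map_zero, add_zero, hh] at this
      exact this
  · rintro ⟨h1, h2⟩
    refine ⟨h1, ?_⟩
    rintro A B hA hB hAB
    obtain ⟨h⟩ := hAB.bip
    rcases h2 _ (h.hia.comp h.hpa) (fun i v => by simp [h.paia]) with key | key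
    · apply hA
      refine fun i => ⟨fun a b => ?_⟩
      have h1 := congrArg (h.pa i) (key i (h.ia i a))
      have h2 := congrArg (h.pa i) (key i (h.ia i b))
      simp [h.paia] at h1 h2
      rw [h1, h2]
    · apply hB
      refine fun i => ⟨fun a b => ?_⟩
      have h1 := congrArg (h.pb i) (key i (h.ib i a))
      have h2 := congrArg (h.pb i) (key i (h.ib i b))
      simp [h.pbib, h.paib] at h1 h2
      rw [← h1, ← h2]

end QRep

theorem unit_or_nilp_of_idem {k A : Type*} [Field k] [Ring A] [Algebra k A] [Module.Finite k A]
    (h : ∀ e : A, e * e = e → e = 0 ∨ e = 1) (a : A) : IsUnit a ∨ IsNilpotent a := by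
  classical
  have ha : IsIntegral k a := IsIntegral.of_finite k a
  have hne := minpoly.ne_zero ha
  obtain ⟨n, g, hg, hg0⟩ : ∃ (n : ℕ) (g : Polynomial k), minpoly k a = Polynomial.X ^ n * g ∧
      ¬ Polynomial.X ∣ g := by
    obtain ⟨g, hg, hg0⟩ := (minpoly k a).exists_eq_pow_rootMultiplicity_mul_and_not_dvd hne 0
    rw [Polynomial.C_0, sub_zero] at hg hg0
    exact ⟨_, g, hg, hg0⟩
  have hc : IsCoprime (Polynomial.X ^ (n + 1) : Polynomial k) g :=
    ((Polynomial.irreducible_X.coprime_iff_not_dvd).2 hg0).pow_left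
  obtain ⟨u, v, huv⟩ := hc
  have hz : Polynomial.aeval a (Polynomial.X ^ n * g) = 0 := by rw [← hg]; exact minpoly.aeval k a
  have h1 : Polynomial.aeval a (u * Polynomial.X ^ (n + 1)) + Polynomial.aeval a (v * g) = 1 := by
    rw [← map_add, huv, map_one]
  have h0 : Polynomial.aeval a (u * Polynomial.X ^ (n + 1)) * Polynomial.aeval a (v * g) = 0 := by
    rw [← map_mul, show u * Polynomial.X ^ (n + 1) * (v * g) =
      u * v * Polynomial.X * (Polynomial.X ^ n * g) by ring, map_mul, hz, mul_zero]
  obtain ⟨e, he⟩ : ∃ e, e = Polynomial.aeval a (u * Polynomial.X ^ (n + 1)) := ⟨_, rfl⟩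
  rw [← he] at h1 h0
  have hee : e * e = e := by
    have : e * (e + Polynomial.aeval a (v * g)) = e := by rw [h1, mul_one]
    rw [mul_add, h0, add_zero] at this; exact this
  rcases h e hee with h2 | h2
  · right
    refine ⟨n, ?_⟩
    rw [h2, zero_add] at h1
    have : Polynomial.aeval a (v * (Polynomial.X ^ n * g)) = 0 := by rw [map_mul, hz, mul_zero]
    rw [show v * (Polynomial.X ^ n * g) = (v * g) * Polynomial.X ^ n by ring, map_mul, h1,
      one_mul] at this
    simpa using this
  · left
    refine isUnit_iff_exists.2 ⟨Polynomial.aeval a (u * Polynomial.X ^ n), ?_, ?_⟩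
    · have : a * Polynomial.aeval a (u * Polynomial.X ^ n) =
          Polynomial.aeval a (Polynomial.X * (u * Polynomial.X ^ n)) := by
        rw [map_mul _ Polynomial.X, Polynomial.aeval_X]
      rw [this, ← h2, he]; congr 1; ring
    · have : Polynomial.aeval a (u * Polynomial.X ^ n) * a =
          Polynomial.aeval a ((u * Polynomial.X ^ n) * Polynomial.X) := by
        rw [map_mul _ _ Polynomial.X, Polynomial.aeval_X]
      rw [this, ← h2, he]; congr 1; ring

namespace QRep

variable {k : Type} [Field k] {I E : Type} {s t : E → I}

/-- The endomorphism algebra. -/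
def endAlg (M : QRep k I E s t) : Subalgebra k (∀ i, Module.End k (M.V i)) where
  carrier := {φ | IsHom M M φ}
  mul_mem' ha hb := ha.comp hb
  add_mem' ha hb := ha.add hb
  algebraMap_mem' c := (isHom_id M).smul c

def IsHom.toEnd {M : QRep k I E s t} {φ : ∀ i, M.V i →ₗ[k] M.V i} (h : IsHom M M φ) : M.endAlg :=
  ⟨φ, h⟩

theorem mem_endAlg {M : QRep k I E s t} {φ : ∀ i, Module.End k (M.V i)} :
    φ ∈ M.endAlg ↔ IsHom M M φ := Iff.rfl

instance [Finite I] (M : QRep k I E s t) : Module.Finite k M.endAlg :=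
  inferInstanceAs (Module.Finite k (Subalgebra.toSubmodule M.endAlg))

theorem indec_iff_endAlg (M : QRep k I E s t) : M.Indecomposable ↔ Nontrivial M.endAlg ∧
    ∀ e : M.endAlg, e * e = e → e = 0 ∨ e = 1 := by
  rw [indec_iff]
  refine and_congr ?_ ?_
  · rw [← not_iff_not, not_not, not_nontrivial_iff_subsingleton]
    constructor
    · intro h
      refine ⟨fun a b => Subtype.ext (funext fun i => LinearMap.ext fun v => ?_)⟩
      have := h i
      exact Subsingleton.elim _ _
    · intro h i
      refine ⟨fun a b => ?_⟩
      have := congrArg Subtype.val (Subsingleton.elim (1 : M.endAlg) 0)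
      have h1 := fun v => LinearMap.congr_fun (congrFun this i) v
      have h2 := h1 a
      have h3 := h1 b
      change a = 0 at h2
      change b = 0 at h3
      rw [h2, h3]
  · constructor
    · rintro h ⟨p, hp⟩ hpp
      rcases h p hp (fun i v => LinearMap.congr_fun (congrFun (congrArg Subtype.val hpp) i) v)
        with h | h
      · left; exact Subtype.ext (funext fun i => LinearMap.ext (h i))
      · right; exact Subtype.ext (funext fun i => LinearMap.ext (h i))
    · intro h p hp hpp
      rcases h ⟨p, hp⟩ (Subtype.ext (funext fun i => LinearMap.ext (hpp i))) with h | h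
      · left; exact fun i v => LinearMap.congr_fun (congrFun (congrArg Subtype.val h) i) v
      · right; exact fun i v => LinearMap.congr_fun (congrFun (congrArg Subtype.val h) i) v

theorem Indecomposable.unit_or_nilp [Finite I] {M : QRep k I E s t} (h : M.Indecomposable)
    (a : M.endAlg) : IsUnit a ∨ IsNilpotent a :=
  unit_or_nilp_of_idem (k := k) ((indec_iff_endAlg M).1 h).2 a

theorem Indecomposable.isUnit_or [Finite I] {M : QRep k I E s t} (h : M.Indecomposable)
    {a b : M.endAlg} (hab : IsUnit (a + b)) : IsUnit a ∨ IsUnit b := by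
  rcases h.unit_or_nilp a with ha | ha
  · exact Or.inl ha
  right
  obtain ⟨u, hu⟩ := hab
  have h1 : ¬ IsUnit (↑u⁻¹ * a) := by
    intro h2
    have h3 : IsUnit a := by
      have := u.isUnit.mul h2
      rwa [Units.mul_inv_cancel_left] at this
    have := ((indec_iff_endAlg M).1 h).1
    exact ha.not_isUnit h3
  have h2 := (h.unit_or_nilp (↑u⁻¹ * a)).resolve_left h1
  have h3 := h2.isUnit_one_sub
  have h4 := u.isUnit.mul h3
  rw [mul_sub, mul_one, Units.mul_inv_cancel_left, hu] at h4
  simpa using h4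

/-- Exchange data in pointwise form. -/
theorem Indecomposable.inv_of_add [Finite I] {M : QRep k I E s t} (h : M.Indecomposable)
    {a b : ∀ i, M.V i →ₗ[k] M.V i} (ha : IsHom M M a) (hb : IsHom M M b)
    (hab : ∀ i v, a i v + b i v = v) :
    (∃ c, IsHom M M c ∧ (∀ i v, c i (a i v) = v) ∧ (∀ i v, a i (c i v) = v)) ∨
    (∃ c, IsHom M M c ∧ (∀ i v, c i (b i v) = v) ∧ (∀ i v, b i (c i v) = v)) := by
  have key : ∀ a : M.endAlg, IsUnit a → 
    (∃ c, IsHom M M c ∧ (∀ i v, c i (a.1 i v) = v) ∧ (∀ i v, a.1 i (c i v) = v)) := by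
    rintro a ⟨u, rfl⟩
    refine ⟨(↑u⁻¹ : M.endAlg).1, (↑u⁻¹ : M.endAlg).2, ?_, ?_⟩
    · intro i v
      exact LinearMap.congr_fun (congrFun (congrArg Subtype.val u.inv_mul) i) v
    · intro i v
      exact LinearMap.congr_fun (congrFun (congrArg Subtype.val u.mul_inv) i) v
  have h1 : (⟨a, ha⟩ : M.endAlg) + ⟨b, hb⟩ = 1 :=
    Subtype.ext (funext fun i => LinearMap.ext (hab i))
  rcases h.isUnit_or (h1 ▸ isUnit_one) with h2 | h2
  · exact Or.inl (key _ h2)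
  · exact Or.inr (key _ h2)

theorem bip_dimVec {M A B : QRep k I E s t} (h : Bip M A B) : M.dimVec = A.dimVec + B.dimVec := by
  rw [h.iso.dimVec]; funext i; exact dimVec_dsum A B i

/-- A split mono gives a direct summand. -/
theorem exists_bip_of_split {L M : QRep k I E s t} {f : ∀ i, L.V i →ₗ[k] M.V i}
    {g : ∀ i, M.V i →ₗ[k] L.V i} (hf : IsHom L M f) (hg : IsHom M L g)
    (hgf : ∀ i v, g i (f i v) = v) : ∃ B, Nonempty (Bip M L B) := by
  obtain ⟨A, B, h, hh⟩ := exists_bip_of_idem M _ (hf.comp hg) (fun i v => by simp [hgf])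
  simp only [LinearMap.comp_apply] at hh
  refine ⟨B, ⟨⟨f, g, h.ib, h.pb, hf, hg, h.hib, h.hpb, hgf, h.pbib, fun i v => ?_⟩⟩⟩
  rw [← hh]; exact h.tot i v

/-- Indecomposables are prime. -/
theorem Indecomposable.prime [Finite I] {L M A B C : QRep k I E s t} (hL : L.Indecomposable)
    (h : Bip M L A) (h' : Bip M B C) : (∃ B', Nonempty (Bip B L B')) ∨
      (∃ C', Nonempty (Bip C L C')) := by
  have h1 := h'.hpa.comp h.hia
  have h2 := h.hpa.comp h'.hia
  have h3 := h'.hpb.comp h.hia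
  have h4 := h.hpa.comp h'.hib
  rcases hL.inv_of_add (h2.comp h1) (h4.comp h3) (fun i v => by
    simp [← map_add, h'.tot, h.paia]) with ⟨c, hc, h5, -⟩ | ⟨c, hc, h5, -⟩
  · exact Or.inl (exists_bip_of_split h1 (hc.comp h2) (fun i v => by simpa using h5 i v))
  · exact Or.inr (exists_bip_of_split h3 (hc.comp h4) (fun i v => by simpa using h5 i v))

theorem schur_iso {L M A D : QRep k I E s t} 
    (h : Bip M L A) (h' : Bip M L D) {c : ∀ i, L.V i →ₗ[k] L.V i} (hc : IsHom L L c)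
    (h1 : ∀ i v, c i (h'.pa i (h.ia i v)) = v) (h2 : ∀ i v, h'.pa i (h.ia i (c i v)) = v) :
    A.Iso D := by
  refine iso_of_inv (φ := fun i => h'.pb i ∘ₗ (h.ib i - h.ia i ∘ₗ c i ∘ₗ h'.pa i ∘ₗ h.ib i))
    (ψ := fun i => h.pb i ∘ₗ h'.ib i) ?_ ?_ ?_
  · exact h'.hpb.comp (h.hib.sub (h.hia.comp (hc.comp (h'.hpa.comp h.hib))))
  · intro i; ext v
    set w := h.ib i v - h.ia i (c i (h'.pa i (h.ib i v))) with hw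
    have e1 : h'.pa i w = 0 := by rw [hw, map_sub, h2, sub_self]
    have e2 := h'.tot i w
    rw [e1, map_zero, zero_add] at e2
    change h.pb i (h'.ib i (h'.pb i w)) = v
    rw [e2, hw, map_sub, h.pbib, h.pbia, sub_zero]
  · intro i; ext v
    set w := h.pb i (h'.ib i v) with hw
    have e1 := h.tot i (h'.ib i v)
    rw [← hw] at e1
    have e2 : h.ib i w = h'.ib i v - h.ia i (h.pa i (h'.ib i v)) := eq_sub_of_add_eq' e1
    change h'.pb i (h.ib i w - h.ia i (c i (h'.pa i (h.ib i w)))) = v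
    rw [e2, map_sub (h'.pa i), h'.paib, zero_sub, map_neg, map_neg, h1, sub_neg_eq_add,
      sub_add_cancel, h'.pbib]

/-- Indecomposables cancel. -/
theorem Indecomposable.cancel [Finite I] {L M A D : QRep k I E s t} (hL : L.Indecomposable)
    (h : Bip M L A) (h' : Bip M L D) : A.Iso D := by
  rcases hL.inv_of_add (h.hpa.comp (h'.hia.comp (h'.hpa.comp h.hia)))
    (h.hpa.comp (h'.hib.comp (h'.hpb.comp h.hia))) (fun i v => by
    simp [← map_add, h'.tot, h.paia]) with ⟨c, hc, h5, h6⟩ | ⟨c, hc, h5, h6⟩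
  · -- `x * y` is a unit where `y = pa' ia`, so `y` is a unit
    obtain ⟨u, hu⟩ : IsUnit ((h.hpa.comp h'.hia).toEnd * (h'.hpa.comp h.hia).toEnd) :=
      isUnit_iff_exists.2 ⟨⟨c, hc⟩, Subtype.ext (funext fun i => LinearMap.ext (h6 i)),
        Subtype.ext (funext fun i => LinearMap.ext (h5 i))⟩
    set x : L.endAlg := (h.hpa.comp h'.hia).toEnd
    set y : L.endAlg := (h'.hpa.comp h.hia).toEnd
    have hl : (↑u⁻¹ * x) * y = 1 := by rw [mul_assoc, ← hu, Units.inv_mul]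
    have : IsArtinianRing L.endAlg := IsArtinianRing.of_finite k _
    have hr : y * (↑u⁻¹ * x) = 1 := mul_eq_one_symm hl
    obtain ⟨z, hz⟩ : ∃ z : L.endAlg, z = ↑u⁻¹ * x := ⟨_, rfl⟩
    rw [← hz] at hl hr
    exact schur_iso h h' z.2
      (fun i v => LinearMap.congr_fun (congrFun (congrArg Subtype.val hl) i) v)
      (fun i v => LinearMap.congr_fun (congrFun (congrArg Subtype.val hr) i) v)
  · by_cases hy : IsUnit (h'.hpa.comp h.hia).toEnd
    · obtain ⟨u, hu⟩ := hy
      exact schur_iso h h' (↑u⁻¹ : L.endAlg).2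
        (fun i v => by
          have := LinearMap.congr_fun (congrFun (congrArg Subtype.val u.inv_mul) i) v
          rw [hu] at this; exact this)
        (fun i v => by
          have := LinearMap.congr_fun (congrFun (congrArg Subtype.val u.mul_inv) i) v
          rw [hu] at this; exact this)
    · -- modify the second decomposition
      have hx : IsHom D L (fun i => h.pa i ∘ₗ h'.ib i) := h.hpa.comp h'.hib
      let h'' : Bip M L D := ⟨h'.ia, fun i => h'.pa i + (h.pa i ∘ₗ h'.ib i) ∘ₗ h'.pb i,
        fun i => h'.ib i - h'.ia i ∘ₗ (h.pa i ∘ₗ h'.ib i), h'.pb, h'.hia,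
        h'.hpa.add (hx.comp h'.hpb), h'.hib.sub (h'.hia.comp hx), h'.hpb,
        fun i v => by simp [h'.paia, h'.pbia], fun i v => by simp [h'.pbib, h'.pbia],
        fun i v => by
          have := h'.tot i v
          simp only [LinearMap.add_apply, LinearMap.sub_apply, LinearMap.comp_apply, map_add]
          rw [← this]
          simp only [map_add, h'.paia, h'.pbia, h'.paib, h'.pbib]
          simp⟩
      have hs : IsUnit ((h''.hpa.comp h.hia).toEnd - (h'.hpa.comp h.hia).toEnd) := by
        refine isUnit_iff_exists.2 ⟨⟨c, hc⟩, Subtype.ext (funext fun i => LinearMap.ext fun v => ?_),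
          Subtype.ext (funext fun i => LinearMap.ext fun v => ?_)⟩
        · refine Eq.trans ?_ (h6 i v)
          exact add_sub_cancel_left _ _
        · refine Eq.trans ?_ (h5 i v)
          exact congrArg (c i) (add_sub_cancel_left _ _)
      rw [sub_eq_add_neg] at hs
      obtain ⟨u, hu⟩ := (hL.isUnit_or hs).resolve_right (fun h => hy (by simpa using h.neg))
      exact schur_iso h h'' (↑u⁻¹ : L.endAlg).2
        (fun i v => by
          have := LinearMap.congr_fun (congrFun (congrArg Subtype.val u.inv_mul) i) v
          rw [hu] at this; exact this)
        (fun i v => by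
          have := LinearMap.congr_fun (congrFun (congrArg Subtype.val u.mul_inv) i) v
          rw [hu] at this; exact this)

end QRep

open Equiv.Perm in
theorem pow_apply_self_iff {X : Type*} [Fintype X] [DecidableEq X] (a : Equiv.Perm X) (x : X) (j : ℕ) :
    (a ^ j) x = x ↔ orderOf (a.cycleOf x) ∣ j := by
  rw [orderOf_dvd_iff_pow_eq_one]
  by_cases hx : a x = x
  · have h1 : a.cycleOf x = 1 := cycleOf_eq_one_iff a |>.2 hx
    rw [h1]
    simp [pow_apply_eq_self_of_apply_eq_self hx]
  · rw [(isCycle_cycleOf a hx).pow_eq_one_iff' (x := x) (by simpa [cycleOf_apply_self] using hx),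
      cycleOf_pow_apply_self]

open Equiv.Perm Finset in
theorem card_orderOf_cycleOf {X : Type*} [Fintype X] [DecidableEq X] (a : Equiv.Perm X) (d : ℕ)
    (hd : 2 ≤ d) : #{x | orderOf (a.cycleOf x) = d} = d * a.cycleType.count d := by
  have h1 : ({x | orderOf (a.cycleOf x) = d} : Finset X) =
      ({c ∈ a.cycleFactorsFinset | #c.support = d} : Finset _).biUnion (fun c => c.support) := by
    ext x
    simp only [mem_filter, mem_univ, true_and, mem_biUnion]
    constructor
    · intro h
      have hx : a x ≠ x := by
        intro hx
        rw [(cycleOf_eq_one_iff a).2 hx, orderOf_one] at h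
        omega
      refine ⟨a.cycleOf x, ⟨cycleOf_mem_cycleFactorsFinset_iff.2 (mem_support.2 hx), ?_⟩, ?_⟩
      · rw [← (isCycle_cycleOf a hx).orderOf, h]
      · simpa [cycleOf_apply_self] using hx
    · rintro ⟨c, ⟨hc, hcd⟩, hxc⟩
      have := (eq_cycleOf_of_mem_cycleFactorsFinset_iff a c hc x).2 hxc
      rw [← this, ← hcd, (mem_cycleFactorsFinset_iff.1 hc).1.orderOf]
  rw [h1, card_biUnion, sum_const_nat (m := d), cycleType_def, Multiset.count_map, mul_comm]
  · congr 1
    rw [Finset.card_def, Finset.filter_val]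
    congr 1
    apply Multiset.filter_congr
    intro c _
    simp [eq_comm]
  · simp
  · intro c hc c' hc' hne
    refine disjoint_iff_disjoint_support.1 ?_
    exact cycleFactorsFinset_pairwise_disjoint a (mem_filter.1 hc).1 (mem_filter.1 hc').1 hne

open Finset in
theorem permFix {X Y : Type*} [Finite X] [Finite Y] (a : Equiv.Perm X) (b : Equiv.Perm Y)
    (h : ∀ j : ℕ, Nat.card {x // (a ^ j) x = x} = Nat.card {y // (b ^ j) y = y}) :
    ∃ e : X ≃ Y, ∀ x, e (a x) = b (e x) := by
  classical
  have := Fintype.ofFinite X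
  have := Fintype.ofFinite Y
  have hcard : Nat.card X = Nat.card Y := by simpa using h 0
  let e₀ : X ≃ Y := Fintype.equivOfCardEq (by simpa [Nat.card_eq_fintype_card] using hcard)
  have key : ∀ (a b : Equiv.Perm X),
      (∀ j : ℕ, Nat.card {x // (a ^ j) x = x} = Nat.card {y // (b ^ j) y = y}) → IsConj a b := by
    intro a b h
    rw [Equiv.Perm.isConj_iff_cycleType_eq]
    have hn : ∀ d : ℕ, 0 < d → #{x | orderOf (a.cycleOf x) = d} =
        #{x | orderOf (b.cycleOf x) = d} := by
      have hs : ∀ (c : Equiv.Perm X) (d : ℕ), 0 < d → Nat.card {x // (c ^ d) x = x} =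
          ∑ d' ∈ d.properDivisors, #{x | orderOf (c.cycleOf x) = d'} +
            #{x | orderOf (c.cycleOf x) = d} := by
        intro c d hd
        rw [add_comm, ← Finset.sum_insert (f := fun d => #{x | orderOf (c.cycleOf x) = d})
          Nat.self_notMem_properDivisors, Nat.insert_self_properDivisors hd.ne']
        rw [Nat.card_eq_fintype_card, Fintype.card_subtype]
        simp only [pow_apply_self_iff]
        rw [Finset.card_eq_sum_card_fiberwise (f := fun x => orderOf (c.cycleOf x))
          (t := d.divisors)]
        · refine sum_congr rfl fun d' hd' => ?_
          congr 1; ext x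
          simp only [mem_filter, mem_univ, true_and]
          exact ⟨fun h => h.2, fun h => ⟨h ▸ (Nat.mem_divisors.1 hd').1, h⟩⟩
        · intro x hx
          simp only [coe_filter, mem_univ, true_and, Set.mem_setOf_eq] at hx
          exact Nat.mem_divisors.2 ⟨hx, hd.ne'⟩
      intro d
      induction d using Nat.strong_induction_on with
      | _ d ih =>
        intro hd
        have h1 := h d
        rw [hs a d hd, hs b d hd] at h1
        have h2 : ∑ d' ∈ d.properDivisors, #{x | orderOf (a.cycleOf x) = d'} =
            ∑ d' ∈ d.properDivisors, #{x | orderOf (b.cycleOf x) = d'} :=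
          sum_congr rfl fun d' hd' =>
            ih d' (Nat.mem_properDivisors.1 hd').2 (Nat.pos_of_mem_properDivisors hd')
        omega
    ext d
    by_cases hd : 2 ≤ d
    · have := hn d (by omega)
      rw [card_orderOf_cycleOf a d hd, card_orderOf_cycleOf b d hd] at this
      exact Nat.eq_of_mul_eq_mul_left (by omega) this
    · rw [Multiset.count_eq_zero_of_notMem, Multiset.count_eq_zero_of_notMem]
      · exact fun h => hd (Equiv.Perm.two_le_of_mem_cycleType h)
      · exact fun h => hd (Equiv.Perm.two_le_of_mem_cycleType h)
  obtain ⟨c, hc⟩ := isConj_iff.1 (key a (e₀.symm.permCongr b) (fun j => by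
    rw [h j]
    refine Nat.card_congr (e₀.symm.subtypeEquiv fun y => ?_)
    have : ((e₀.symm.permCongr b) ^ j) = e₀.symm.permCongr (b ^ j) :=
      (map_pow (e₀.symm.permCongrHom) b j).symm
    rw [this]
    simp))
  refine ⟨c.trans e₀, fun x => ?_⟩
  have := congrArg (fun p : Equiv.Perm X => e₀ (p (c x))) hc
  simpa using this

theorem subPerm_pow {Y : Type*} (T : Equiv.Perm Y) {p : Y → Prop} (h : ∀ y, p (T y) ↔ p y)
    (j : ℕ) (y : {y // p y}) : (((T.subtypePerm h) ^ j) y : Y) = (T ^ j) y := by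
  induction j with
  | zero => rfl
  | succ j ih => rw [pow_succ', pow_succ', Equiv.Perm.mul_apply, Equiv.Perm.mul_apply, ← ih]; rfl

def msEquiv {A B : Type*} (e : A ≃ B) : Multiset A ≃ Multiset B where
  toFun m := m.map e
  invFun m := m.map e.symm
  left_inv m := by simp
  right_inv m := by simp

theorem pow_dim {Y D : Type*} (T : Equiv.Perm Y) (d : Y → D) (h : ∀ y, d (T y) = d y) (j : ℕ)
    (y : Y) : d ((T ^ j) y) = d y := by
  induction j with
  | zero => rfl
  | succ j ih => rw [pow_succ', Equiv.Perm.mul_apply, h, ih]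

section
variable {I : Type*} [Fintype I]

theorem card_fixM {Y : Type*} (d : Y → I → ℕ) (T : Equiv.Perm Y) (hd : ∀ y, d (T y) = d y)
    (hd0 : ∀ y, d y ≠ 0) (α : I → ℕ) (hfin : Finite {m : Multiset Y // (m.map d).sum = α})
    (j : ℕ) (hT : ∀ y, (∑ i, d (T y) i < ∑ i, α i) ↔ (∑ i, d y i < ∑ i, α i)) :
    Finite {y // d y = α} ∧
    Nat.card {m : Multiset Y // (m.map d).sum = α ∧ m.map (T ^ j) = m} =
    Nat.card {m : Multiset {y // ∑ i, d y i < ∑ i, α i} // (m.map (fun y => d y.1)).sum = α ∧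
      m.map ((T.subtypePerm hT) ^ j) = m} + Nat.card {y // d y = α ∧ (T ^ j) y = y} := by
  have hY : Finite {y // d y = α} := by
    refine Finite.of_injective (fun y : {y // d y = α} =>
      (⟨{y.1}, by simp [y.2]⟩ : {m : Multiset Y // (m.map d).sum = α})) ?_
    intro y y' h
    simpa [Subtype.ext_iff] using h
  refine ⟨hY, ?_⟩
  have hf1 : Finite {y // d y = α ∧ (T ^ j) y = y} :=
    Finite.of_injective (fun y => (⟨y.1, y.2.1⟩ : {y // d y = α})) (fun a b h => by
      simpa [Subtype.ext_iff] using h)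
  set A := {y // ∑ i, d y i < ∑ i, α i}
  have hf2 : Finite {m : Multiset A // (m.map (fun y => d y.1)).sum = α ∧
      m.map ((T.subtypePerm hT) ^ j) = m} := by
    refine Finite.of_injective (fun m => (⟨m.1.map Subtype.val, by
      rw [Multiset.map_map]; exact m.2.1⟩ : {m : Multiset Y // (m.map d).sum = α})) ?_
    intro m m' h
    exact Subtype.ext (Multiset.map_injective Subtype.val_injective (Subtype.ext_iff.1 h))
  rw [← Nat.card_sum]
  symm
  let g : {m : Multiset A // (m.map (fun y => d y.1)).sum = α ∧ m.map ((T.subtypePerm hT) ^ j) = m} ⊕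
      {y // d y = α ∧ (T ^ j) y = y} →
      {m : Multiset Y // (m.map d).sum = α ∧ m.map (T ^ j) = m} :=
    Sum.elim (fun m => ⟨m.1.map Subtype.val, by rw [Multiset.map_map]; exact m.2.1, by
      conv_rhs => rw [← m.2.2]
      rw [Multiset.map_map, Multiset.map_map]
      exact Multiset.map_congr rfl fun y _ => (subPerm_pow T hT j y).symm⟩)
      (fun y => ⟨{y.1}, by simp [y.2.1], by simp [y.2.2]⟩)
  refine Nat.card_congr (Equiv.ofBijective g ⟨?_, ?_⟩)
  · rintro (⟨m, hm⟩ | ⟨y, hy⟩) (⟨m', hm'⟩ | ⟨y', hy'⟩) h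
    · congr 1
      exact Subtype.ext (Multiset.map_injective Subtype.val_injective (Subtype.ext_iff.1 h))
    · exfalso
      have h1 : m.map Subtype.val = {y'} := Subtype.ext_iff.1 h
      have h2 : y' ∈ m.map Subtype.val := by rw [h1]; simp
      obtain ⟨z, -, rfl⟩ := Multiset.mem_map.1 h2
      have := z.2
      rw [hy'.1] at this
      exact lt_irrefl _ this
    · exfalso
      have h1 : {y} = m'.map Subtype.val := Subtype.ext_iff.1 h
      have h2 : y ∈ m'.map Subtype.val := by rw [← h1]; simp
      obtain ⟨z, -, rfl⟩ := Multiset.mem_map.1 h2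
      have := z.2
      rw [hy.1] at this
      exact lt_irrefl _ this
    · congr 1
      have h1 : ({y} : Multiset Y) = {y'} := Subtype.ext_iff.1 h
      exact Subtype.ext (by simpa using h1)
  · rintro ⟨m, hm, hmT⟩
    by_cases hall : ∀ y ∈ m, ∑ i, d y i < ∑ i, α i
    · lift m to Multiset A using hall
      refine ⟨Sum.inl ⟨m, by rw [Multiset.map_map] at hm; exact hm, ?_⟩, rfl⟩
      apply Multiset.map_injective Subtype.val_injective
      rw [Multiset.map_map]
      conv_rhs => rw [← hmT, Multiset.map_map]
      exact Multiset.map_congr rfl fun y _ => (subPerm_pow T hT j y)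
    · push Not at hall
      obtain ⟨y, hy, hle⟩ := hall
      obtain ⟨m', rfl⟩ := Multiset.exists_cons_of_mem hy
      rw [Multiset.map_cons, Multiset.sum_cons] at hm
      have h1 : ∀ i, (m'.map d).sum i = 0 := by
        have h2 : ∑ i, d y i + ∑ i, (m'.map d).sum i = ∑ i, α i := by
          rw [← Finset.sum_add_distrib, ← hm]; rfl
        have h3 : ∑ i, (m'.map d).sum i = 0 := by omega
        simpa using h3
      have h2 : m' = 0 := by
        by_contra hne
        obtain ⟨z, hz⟩ := Multiset.exists_mem_of_ne_zero hne
        obtain ⟨m'', rfl⟩ := Multiset.exists_cons_of_mem hz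
        apply hd0 z
        funext i
        have := h1 i
        rw [Multiset.map_cons, Multiset.sum_cons, Pi.add_apply] at this
        change d z i = 0
        omega
      subst h2
      refine ⟨Sum.inr ⟨y, by simpa using hm, by simpa using hmT⟩, rfl⟩

theorem equivariant {Y Y' : Type*} (d : Y → I → ℕ) (T : Equiv.Perm Y) (d' : Y' → I → ℕ)
    (T' : Equiv.Perm Y') (hd : ∀ y, d (T y) = d y) (hd' : ∀ y, d' (T' y) = d' y)
    (hd0 : ∀ y, d y ≠ 0) (hd0' : ∀ y, d' y ≠ 0)
    (hfin : ∀ α, Finite {m : Multiset Y // (m.map d).sum = α})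
    (hfin' : ∀ α, Finite {m : Multiset Y' // (m.map d').sum = α})
    (h : ∀ α (j : ℕ), Nat.card {m : Multiset Y // (m.map d).sum = α ∧ m.map (T ^ j) = m} =
      Nat.card {m : Multiset Y' // (m.map d').sum = α ∧ m.map (T' ^ j) = m}) :
    ∀ α, ∃ e : {y // d y = α} ≃ {y // d' y = α}, ∀ y y', T y.1 = y'.1 → T' (e y) = e y' := by
  suffices H : ∀ (n : ℕ) (α : I → ℕ), ∑ i, α i = n → ∃ e : {y // d y = α} ≃ {y // d' y = α},
      ∀ y y', T y.1 = y'.1 → T' (e y) = e y' from fun α => H _ α rfl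
  intro n
  induction n using Nat.strong_induction_on with
  | _ n ih =>
  rintro α rfl
  have ih' : ∀ β : {β : I → ℕ // ∑ i, β i < ∑ i, α i}, ∃ e : {y // d y = β} ≃ {y // d' y = β},
      ∀ y y', T y.1 = y'.1 → T' (e y) = e y' := fun β => ih _ β.2 β.1 rfl
  choose e he using ih'
  let F : {y // ∑ i, d y i < ∑ i, α i} → {y // ∑ i, d' y i < ∑ i, α i} := fun y =>
    ⟨(e ⟨d y, y.2⟩ ⟨y.1, rfl⟩).1, by rw [(e ⟨d y, y.2⟩ ⟨y.1, rfl⟩).2]; exact y.2⟩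
  let G : {y // ∑ i, d' y i < ∑ i, α i} → {y // ∑ i, d y i < ∑ i, α i} := fun y =>
    ⟨((e ⟨d' y, y.2⟩).symm ⟨y.1, rfl⟩).1, by
      rw [((e ⟨d' y, y.2⟩).symm ⟨y.1, rfl⟩).2]; exact y.2⟩
  have hF : ∀ y β (hβ : d y.1 = β) (hb : ∑ i, β i < ∑ i, α i), (F y).1 = (e ⟨β, hb⟩ ⟨y.1, hβ⟩).1 := by
    rintro y β rfl hb; rfl
  have hG : ∀ y β (hβ : d' y.1 = β) (hb : ∑ i, β i < ∑ i, α i),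
      (G y).1 = ((e ⟨β, hb⟩).symm ⟨y.1, hβ⟩).1 := by
    rintro y β rfl hb; rfl
  have hdF : ∀ y, d' (F y).1 = d y.1 := fun y => (e ⟨d y, y.2⟩ ⟨y.1, rfl⟩).2
  have hdG : ∀ y, d (G y).1 = d' y.1 := fun y => ((e ⟨d' y, y.2⟩).symm ⟨y.1, rfl⟩).2
  let FE : {y // ∑ i, d y i < ∑ i, α i} ≃ {y // ∑ i, d' y i < ∑ i, α i} :=
    ⟨F, G, fun y => by
      apply Subtype.ext
      rw [hG (F y) (d y.1) (hdF y) y.2]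
      exact congrArg Subtype.val ((e ⟨d y, y.2⟩).symm_apply_apply ⟨y.1, rfl⟩), fun y => by
      apply Subtype.ext
      rw [hF (G y) (d' y.1) (hdG y) y.2]
      exact congrArg Subtype.val ((e ⟨d' y, y.2⟩).apply_symm_apply ⟨y.1, rfl⟩)⟩
  have hT : ∀ y, (∑ i, d (T y) i < ∑ i, α i) ↔ (∑ i, d y i < ∑ i, α i) := fun y => by rw [hd]
  have hT' : ∀ y, (∑ i, d' (T' y) i < ∑ i, α i) ↔ (∑ i, d' y i < ∑ i, α i) :=
    fun y => by rw [hd']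
  have hFT : ∀ y, FE (T.subtypePerm hT y) = T'.subtypePerm hT' (FE y) := by
    intro y
    apply Subtype.ext
    change (F _).1 = T' (F y).1
    rw [hF (T.subtypePerm hT y) (d y.1) (hd _) y.2, hF y (d y.1) rfl y.2]
    exact (he _ _ _ rfl).symm
  have hFTj : ∀ (j : ℕ) y, FE (((T.subtypePerm hT) ^ j) y) = ((T'.subtypePerm hT') ^ j) (FE y) := by
    intro j
    induction j with
    | zero => intro y; rfl
    | succ j ihj =>
      intro y
      rw [pow_succ', pow_succ', Equiv.Perm.mul_apply, Equiv.Perm.mul_apply, hFT, ihj]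
  have c1 := fun j => card_fixM d T hd hd0 α (hfin α) j hT
  have c2 := fun j => card_fixM d' T' hd' hd0' α (hfin' α) j hT'
  have := (c1 0).1
  have := (c2 0).1
  have hc : ∀ j, Nat.card {y // d y = α ∧ (T ^ j) y = y} =
      Nat.card {y // d' y = α ∧ (T' ^ j) y = y} := by
    intro j
    have e1 := (c1 j).2
    have e2 := (c2 j).2
    rw [h α j, e2] at e1
    have e3 : Nat.card {m : Multiset {y // ∑ i, d y i < ∑ i, α i} //
        (m.map (fun y => d y.1)).sum = α ∧ m.map ((T.subtypePerm hT) ^ j) = m} =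
        Nat.card {m : Multiset {y // ∑ i, d' y i < ∑ i, α i} //
        (m.map (fun y => d' y.1)).sum = α ∧ m.map ((T'.subtypePerm hT') ^ j) = m} := by
      refine Nat.card_congr ((msEquiv FE).subtypeEquiv fun m => and_congr ?_ ?_)
      · change _ ↔ ((m.map FE).map _).sum = α
        rw [Multiset.map_map]
        have : (m.map ((fun y : {y // ∑ i, d' y i < ∑ i, α i} => d' y.1) ∘ FE)) =
          m.map (fun y => d y.1) := Multiset.map_congr rfl fun y _ => hdF y
        rw [this]
      · change _ ↔ (m.map FE).map _ = m.map FE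
        rw [← (Multiset.map_injective FE.injective).eq_iff, Multiset.map_map, Multiset.map_map]
        have : m.map (((T'.subtypePerm hT') ^ j) ∘ FE) = m.map (FE ∘ ((T.subtypePerm hT) ^ j)) :=
          Multiset.map_congr rfl fun y _ => (hFTj j y).symm
        rw [this]
    omega
  have p1 : ∀ y, d (T y) = α ↔ d y = α := fun y => by rw [hd]
  have p2 : ∀ y, d' (T' y) = α ↔ d' y = α := fun y => by rw [hd']
  obtain ⟨e', he'⟩ := permFix (T.subtypePerm (p := fun y => d y = α) p1)
    (T'.subtypePerm (p := fun y => d' y = α) p2) (fun j => by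
    simp only [Subtype.ext_iff, subPerm_pow]
    refine (Nat.card_congr (Equiv.subtypeSubtypeEquivSubtypeInter (fun y => d y = α)
      (fun y => (T ^ j) y = y))).trans (Eq.trans ?_ (Nat.card_congr
        (Equiv.subtypeSubtypeEquivSubtypeInter (fun y => d' y = α) (fun y => (T' ^ j) y = y)).symm))
    exact hc j)
  refine ⟨e', fun y y' hy => ?_⟩
  have : y' = T.subtypePerm (p := fun y => d y = α) p1 y := Subtype.ext hy.symm
  rw [this, he']; rfl
end

namespace QRep

variable {k : Type} [Field k] {I E : Type} {s t : E → I}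

instance isoSetoid : Setoid (QRep k I E s t) where
  r := Iso
  iseqv := ⟨Iso.refl, Iso.symm, Iso.trans⟩

theorem Iso.dsum {A A' B B' : QRep k I E s t} (hA : A.Iso A') (hB : B.Iso B') :
    (A.dsum B).Iso (A'.dsum B') := (dsumBip A B).iso_of (dsumBip A' B') hA hB

theorem dsum_comm (A B : QRep k I E s t) : (A.dsum B).Iso (B.dsum A) := (dsumBip A B).swap.iso

theorem dsum_assoc (A B C : QRep k I E s t) : ((A.dsum B).dsum C).Iso (A.dsum (B.dsum C)) :=
  ⟨fun i => LinearEquiv.prodAssoc k (A.V i) (B.V i) (C.V i), fun _ _ => rfl⟩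

theorem dsum_triv (A B : QRep k I E s t) (hB : B.IsTrivial) : A.Iso (A.dsum B) := by
  refine Bip.iso ⟨fun _ => LinearMap.id, fun _ => LinearMap.id, fun _ => 0, fun _ => 0,
    isHom_id A, isHom_id A, fun e v => by simp, fun e v => by simp, fun i v => rfl, fun i v => ?_,
    fun i v => by simp⟩
  have := hB i
  exact Subsingleton.elim _ _

theorem zero_isTrivial : (zero k I E s t).IsTrivial := fun _ => inferInstanceAs (Subsingleton PUnit)

variable (k I E s t) in
/-- Isomorphism classes. -/
def Cl : Type 1 := Quotient (isoSetoid (k := k) (I := I) (E := E) (s := s) (t := t))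

def cl (M : QRep k I E s t) : Cl k I E s t := Quotient.mk _ M

theorem cl_eq {M N : QRep k I E s t} : cl M = cl N ↔ M.Iso N := Quotient.eq

theorem cl_ind {P : Cl k I E s t → Prop} (h : ∀ M, P (cl M)) (x : Cl k I E s t) : P x :=
  Quotient.ind h x

def Cl.add : Cl k I E s t → Cl k I E s t → Cl k I E s t :=
  Quotient.map₂ QRep.dsum (fun _ _ h _ _ h' => Iso.dsum h h')

instance : Add (Cl k I E s t) := ⟨Cl.add⟩
instance : Zero (Cl k I E s t) := ⟨cl (zero k I E s t)⟩

instance : AddCommMonoid (Cl k I E s t) where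
  add_assoc x y z := by
    induction x using cl_ind; induction y using cl_ind; induction z using cl_ind
    exact cl_eq.2 (dsum_assoc _ _ _)
  add_comm x y := by
    induction x using cl_ind; induction y using cl_ind
    exact cl_eq.2 (dsum_comm _ _)
  zero_add x := by
    induction x using cl_ind
    exact cl_eq.2 ((dsum_comm _ _).trans (dsum_triv _ _ zero_isTrivial).symm)
  add_zero x := by
    induction x using cl_ind
    exact cl_eq.2 (dsum_triv _ _ zero_isTrivial).symm
  nsmul := nsmulRec

theorem cl_dsum (A B : QRep k I E s t) : cl (A.dsum B) = cl A + cl B := rfl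

theorem cl_bip {M A B : QRep k I E s t} (h : Bip M A B) : cl M = cl A + cl B := cl_eq.2 h.iso

theorem bip_of_cl {M A B : QRep k I E s t} (h : cl M = cl A + cl B) : Nonempty (Bip M A B) :=
  (cl_eq.1 h).bip

noncomputable def Cl.dim : Cl k I E s t →+ (I → ℕ) where
  toFun := Quotient.lift dimVec (fun _ _ h => h.dimVec)
  map_zero' := by
    change dimVec (zero k I E s t) = 0
    exact (isTrivial_iff _).1 zero_isTrivial
  map_add' x y := by
    induction x using cl_ind; induction y using cl_ind
    exact funext fun i => dimVec_dsum _ _ i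

theorem dim_cl (M : QRep k I E s t) : (cl M).dim = M.dimVec := rfl

def Cl.Ind : Cl k I E s t → Prop :=
  Quotient.lift Indecomposable (fun _ _ h => propext ⟨h.indec, h.symm.indec⟩)

theorem ind_cl {M : QRep k I E s t} : (cl M).Ind ↔ M.Indecomposable := Iff.rfl

theorem Cl.Ind.dim_ne {x : Cl k I E s t} (h : x.Ind) : x.dim ≠ 0 := by
  induction x using cl_ind with
  | _ M => exact fun h0 => h.1 ((isTrivial_iff M).2 h0)

theorem cl_dim_eq_zero {x : Cl k I E s t} (h : x.dim = 0) : x = 0 := by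
  induction x using cl_ind with
  | _ M =>
    have := (isTrivial_iff M).2 h
    refine cl_eq.2 ⟨fun i => ?_, ?_⟩
    · have := this i
      exact LinearEquiv.ofSubsingleton (M.V i) PUnit
    · intro e v; rfl

theorem Cl.Ind.eq_zero_of_add {x y z : Cl k I E s t} (h : x.Ind) (hx : x = y + z) :
    y = 0 ∨ z = 0 := by
  subst hx
  induction y using cl_ind with
  | _ A =>
  induction z using cl_ind with
  | _ B =>
  by_contra hcon
  push Not at hcon
  refine h.2 A B ?_ ?_ (Iso.refl _)
  · exact fun hA => hcon.1 (cl_dim_eq_zero ((isTrivial_iff A).1 hA))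
  · exact fun hB => hcon.2 (cl_dim_eq_zero ((isTrivial_iff B).1 hB))

theorem exists_ms [Fintype I] (x : Cl k I E s t) :
    ∃ m : Multiset (Cl k I E s t), (∀ y ∈ m, y.Ind) ∧ m.sum = x := by
  obtain ⟨n, hn⟩ : ∃ n, ∑ i, x.dim i = n := ⟨_, rfl⟩
  induction n using Nat.strong_induction_on generalizing x with
  | _ n ih =>
  by_cases h0 : x = 0
  · exact ⟨0, by simp, by simp [h0]⟩
  by_cases h1 : x.Ind
  · exact ⟨{x}, by simpa using h1, by simp⟩
  induction x using cl_ind with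
  | _ M =>
  have h2 : ¬ M.IsTrivial := fun h => h0 (cl_dim_eq_zero ((isTrivial_iff M).1 h))
  have h3 : ¬ M.Indecomposable := h1
  rw [Indecomposable] at h3
  push Not at h3
  obtain ⟨A, B, hA, hB, hAB⟩ := h3 h2
  have e : cl M = cl A + cl B := cl_eq.2 hAB
  have e1 : ∑ i, (cl A).dim i + ∑ i, (cl B).dim i = n := by
    rw [← hn, e, map_add, ← Finset.sum_add_distrib]; rfl
  have pos : ∀ A : QRep k I E s t, ¬ A.IsTrivial → 0 < ∑ i, (cl A).dim i := by
    intro A hA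
    rw [Nat.pos_iff_ne_zero]
    intro h
    apply hA
    rw [isTrivial_iff]
    funext i
    exact (Finset.sum_eq_zero_iff.1 h) i (Finset.mem_univ i)
  obtain ⟨m, hm, hs⟩ := ih _ (by have := pos B hB; omega) (cl A) rfl
  obtain ⟨m', hm', hs'⟩ := ih _ (by have := pos A hA; omega) (cl B) rfl
  refine ⟨m + m', fun y hy => ?_, by rw [Multiset.sum_add, hs, hs', e]⟩
  rcases Multiset.mem_add.1 hy with h | h
  · exact hm y h
  · exact hm' y h

theorem Cl.Ind.prime [Finite I] {x a b c : Cl k I E s t} (h : x.Ind) (e : x + a = b + c) :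
    (∃ b', b = x + b') ∨ (∃ c', c = x + c') := by
  induction x using cl_ind; induction a using cl_ind
  induction b using cl_ind; induction c using cl_ind
  rw [← cl_dsum] at e
  obtain ⟨h'⟩ := bip_of_cl e
  rcases Indecomposable.prime h (dsumBip _ _) h' with ⟨B, ⟨hB⟩⟩ | ⟨B, ⟨hB⟩⟩
  · exact Or.inl ⟨cl B, cl_bip hB⟩
  · exact Or.inr ⟨cl B, cl_bip hB⟩

theorem Cl.Ind.cancel [Finite I] {x a b : Cl k I E s t} (h : x.Ind) (e : x + a = x + b) :
    a = b := by
  induction x using cl_ind; induction a using cl_ind; induction b using cl_ind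
  rw [← cl_dsum] at e
  obtain ⟨h'⟩ := bip_of_cl e
  exact cl_eq.2 (Indecomposable.cancel h (dsumBip _ _) h')

theorem Cl.Ind.mem_of_sum [Finite I] {x a : Cl k I E s t} (h : x.Ind) (m : Multiset (Cl k I E s t))
    (hm : ∀ y ∈ m, y.Ind) (e : x + a = m.sum) : x ∈ m := by
  induction m using Multiset.induction_on generalizing a with
  | empty =>
    exfalso
    rw [Multiset.sum_zero] at e
    have := congrArg Cl.dim e
    rw [map_add, map_zero] at this
    exact h.dim_ne (funext fun i => by have := congrFun this i; simp at this; exact this.1)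
  | cons y m ih =>
    rw [Multiset.sum_cons] at e
    rcases h.prime e with ⟨b, hb⟩ | ⟨c, hc⟩
    · rcases (hm y (by simp)).eq_zero_of_add hb with h0 | h0
      · exact absurd (by rw [h0, map_zero]) h.dim_ne
      · rw [h0, add_zero] at hb; rw [hb]; simp
    · exact Multiset.mem_cons_of_mem (ih (fun y hy => hm y (Multiset.mem_cons_of_mem hy)) hc.symm)

theorem ms_unique [Finite I] (m m' : Multiset (Cl k I E s t)) (hm : ∀ y ∈ m, y.Ind)
    (hm' : ∀ y ∈ m', y.Ind) (e : m.sum = m'.sum) : m = m' := by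
  classical
  induction m using Multiset.induction_on generalizing m' with
  | empty =>
    by_contra hne
    obtain ⟨z, hz⟩ := Multiset.exists_mem_of_ne_zero (Ne.symm hne)
    obtain ⟨m'', rfl⟩ := Multiset.exists_cons_of_mem hz
    rw [Multiset.sum_cons] at e
    simpa using (hm' z hz).mem_of_sum 0 (by simp) e.symm
  | cons y m ih =>
    rw [Multiset.sum_cons] at e
    have hy := hm y (by simp)
    obtain ⟨m'', rfl⟩ := Multiset.exists_cons_of_mem (hy.mem_of_sum m' hm' e)
    rw [Multiset.sum_cons] at e
    rw [ih m'' (fun y hy => hm y (Multiset.mem_cons_of_mem hy))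
      (fun y hy => hm' y (Multiset.mem_cons_of_mem hy)) (hy.cancel e)]

/-- Krull–Schmidt: classes are multisets of indecomposable classes. -/
noncomputable def ksEquiv [Fintype I] :
    Multiset {x : Cl k I E s t // x.Ind} ≃ Cl k I E s t :=
  Equiv.ofBijective (fun m => (m.map Subtype.val).sum) ⟨by
    intro m m' h
    apply Multiset.map_injective Subtype.val_injective
    refine ms_unique _ _ ?_ ?_ h
    · intro y hy; obtain ⟨z, -, rfl⟩ := Multiset.mem_map.1 hy; exact z.2
    · intro y hy; obtain ⟨z, -, rfl⟩ := Multiset.mem_map.1 hy; exact z.2, by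
    intro x
    obtain ⟨m, hm, rfl⟩ := exists_ms x
    lift m to Multiset {x : Cl k I E s t // x.Ind} using hm
    exact ⟨m, rfl⟩⟩

theorem ksEquiv_apply [Fintype I] (m : Multiset {x : Cl k I E s t // x.Ind}) :
    ksEquiv m = (m.map Subtype.val).sum := rfl

end QRep

namespace QRep

variable {k : Type} [Field k] {I E : Type} {s t : E → I}

/-- Semilinear isomorphism. -/
def SIso (τ : k ≃+* k) (M N : QRep k I E s t) : Prop :=
  ∃ φ : ∀ i, M.V i ≃+ N.V i, (∀ i (c : k) v, φ i (c • v) = τ c • φ i v) ∧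
    ∀ (e : E) (v : M.V (s e)), φ (t e) (M.f e v) = N.f e (φ (s e) v)

theorem SIso.trans {τ ρ : k ≃+* k} {M N P : QRep k I E s t} (h : SIso τ M N) (h' : SIso ρ N P) :
    SIso (ρ * τ) M P := by
  obtain ⟨φ, h1, h2⟩ := h
  obtain ⟨ψ, h3, h4⟩ := h'
  exact ⟨fun i => (φ i).trans (ψ i), fun i c v => by simp [h1, h3], fun e v => by simp [h2, h4]⟩

theorem SIso.symm {τ : k ≃+* k} {M N : QRep k I E s t} (h : SIso τ M N) : SIso τ⁻¹ N M := by
  obtain ⟨φ, h1, h2⟩ := h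
  refine ⟨fun i => (φ i).symm, fun i c v => ?_, fun e v => ?_⟩
  · rw [AddEquiv.symm_apply_eq, h1, AddEquiv.apply_symm_apply]
    congr 1
    exact (τ.apply_symm_apply c).symm
  · rw [AddEquiv.symm_apply_eq, h2, AddEquiv.apply_symm_apply]

theorem sIso_one {M N : QRep k I E s t} : SIso 1 M N ↔ M.Iso N := by
  constructor
  · rintro ⟨φ, h1, h2⟩
    exact ⟨fun i => (φ i).toLinearEquiv (h1 i), h2⟩
  · rintro ⟨φ, h⟩
    exact ⟨fun i => (φ i).toAddEquiv, fun i c v => (φ i).map_smul c v, h⟩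

theorem SIso.iso {τ : k ≃+* k} {M N P : QRep k I E s t} (h : SIso τ M N) (h' : SIso τ M P) :
    N.Iso P := by
  have := h.symm.trans h'
  rw [mul_inv_cancel] at this
  exact sIso_one.1 this

theorem SIso.iso_left {τ : k ≃+* k} {M N P : QRep k I E s t} (h : SIso τ N M) (h' : SIso τ P M) :
    N.Iso P := by
  have := h.trans h'.symm
  rw [inv_mul_cancel] at this
  exact sIso_one.1 this

theorem SIso.trans_iso {τ : k ≃+* k} {M N P : QRep k I E s t} (h : SIso τ M N) (h' : N.Iso P) :
    SIso τ M P := by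
  have := h.trans (sIso_one.2 h')
  rwa [one_mul] at this

theorem Iso.trans_sIso {τ : k ≃+* k} {M N P : QRep k I E s t} (h : M.Iso N) (h' : SIso τ N P) :
    SIso τ M P := by
  have := (sIso_one.2 h).trans h'
  rwa [mul_one] at this

theorem SIso.dsum {τ : k ≃+* k} {A A' B B' : QRep k I E s t} (h : SIso τ A A') (h' : SIso τ B B') :
    SIso τ (A.dsum B) (A'.dsum B') := by
  obtain ⟨φ, h1, h2⟩ := h
  obtain ⟨ψ, h3, h4⟩ := h'
  exact ⟨fun i => (φ i).prodCongr (ψ i), fun i c v => Prod.ext (h1 i c _) (h3 i c _),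
    fun e v => Prod.ext (h2 e _) (h4 e _)⟩

theorem SIso.dimVec {τ : k ≃+* k} {M N : QRep k I E s t} (h : SIso τ M N) :
    M.dimVec = N.dimVec := by
  obtain ⟨φ, h1, -⟩ := h
  funext i
  exact congrArg Cardinal.toNat (rank_eq_of_equiv_equiv τ (φ i) τ.bijective (h1 i))

/-- A vector space with scalars twisted by a field automorphism. -/
def TwV (_τ : k ≃+* k) (V : Type) : Type := V
instance (τ : k ≃+* k) (V : Type) [h : AddCommGroup V] : AddCommGroup (TwV τ V) := h
instance (τ : k ≃+* k) (V : Type) [AddCommGroup V] [Module k V] : Module k (TwV τ V) :=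
  Module.compHom V (τ⁻¹ : k ≃+* k).toRingHom
def twE (τ : k ≃+* k) (V : Type) [AddCommGroup V] : V ≃+ TwV τ V := AddEquiv.refl V
theorem twE_smul (τ : k ≃+* k) (V : Type) [AddCommGroup V] [Module k V] (c : k) (v : V) :
    twE τ V (c • v) = τ c • twE τ V v :=
  (congrArg (fun x => x • v) (τ.symm_apply_apply c)).symm
instance (τ : k ≃+* k) (V : Type) [AddCommGroup V] [Module k V] [FiniteDimensional k V] :
    FiniteDimensional k (TwV τ V) := by
  have := rank_eq_of_equiv_equiv τ (twE τ V) τ.bijective (twE_smul τ V)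
  exact Module.rank_lt_aleph0_iff.1 (this ▸ Module.rank_lt_aleph0 k V)

/-- The twist of a representation by a field automorphism. -/
def tw (τ : k ≃+* k) (M : QRep k I E s t) : QRep k I E s t where
  V i := TwV τ (M.V i)
  f e := ⟨⟨fun v => twE τ _ (M.f e ((twE τ _).symm v)), fun v w => by simp⟩, fun c v => by
    obtain ⟨v, rfl⟩ := (twE τ _).surjective v
    obtain ⟨c, rfl⟩ := τ.surjective c
    simp [← twE_smul]⟩

theorem sIso_tw (τ : k ≃+* k) (M : QRep k I E s t) : SIso τ M (tw τ M) :=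
  ⟨fun i => twE τ (M.V i), fun i c v => twE_smul τ (M.V i) c v, fun _ _ => rfl⟩

theorem SIso.isTrivial {τ : k ≃+* k} {M N : QRep k I E s t} (h : SIso τ M N) (hM : M.IsTrivial) :
    N.IsTrivial := by rw [isTrivial_iff] at *; rw [← h.dimVec]; exact hM

theorem SIso.indec {τ : k ≃+* k} {M N : QRep k I E s t} (h : SIso τ M N)
    (hM : M.Indecomposable) : N.Indecomposable := by
  refine ⟨fun hN => hM.1 (h.symm.isTrivial hN), fun A B hA hB hAB => ?_⟩
  refine hM.2 (tw τ⁻¹ A) (tw τ⁻¹ B) (fun h => hA ((sIso_tw τ⁻¹ A).symm.isTrivial h))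
    (fun h => hB ((sIso_tw τ⁻¹ B).symm.isTrivial h)) ?_
  exact h.symm.iso ((hAB.trans_sIso ((sIso_tw τ⁻¹ A).dsum (sIso_tw τ⁻¹ B))))

def Cl.tw (τ : k ≃+* k) : Cl k I E s t → Cl k I E s t :=
  Quotient.map (QRep.tw τ) (fun _ _ h => (sIso_tw τ _).iso (h.trans_sIso (sIso_tw τ _)))

theorem cl_tw (τ : k ≃+* k) (M : QRep k I E s t) : (cl M).tw τ = cl (M.tw τ) := rfl

theorem cl_tw_eq {τ : k ≃+* k} {M N : QRep k I E s t} : (cl M).tw τ = cl N ↔ SIso τ M N := by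
  rw [cl_tw, cl_eq]
  exact ⟨fun h => (sIso_tw τ M).trans_iso h, fun h => (sIso_tw τ M).iso h⟩

theorem Cl.tw_tw (τ ρ : k ≃+* k) (x : Cl k I E s t) : (x.tw τ).tw ρ = x.tw (ρ * τ) := by
  induction x using cl_ind with
  | _ M => exact cl_tw_eq.2 ((sIso_tw τ M).symm.trans (sIso_tw (ρ * τ) M) |> fun h => by simpa using h)

theorem Cl.tw_one (x : Cl k I E s t) : x.tw 1 = x := by
  induction x using cl_ind with
  | _ M => exact cl_tw_eq.2 (sIso_one.2 (Iso.refl M))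

theorem Cl.tw_add (τ : k ≃+* k) (x y : Cl k I E s t) : (x + y).tw τ = x.tw τ + y.tw τ := by
  induction x using cl_ind; induction y using cl_ind
  rw [cl_tw, cl_tw, ← cl_dsum, ← cl_dsum, cl_tw_eq]
  exact (sIso_tw _ _).dsum (sIso_tw _ _)

theorem Cl.tw_dim (τ : k ≃+* k) (x : Cl k I E s t) : (x.tw τ).dim = x.dim := by
  induction x using cl_ind with
  | _ M => exact (sIso_tw τ M).dimVec.symm

theorem Cl.tw_zero (τ : k ≃+* k) : (0 : Cl k I E s t).tw τ = 0 :=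
  cl_dim_eq_zero (by rw [Cl.tw_dim, map_zero])

theorem Cl.tw_ind {τ : k ≃+* k} {x : Cl k I E s t} (h : x.Ind) : (x.tw τ).Ind := by
  induction x using cl_ind with
  | _ M => exact (sIso_tw τ M).indec h

def Cl.twPerm (τ : k ≃+* k) : Equiv.Perm (Cl k I E s t) where
  toFun := Cl.tw τ
  invFun := Cl.tw τ⁻¹
  left_inv x := by rw [Cl.tw_tw, inv_mul_cancel, Cl.tw_one]
  right_inv x := by rw [Cl.tw_tw, mul_inv_cancel, Cl.tw_one]

def Cl.twPermI (τ : k ≃+* k) : Equiv.Perm {x : Cl k I E s t // x.Ind} where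
  toFun x := ⟨x.1.tw τ, Cl.tw_ind x.2⟩
  invFun x := ⟨x.1.tw τ⁻¹, Cl.tw_ind x.2⟩
  left_inv x := Subtype.ext (by change Cl.tw _ (Cl.tw _ _) = _; rw [Cl.tw_tw, inv_mul_cancel, Cl.tw_one])
  right_inv x := Subtype.ext (by change Cl.tw _ (Cl.tw _ _) = _; rw [Cl.tw_tw, mul_inv_cancel, Cl.tw_one])

theorem Cl.twPermI_pow (τ : k ≃+* k) (j : ℕ) (x : {x : Cl k I E s t // x.Ind}) :
    ((Cl.twPermI τ ^ j) x).1 = x.1.tw (τ ^ j) := by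
  induction j with
  | zero => exact (Cl.tw_one _).symm
  | succ j ih =>
    rw [pow_succ', pow_succ', Equiv.Perm.mul_apply, ← Cl.tw_tw, ← ih]; rfl

theorem ks_tw [Fintype I] (τ : k ≃+* k) (j : ℕ) (m : Multiset {x : Cl k I E s t // x.Ind}) :
    ksEquiv (m.map (Cl.twPermI τ ^ j)) = (ksEquiv m).tw (τ ^ j) := by
  rw [ksEquiv_apply, ksEquiv_apply]
  induction m using Multiset.induction_on with
  | empty => simp [Cl.tw_zero]
  | cons x m ih => simp only [Multiset.map_cons, Multiset.sum_cons, Cl.tw_add, ih, Cl.twPermI_pow]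

theorem ks_dim [Fintype I] (m : Multiset {x : Cl k I E s t // x.Ind}) :
    (ksEquiv m).dim = (m.map (fun x => x.1.dim)).sum := by
  rw [ksEquiv_apply, map_multiset_sum, Multiset.map_map]; rfl

theorem card_fix_ms [Fintype I] (τ : k ≃+* k) (j : ℕ) (α : I → ℕ) :
    Nat.card {m : Multiset {x : Cl k I E s t // x.Ind} // (m.map (fun x => x.1.dim)).sum = α ∧
      m.map (Cl.twPermI τ ^ j) = m} = Nat.card {x : Cl k I E s t // x.dim = α ∧ x.tw (τ ^ j) = x} :=
  Nat.card_congr (ksEquiv.subtypeEquiv fun m => by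
    rw [ks_dim, ← ks_tw, ksEquiv.injective.eq_iff])

end QRep

namespace QRep

variable {k : Type} [Field k] {I E : Type} {s t : E → I}

variable (k s t) in
abbrev Mats (α : I → ℕ) : Type := ∀ e, Matrix (Fin (α (t e))) (Fin (α (s e))) k

/-- The representation attached to a family of matrices. -/
def ofMat (α : I → ℕ) (x : Mats k s t α) : QRep k I E s t where
  V i := Fin (α i) → k
  f e := (x e).mulVecLin

theorem ofMat_f (α : I → ℕ) (x : Mats k s t α) (e : E) (v : Fin (α (s e)) → k) :
    (ofMat α x).f e v = (x e).mulVec v := rfl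

theorem dimVec_ofMat (α : I → ℕ) (x : Mats k s t α) : (ofMat α x).dimVec = α :=
  funext fun _ => Module.finrank_fin_fun k

theorem exists_ofMat {α : I → ℕ} (M : QRep k I E s t) (h : M.dimVec = α) :
    ∃ x, M.Iso (ofMat α x) := by
  have h' : ∀ i, Module.finrank k (M.V i) = α i := fun i => congrFun h i
  let b := fun i => (Module.finBasisOfFinrankEq k (M.V i) (h' i)).equivFun
  refine ⟨fun e => LinearMap.toMatrix' ((b (t e)).toLinearMap ∘ₗ M.f e ∘ₗ (b (s e)).symm.toLinearMap),
    b, fun e v => ?_⟩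
  have := LinearMap.toMatrix'_mulVec
    ((b (t e)).toLinearMap ∘ₗ M.f e ∘ₗ (b (s e)).symm.toLinearMap) (b (s e) v)
  simp only [LinearMap.comp_apply, LinearEquiv.coe_coe, LinearEquiv.symm_apply_apply] at this
  exact this.symm

theorem ofMat_iso_iff {α : I → ℕ} {x y : Mats k s t α} : (ofMat α x).Iso (ofMat α y) ↔
    ∃ g : ∀ i, GL (Fin (α i)) k, ∀ e, (g (t e)).1 * x e = y e * (g (s e)).1 := by
  constructor
  · rintro ⟨φ, hφ⟩
    let φ' : ∀ i, (Fin (α i) → k) ≃ₗ[k] (Fin (α i) → k) := φ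
    refine ⟨fun i => ⟨LinearMap.toMatrix' (φ' i).toLinearMap, LinearMap.toMatrix' (φ' i).symm.toLinearMap,
      ?_, ?_⟩, fun e => ?_⟩
    · rw [← LinearMap.toMatrix'_comp]; simp
    · rw [← LinearMap.toMatrix'_comp]; simp
    · apply Matrix.toLin'.injective
      rw [Matrix.toLin'_mul, Matrix.toLin'_mul]
      simp only [Matrix.toLin'_toMatrix']
      apply LinearMap.ext
      intro v
      exact hφ e v
  · rintro ⟨g, hg⟩
    refine iso_of_inv (M := ofMat α x) (N := ofMat α y) (φ := fun i => (g i).1.mulVecLin)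
      (ψ := fun i => ((g i)⁻¹).1.mulVecLin) ?_ ?_ ?_
    · intro e v
      have : ∀ v, (g (t e)).1.mulVec ((x e).mulVec v) = (y e).mulVec ((g (s e)).1.mulVec v) := by
        intro v
        rw [Matrix.mulVec_mulVec, Matrix.mulVec_mulVec, hg]
      exact this v
    · intro i
      change Matrix.mulVecLin _ ∘ₗ Matrix.mulVecLin _ = _
      rw [← Matrix.mulVecLin_mul, ← Units.val_mul, inv_mul_cancel]; exact Matrix.mulVecLin_one
    · intro i
      change Matrix.mulVecLin _ ∘ₗ Matrix.mulVecLin _ = _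
      rw [← Matrix.mulVecLin_mul, ← Units.val_mul, mul_inv_cancel]; exact Matrix.mulVecLin_one

theorem sIso_ofMat (τ : k ≃+* k) (α : I → ℕ) (x : Mats k s t α) :
    SIso τ (ofMat α x) (ofMat α (fun e => (x e).map τ)) := by
  refine ⟨fun i => AddEquiv.piCongrRight (fun _ => τ.toAddEquiv), fun i c v => ?_, fun e v => ?_⟩
  · funext a
    exact map_mul τ c _
  · exact funext fun i => RingHom.map_mulVec τ.toRingHom (x e) v i

theorem sIso_ofMat_iff {τ : k ≃+* k} {α : I → ℕ} {x y : Mats k s t α} :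
    SIso τ (ofMat α x) (ofMat α y) ↔
    ∃ g : ∀ i, GL (Fin (α i)) k, ∀ e, (g (t e)).1 * (x e).map τ = y e * (g (s e)).1 := by
  rw [← ofMat_iso_iff (x := fun e => (x e).map τ)]
  exact ⟨fun h => (sIso_ofMat τ α x).iso h, fun h => (sIso_ofMat τ α x).trans_iso h⟩

end QRep

open MulAction in
theorem burnside_cl {G P C : Type*} [Group G] [MulAction G P] (f : P → C)
    (hf : Function.Surjective f) (h : ∀ x y, f x = f y ↔ ∃ g : G, g • y = x) :
    Nat.card C * Nat.card G = Nat.card (Σ x : P, stabilizer G x) := by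
  rw [← Nat.card_prod]
  have e1 : orbitRel.Quotient G P ≃ C := by
    refine Equiv.ofBijective (Quotient.lift f (fun x y hxy => (h x y).2 hxy)) ⟨?_, ?_⟩
    · intro x y
      induction x using Quotient.inductionOn
      induction y using Quotient.inductionOn
      intro hxy
      exact Quotient.sound ((h _ _).1 hxy)
    · intro c
      obtain ⟨x, rfl⟩ := hf c
      exact ⟨Quotient.mk _ x, rfl⟩
  refine Nat.card_congr ((e1.symm.prodCongr (Equiv.refl G)).trans
    ((sigmaFixedByEquivOrbitsProdGroup G P).symm.trans ?_))
  exact ⟨fun p => ⟨p.2.1, p.1, p.2.2⟩, fun p => ⟨p.2.1, p.1, p.2.2⟩, fun _ => rfl, fun _ => rfl⟩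

theorem finrank_ker_adj_le {F V W : Type*} [Field F] [AddCommGroup V] [Module F V]
    [AddCommGroup W] [Module F W] [FiniteDimensional F V] 
    (B : W →ₗ[F] V →ₗ[F] F) (hB : Function.Injective B) (A : V →ₗ[F] V) (A' : W →ₗ[F] W)
    (h : ∀ x y, B (A' y) x = B y (A x)) :
    Module.finrank F (LinearMap.ker A') ≤ Module.finrank F (LinearMap.ker A) := by
  have h1 : Module.finrank F (LinearMap.ker A') ≤
      Module.finrank F (LinearMap.ker A.dualMap) := by
    refine LinearMap.finrank_le_finrank_of_injective
      (f := (B ∘ₗ (LinearMap.ker A').subtype).codRestrict (LinearMap.ker A.dualMap) ?_) ?_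
    · rintro ⟨y, hy⟩
      rw [LinearMap.mem_ker] at hy ⊢
      ext x
      simp [← h, hy]
    · intro a b hab
      exact Subtype.ext (hB (congrArg Subtype.val hab))
  have h2 := LinearMap.finrank_range_add_finrank_ker A
  have h3 := LinearMap.finrank_range_add_finrank_ker A.dualMap
  rw [LinearMap.finrank_range_dualMap_eq_finrank_range, Subspace.dual_finrank_eq] at h3
  omega

open MulAction in
theorem burnside_tw {G X C : Type*} [Group G] (act : G →* Equiv.Perm X) (T : X → X) (σ : G → G)
    (hT : ∀ g x, T (act g x) = act (σ g) (T x))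
    (f : {x : X // ∃ g, act g (T x) = x} → C) (hf : Function.Surjective f)
    (h : ∀ x y, f x = f y ↔ ∃ g, act g y.1 = x.1) :
    Nat.card C * Nat.card G = Nat.card {p : G × X // act p.1 (T p.2) = p.2} := by
  have inv : ∀ (g : G) (x : X), (∃ g, act g (T x) = x) → ∃ g', act g' (T (act g x)) = act g x := by
    rintro g x ⟨a, ha⟩
    refine ⟨g * a * (σ g)⁻¹, ?_⟩
    rw [hT, map_mul, map_inv, Equiv.Perm.mul_apply, Equiv.Perm.inv_eq_iff_eq.2 rfl, map_mul,
      Equiv.Perm.mul_apply, ha]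
  let _ : MulAction G {x : X // ∃ g, act g (T x) = x} :=
    { smul := fun g x => ⟨act g x.1, inv g x.1 x.2⟩
      one_smul := fun x => Subtype.ext (by change act 1 x.1 = x.1; simp)
      mul_smul := fun a b x => Subtype.ext (by
        change act (a * b) x.1 = act a (act b x.1); simp) }
  have hs : ∀ (g : G) (x : {x : X // ∃ g, act g (T x) = x}), (g • x).1 = act g x.1 := fun _ _ => rfl
  rw [burnside_cl (G := G) f hf (fun x y => (h x y).trans
    ⟨fun ⟨g, hg⟩ => ⟨g, Subtype.ext hg⟩, fun ⟨g, hg⟩ => ⟨g, congrArg Subtype.val hg⟩⟩)]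
  choose g0 hg0 using fun x : {x : X // ∃ g, act g (T x) = x} => x.2
  refine Nat.card_congr ⟨fun q => ⟨(q.2.1 * g0 q.1, q.1.1), ?_⟩,
    fun p => ⟨⟨p.1.2, p.1.1, p.2⟩, ⟨p.1.1 * (g0 ⟨p.1.2, p.1.1, p.2⟩)⁻¹, ?_⟩⟩, ?_, ?_⟩
  · have := q.2.2
    rw [mem_stabilizer_iff, Subtype.ext_iff, hs] at this
    change act (q.2.1 * g0 q.1) (T q.1.1) = q.1.1
    rw [map_mul, Equiv.Perm.mul_apply, hg0, this]
  · rw [mem_stabilizer_iff, Subtype.ext_iff, hs]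
    have := hg0 ⟨p.1.2, p.1.1, p.2⟩
    have e : (act (g0 ⟨p.1.2, p.1.1, p.2⟩))⁻¹ p.1.2 = T p.1.2 := by
      rw [Equiv.Perm.inv_eq_iff_eq]; exact this.symm
    rw [map_mul, Equiv.Perm.mul_apply, map_inv, e, p.2]
  · rintro ⟨x, a⟩
    simp
  · rintro ⟨⟨g, x⟩, hx⟩
    simp

section
variable {K : Type} [Field K] [Finite K] (τ : K ≃+* K) {m n : ℕ}

theorem card_tw_le (g : GL (Fin m) K) (h : GL (Fin n) K) :
    Nat.card {Y : Matrix (Fin n) (Fin m) K // h.1 * Y.map τ = Y * g.1} ≤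
    Nat.card {X : Matrix (Fin m) (Fin n) K // g.1 * X.map τ = X * h.1} := by
  obtain ⟨p, hp⟩ := CharP.exists K
  have : Fact p.Prime := ⟨CharP.char_is_prime K p⟩
  let _ : Algebra (ZMod p) K := ZMod.algebra K p
  have : FiniteDimensional (ZMod p) K := Module.Finite.of_finite
  let T : K ≃ₐ[ZMod p] K := AlgEquiv.ofRingEquiv (f := τ) (fun r =>
    RingHom.congr_fun (Subsingleton.elim (τ.toRingHom.comp (algebraMap (ZMod p) K)) _) r)
  have hT : ∀ x, Algebra.trace (ZMod p) K (τ x) = Algebra.trace (ZMod p) K x :=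
    fun x => Algebra.trace_eq_of_algEquiv T x
  have madd : ∀ {a b : ℕ} (σ : K ≃+* K) (X Y : Matrix (Fin a) (Fin b) K),
      (X + Y).map σ = X.map σ + Y.map σ := fun σ X Y => by ext; simp
  have mmul : ∀ {a b c : ℕ} (σ : K ≃+* K) (X : Matrix (Fin a) (Fin b) K)
      (Y : Matrix (Fin b) (Fin c) K), (X * Y).map σ = X.map σ * Y.map σ :=
    fun σ X Y => Matrix.map_mul (f := σ.toRingHom)
  have mtr : ∀ {a : ℕ} (σ : K ≃+* K) (X : Matrix (Fin a) (Fin a) K),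
      (X.map σ).trace = σ X.trace := fun σ X => by simp [Matrix.trace]
  have mm : ∀ {a b : ℕ} (X : Matrix (Fin a) (Fin b) K), (X.map τ.symm).map τ = X :=
    fun X => by ext; simp
  have mm' : ∀ {a b : ℕ} (X : Matrix (Fin a) (Fin b) K), (X.map τ).map τ.symm = X :=
    fun X => by ext; simp
  have hg1 : (g⁻¹).1 * g.1 = 1 := by rw [← Units.val_mul]; simp
  have hg2 : g.1 * (g⁻¹).1 = 1 := by rw [← Units.val_mul]; simp
  have hh1 : (h⁻¹).1 * h.1 = 1 := by rw [← Units.val_mul]; simp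
  have hh2 : h.1 * (h⁻¹).1 = 1 := by rw [← Units.val_mul]; simp
  let A : Matrix (Fin m) (Fin n) K →ₗ[ZMod p] Matrix (Fin m) (Fin n) K :=
    AddMonoidHom.toZModLinearMap p (AddMonoidHom.mk' (fun X => g.1 * X.map τ * (h⁻¹).1 - X)
      (fun X Y => by rw [madd, Matrix.mul_add, Matrix.add_mul]; abel))
  let A' : Matrix (Fin n) (Fin m) K →ₗ[ZMod p] Matrix (Fin n) (Fin m) K :=
    AddMonoidHom.toZModLinearMap p (AddMonoidHom.mk' (fun Y => ((h⁻¹).1 * Y * g.1).map τ.symm - Y)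
      (fun X Y => by rw [Matrix.mul_add, Matrix.add_mul, madd]; abel))
  let B : Matrix (Fin n) (Fin m) K →ₗ[ZMod p] Matrix (Fin m) (Fin n) K →ₗ[ZMod p] ZMod p :=
    AddMonoidHom.toZModLinearMap p (AddMonoidHom.mk' (fun Y =>
      AddMonoidHom.toZModLinearMap p (AddMonoidHom.mk' (fun X =>
        Algebra.trace (ZMod p) K (Y * X).trace)
      (fun X X' => by rw [Matrix.mul_add, Matrix.trace_add, map_add])))
      (fun Y Y' => LinearMap.ext fun X => by
        change Algebra.trace (ZMod p) K ((Y + Y') * X).trace = _ + _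
        rw [Matrix.add_mul, Matrix.trace_add, map_add]; rfl))
  have hA : ∀ X, A X = g.1 * X.map τ * (h⁻¹).1 - X := fun _ => rfl
  have hA' : ∀ X, A' X = ((h⁻¹).1 * X * g.1).map τ.symm - X := fun _ => rfl
  have hBd : ∀ Y X, B Y X = Algebra.trace (ZMod p) K (Y * X).trace := fun _ _ => rfl
  have hB : Function.Injective B := by
    rw [injective_iff_map_eq_zero]
    intro Y hY
    ext i j
    by_contra hne
    obtain ⟨b, hb⟩ := not_forall.1 (fun hz => hne ((traceForm_nondegenerate (ZMod p) K).1 (Y i j) hz))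
    apply hb
    have := congrArg (fun F => F (Matrix.single j i b)) hY
    simp only [hBd, LinearMap.zero_apply] at this
    rw [Matrix.trace_mul_comm, Matrix.trace_single_mul] at this
    rw [Algebra.traceForm_apply, mul_comm]
    simpa using this
  have hadj : ∀ X Y, B (A' Y) X = B Y (A X) := by
    intro X Y
    rw [hBd, hBd, hA, hA', Matrix.sub_mul, Matrix.mul_sub, Matrix.trace_sub, Matrix.trace_sub, map_sub, map_sub]
    congr 1
    rw [← hT, ← mtr, mmul, mm, ← Matrix.mul_assoc, Matrix.trace_mul_comm _ (h⁻¹).1]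
    simp only [Matrix.mul_assoc]
  have key := finrank_ker_adj_le B hB A A' hadj
  have e1 : Nat.card {Y : Matrix (Fin n) (Fin m) K // h.1 * Y.map τ = Y * g.1} =
      Nat.card (LinearMap.ker A') := by
    refine Nat.card_congr (Equiv.subtypeEquivRight fun Y => ?_)
    rw [LinearMap.mem_ker, hA', sub_eq_zero]
    constructor
    · intro hY
      rw [Matrix.mul_assoc, ← hY, ← Matrix.mul_assoc, hh1, Matrix.one_mul, mm']
    · intro hY
      have := congrArg (fun X : Matrix (Fin n) (Fin m) K => h.1 * X.map τ) hY
      simp only [mm] at this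
      rw [← this, ← Matrix.mul_assoc, ← Matrix.mul_assoc, hh2, Matrix.one_mul]
  have e2 : Nat.card {X : Matrix (Fin m) (Fin n) K // g.1 * X.map τ = X * h.1} =
      Nat.card (LinearMap.ker A) := by
    refine Nat.card_congr (Equiv.subtypeEquivRight fun Y => ?_)
    rw [LinearMap.mem_ker, hA, sub_eq_zero]
    constructor
    · intro hY
      rw [hY, Matrix.mul_assoc, hh2, Matrix.mul_one]
    · intro hY
      nth_rewrite 2 [← hY]
      rw [Matrix.mul_assoc _ _ h.1, hh1, Matrix.mul_one]
  rw [e1, e2, Module.natCard_eq_pow_finrank (K := ZMod p), 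
    Module.natCard_eq_pow_finrank (K := ZMod p) (V := LinearMap.ker A)]
  exact Nat.pow_le_pow_right (by simpa using (Fact.out : p.Prime).pos) key

theorem card_tw_eq (g : GL (Fin m) K) (h : GL (Fin n) K) :
    Nat.card {Y : Matrix (Fin n) (Fin m) K // h.1 * Y.map τ = Y * g.1} =
    Nat.card {X : Matrix (Fin m) (Fin n) K // g.1 * X.map τ = X * h.1} :=
  le_antisymm (card_tw_le τ g h) (card_tw_le τ h g)
end

namespace QRep

variable {K : Type} [Field K] {I E : Type} {s t : E → I}

/-- two orientations of the same graph -/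
def Reor (s t s' t' : E → I) : Prop :=
  ∀ e, (s' e = s e ∧ t' e = t e) ∨ (s' e = t e ∧ t' e = s e)

/-- Action by change of bases. -/
def matAct (α : I → ℕ) : (∀ i, GL (Fin (α i)) K) →* Equiv.Perm (Mats K s t α) :=
  MonoidHom.mk' (fun g => ⟨fun x e => (g (t e)).1 * x e * (g (s e))⁻¹.1,
    fun x e => (g (t e))⁻¹.1 * x e * (g (s e)).1,
    fun x => funext fun e => by
      beta_reduce
      rw [Matrix.mul_assoc, Matrix.mul_assoc, ← Units.val_mul, inv_mul_cancel, Units.val_one,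
        Matrix.mul_one, ← Matrix.mul_assoc, ← Units.val_mul, inv_mul_cancel, Units.val_one,
        Matrix.one_mul],
    fun x => funext fun e => by
      beta_reduce
      rw [Matrix.mul_assoc, Matrix.mul_assoc, ← Units.val_mul, mul_inv_cancel, Units.val_one,
        Matrix.mul_one, ← Matrix.mul_assoc, ← Units.val_mul, mul_inv_cancel, Units.val_one,
        Matrix.one_mul]⟩)
    (fun a b => Equiv.ext fun x => funext fun e => by
      change ((a * b) (t e)).1 * x e * ((a * b) (s e))⁻¹.1 =
        (a (t e)).1 * ((b (t e)).1 * x e * (b (s e))⁻¹.1) * (a (s e))⁻¹.1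
      rw [Pi.mul_apply, Pi.mul_apply, mul_inv_rev, Units.val_mul, Units.val_mul]
      simp only [Matrix.mul_assoc])

theorem matAct_eq {α : I → ℕ} {g : ∀ i, GL (Fin (α i)) K} {x y : Mats K s t α} :
    matAct α g x = y ↔ ∀ e, (g (t e)).1 * x e = y e * (g (s e)).1 := by
  rw [funext_iff]
  refine forall_congr' fun e => ?_
  change (g (t e)).1 * x e * (g (s e))⁻¹.1 = y e ↔ _
  constructor
  · intro h
    rw [← h, Matrix.mul_assoc _ _ (g (s e)).1, ← Units.val_mul, inv_mul_cancel, Units.val_one,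
      Matrix.mul_one]
  · intro h
    rw [h, Matrix.mul_assoc, ← Units.val_mul, mul_inv_cancel, Units.val_one, Matrix.mul_one]

theorem card_fix_cl (τ : K ≃+* K) (α : I → ℕ) :
    Nat.card {c : Cl K I E s t // c.dim = α ∧ c.tw τ = c} * Nat.card (∀ i, GL (Fin (α i)) K) =
    Nat.card {p : (∀ i, GL (Fin (α i)) K) × Mats K s t α //
      ∀ e, (p.1 (t e)).1 * (p.2 e).map τ = p.2 e * (p.1 (s e)).1} := by
  have := burnside_tw (C := {c : Cl K I E s t // c.dim = α ∧ c.tw τ = c})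
    (matAct (s := s) (t := t) (K := K) α) (fun x e => (x e).map τ)
    (fun g i => Matrix.GeneralLinearGroup.map τ.toRingHom (g i)) ?_
    (fun x => ⟨cl (ofMat α x.1), by rw [dim_cl, dimVec_ofMat], by
      rw [cl_tw_eq, sIso_ofMat_iff]
      obtain ⟨g, hg⟩ := x.2
      exact ⟨g, matAct_eq.1 hg⟩⟩) ?_ ?_
  · rw [this]
    exact Nat.card_congr (Equiv.subtypeEquivRight fun p => matAct_eq)
  · intro g x
    symm
    rw [matAct_eq]
    intro e
    have hx : matAct (s := s) (t := t) α g x = matAct α g x := rfl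
    have := congrArg (fun X : Matrix (Fin (α (t e))) (Fin (α (s e))) K => X.map τ) (matAct_eq.1 hx e)
    have mmul : ∀ {a b c : ℕ} (X : Matrix (Fin a) (Fin b) K)
      (Y : Matrix (Fin b) (Fin c) K), (X * Y).map τ = X.map τ * Y.map τ :=
      fun X Y => Matrix.map_mul (f := τ.toRingHom)
    simp only [mmul] at this
    exact this
  · rintro ⟨c, hc, hc'⟩
    induction c using cl_ind with
    | _ M => 
    rw [dim_cl] at hc
    obtain ⟨x, hx⟩ := exists_ofMat M hc
    have e := cl_eq.2 hx
    rw [e, cl_tw_eq, sIso_ofMat_iff] at hc'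
    obtain ⟨g, hg⟩ := hc'
    exact ⟨⟨x, g, matAct_eq.2 hg⟩, Subtype.ext e.symm⟩
  · rintro ⟨x, hx⟩ ⟨y, hy⟩
    rw [Subtype.mk.injEq, eq_comm, cl_eq, ofMat_iso_iff]
    exact exists_congr fun g => matAct_eq.symm

variable [Finite K] [Finite E]

theorem card_fix_cl_eq [Finite I] {s' t' : E → I} (hr : Reor s t s' t') (τ : K ≃+* K) (α : I → ℕ) :
    Nat.card {c : Cl K I E s t // c.dim = α ∧ c.tw τ = c} =
    Nat.card {c : Cl K I E s' t' // c.dim = α ∧ c.tw τ = c} := by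
  have h1 := card_fix_cl (s := s) (t := t) τ α
  have h2 := card_fix_cl (s := s') (t := t') τ α
  refine Nat.eq_of_mul_eq_mul_right (Nat.card_pos (α := ∀ i, GL (Fin (α i)) K)) ?_
  rw [h1, h2]
  have e : ∀ g : ∀ i, GL (Fin (α i)) K, ∀ e, Nonempty
      ({X : Matrix (Fin (α (t e))) (Fin (α (s e))) K // (g (t e)).1 * X.map τ = X * (g (s e)).1} ≃
      {X : Matrix (Fin (α (t' e))) (Fin (α (s' e))) K // (g (t' e)).1 * X.map τ = X * (g (s' e)).1}) := by
    intro g e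
    rcases hr e with ⟨ha, hb⟩ | ⟨ha, hb⟩
    · rw [ha, hb]; exact ⟨Equiv.refl _⟩
    · rw [ha, hb]
      exact (Finite.card_eq).1 (card_tw_eq τ _ _)
  let F := fun g e1 => Classical.choice (e g e1)
  let P : ∀ (s t : E → I), (∀ i, GL (Fin (α i)) K) → Type := fun s t g => ∀ e, 
    {X : Matrix (Fin (α (t e))) (Fin (α (s e))) K // (g (t e)).1 * X.map τ = X * (g (s e)).1}
  have eq : ∀ s t : E → I, {p : (∀ i, GL (Fin (α i)) K) × Mats K s t α //
      ∀ e, (p.1 (t e)).1 * (p.2 e).map τ = p.2 e * (p.1 (s e)).1} ≃ Σ g, P s t g := fun s t =>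
    ⟨fun p => ⟨p.1.1, fun e => ⟨p.1.2 e, p.2 e⟩⟩, fun q => ⟨(q.1, fun e => (q.2 e).1), fun e => (q.2 e).2⟩,
      fun _ => rfl, fun _ => rfl⟩
  exact Nat.card_congr ((eq s t).trans ((Equiv.sigmaCongrRight fun g => Equiv.piCongrRight (F g)).trans
    (eq s' t').symm))

instance finite_cl (α : I → ℕ) : Finite {c : Cl K I E s t // c.dim = α} := by
  refine Finite.of_surjective (fun x : Mats K s t α => (⟨cl (ofMat α x), by
    rw [dim_cl, dimVec_ofMat]⟩ : {c : Cl K I E s t // c.dim = α})) ?_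
  rintro ⟨c, hc⟩
  induction c using cl_ind with
  | _ M => 
  rw [dim_cl] at hc
  obtain ⟨x, hx⟩ := exists_ofMat M hc
  exact ⟨x, Subtype.ext (cl_eq.2 hx).symm⟩


theorem orient_fin [Fintype I] {s' t' : E → I} (hr : Reor s t s' t') (τ : K ≃+* K) (α : I → ℕ)
    (M : QRep K I E s t) (hM : M.Indecomposable) (hd : M.dimVec = α) (hτ : SIso τ M M) :
    ∃ N : QRep K I E s' t', N.Indecomposable ∧ N.dimVec = α ∧ SIso τ N N := by
  have fin : ∀ (s t : E → I) (α : I → ℕ), Finite {m : Multiset {x : Cl K I E s t // x.Ind} //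
      (m.map (fun x => x.1.dim)).sum = α} := fun s t α =>
    Finite.of_equiv {c : Cl K I E s t // c.dim = α}
      (ksEquiv.subtypeEquiv fun m => by rw [ks_dim]).symm
  obtain ⟨e, he⟩ := equivariant (fun x : {x : Cl K I E s t // x.Ind} => x.1.dim) (Cl.twPermI τ)
    (fun x : {x : Cl K I E s' t' // x.Ind} => x.1.dim) (Cl.twPermI τ)
    (fun y => Cl.tw_dim _ _) (fun y => Cl.tw_dim _ _) (fun y => y.2.dim_ne) (fun y => y.2.dim_ne)
    (fin s t) (fin s' t') (fun α j => by
      rw [card_fix_ms, card_fix_ms]; exact card_fix_cl_eq hr _ _) α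
  have h1 := he ⟨⟨cl M, hM⟩, by rw [dim_cl, hd]⟩ ⟨⟨cl M, hM⟩, by rw [dim_cl, hd]⟩
    (Subtype.ext (cl_tw_eq.2 hτ))
  obtain ⟨⟨⟨c, hc⟩, hc'⟩, h2⟩ : ∃ c, c = e ⟨⟨cl M, hM⟩, by rw [dim_cl, hd]⟩ := ⟨_, rfl⟩
  rw [← h2] at h1
  induction c using cl_ind with
  | _ N => 
  exact ⟨N, hc, hc', cl_tw_eq.1 (congrArg Subtype.val h1)⟩

end QRep

open Polynomial in
theorem natCard_fix_le (F : Type*) [Field F] {q : ℕ} (hq : 1 < q) :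
    Finite {x : F // x ^ q = x} ∧ Nat.card {x : F // x ^ q = x} ≤ q := by
  classical
  have hne := FiniteField.X_pow_card_sub_X_ne_zero F hq
  have h : ∀ x : F, x ^ q = x ↔ x ∈ (X ^ q - X : F[X]).roots.toFinset := fun x => by
    rw [Multiset.mem_toFinset, mem_roots hne]; simp [sub_eq_zero]
  have e := Equiv.subtypeEquivRight h
  refine ⟨Finite.of_equiv _ e.symm, ?_⟩
  rw [Nat.card_congr e, Nat.card_eq_fintype_card, Fintype.card_coe]
  refine (Multiset.toFinset_card_le _).trans ((card_roots' _).trans ?_)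
  rw [FiniteField.X_pow_card_sub_X_natDegree_eq F hq]

open Polynomial in
theorem natCard_fix_eq (F : Type*) [Field F] [IsAlgClosed F] (p n : ℕ) [CharP F p] (hp : p.Prime)
    (hn : n ≠ 0) : Nat.card {x : F // x ^ (p ^ n) = x} = p ^ n := by
  classical
  have hq : 1 < p ^ n := Nat.one_lt_pow hn hp.one_lt
  have hne := FiniteField.X_pow_card_sub_X_ne_zero F hq
  have h : ∀ x : F, x ^ p ^ n = x ↔ x ∈ (X ^ p ^ n - X : F[X]).roots.toFinset := fun x => by
    rw [Multiset.mem_toFinset, mem_roots hne]; simp [sub_eq_zero]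
  have e := Equiv.subtypeEquivRight h
  have hs : (X ^ p ^ n - X : F[X]).Separable := galois_poly_separable p _ (dvd_pow_self p hn)
  rw [Nat.card_congr e, Nat.card_eq_fintype_card, Fintype.card_coe,
    Multiset.toFinset_card_of_nodup (nodup_roots hs),
    ← (IsAlgClosed.splits _).natDegree_eq_card_roots, FiniteField.X_pow_card_sub_X_natDegree_eq F hq]

theorem pow_iter_fix {L : Type*} [Monoid L] {x : L} {q : ℕ} (h : x ^ q = x) (j : ℕ) :
    x ^ q ^ j = x := by
  induction j with
  | zero => simp
  | succ j ih => rw [pow_succ, pow_mul, ih, h]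

theorem finrank_one_of_aut {K L : Type*} [Field K] [Field L] [Finite K] [Finite L] [Algebra K L]
    {Q g : ℕ} (hQ : 1 < Q) (hg : 0 < g) (hK : Nat.card K = Q ^ g) (hd : Module.finrank K L ∣ g)
    (S : L ≃+* L) (hS : ∀ c : K, S (algebraMap K L c) = algebraMap K L (c ^ Q))
    (hSg : S ^ g = 1) : Module.finrank K L = 1 := by
  have hSn : ∀ (n : ℕ) (c : K), (S ^ n) (algebraMap K L c) = algebraMap K L (c ^ Q ^ n) := by
    intro n c
    induction n with
    | zero => simp
    | succ n ih =>
      rw [pow_succ', RingAut.mul_apply, ih, hS, pow_succ, pow_mul]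
  have ho : orderOf S = g := by
    refine Nat.dvd_antisymm (orderOf_dvd_of_pow_eq_one hSg) ?_
    have h1 : orderOf S ≠ 0 := fun h => by
      have := orderOf_dvd_of_pow_eq_one hSg
      rw [h] at this; omega
    have h2 := natCard_fix_le K (Nat.one_lt_pow h1 hQ)
    have h3 : ∀ c : K, c ^ Q ^ orderOf S = c := fun c => by
      have := hSn (orderOf S) c
      rw [pow_orderOf_eq_one] at this
      exact ((algebraMap K L).injective this).symm
    have h4 : Nat.card {x : K // x ^ Q ^ orderOf S = x} = Nat.card K :=
      Nat.card_congr (Equiv.subtypeUnivEquiv h3)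
    rw [h4, hK] at h2
    have h5 := (Nat.pow_le_pow_iff_right hQ).1 h2.2
    have h6 := Nat.le_of_dvd hg (orderOf_dvd_of_pow_eq_one hSg)
    rw [le_antisymm h6 h5]
  let G := Subgroup.zpowers S
  let F' := FixedPoints.subfield G L
  have : Finite (L ≃+* L) := Finite.of_injective _ (DFunLike.coe_injective (F := L ≃+* L))
  have : Fintype G := Fintype.ofFinite _
  have h1 : Module.finrank F' L = Fintype.card G := FixedPoints.finrank_eq_card G L
  have h2 : Fintype.card G = g := by rw [← Nat.card_eq_fintype_card, Nat.card_zpowers, ho]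
  have h3 : Nat.card L = Nat.card F' ^ g := by
    rw [← h2, ← h1]; exact Module.natCard_eq_pow_finrank
  have h4 : Nat.card L = (Q ^ Module.finrank K L) ^ g := by
    rw [Module.natCard_eq_pow_finrank (K := K), hK, ← pow_mul, ← pow_mul, mul_comm]
  have h5 : Nat.card F' = Q ^ Module.finrank K L :=
    Nat.pow_left_injective (Nat.pos_iff_ne_zero.1 hg) (h3.symm.trans h4)
  have h6 : ∀ x : L, S x = x → x ^ Q ^ Module.finrank K L = x → ∃ c : K, c ^ Q = c ∧ algebraMap K L c = x := by
    intro x hx hx'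
    obtain ⟨j, hj⟩ := hd
    have h7 : x ^ Q ^ g = x := by
      rw [hj, pow_mul]; exact pow_iter_fix hx' j
    obtain ⟨hf, hc⟩ := natCard_fix_le L (Nat.one_lt_pow (Nat.pos_iff_ne_zero.1 hg) hQ)
    rw [← hK] at hc hf h7
    have : Fintype K := Fintype.ofFinite K
    let φ : K → {x : L // x ^ Nat.card K = x} := fun c => ⟨algebraMap K L c, by
      rw [← map_pow, Nat.card_eq_fintype_card, FiniteField.pow_card]⟩
    have hφ : Function.Injective φ := fun a b h =>
      (algebraMap K L).injective (congrArg Subtype.val h)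
    have hb := (Nat.bijective_iff_injective_and_card φ).2 
      ⟨hφ, le_antisymm (Nat.card_le_card_of_injective φ hφ) hc⟩
    obtain ⟨c, hc⟩ := hb.2 ⟨x, h7⟩
    have hc' : algebraMap K L c = x := congrArg Subtype.val hc
    refine ⟨c, (algebraMap K L).injective ?_, hc'⟩
    rw [← hS, hc', hx]
  have h8 : Nat.card F' ≤ Nat.card {c : K // c ^ Q = c} := by
    have : Fintype F' := Fintype.ofFinite F'
    have h9 : ∀ x : F', ∃ c : K, c ^ Q = c ∧ algebraMap K L c = x := fun x => by
      refine h6 x (x.2 ⟨S, Subgroup.mem_zpowers S⟩) ?_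
      rw [← h5, Nat.card_eq_fintype_card]
      exact congrArg Subtype.val (FiniteField.pow_card x)
    choose c hc hc' using h9
    refine Nat.card_le_card_of_injective (fun x => ⟨c x, hc x⟩) ?_
    intro x y hxy
    have := congrArg Subtype.val hxy
    dsimp only at this
    exact Subtype.ext (by rw [← hc', ← hc' y, this])
  have h10 := h8.trans (natCard_fix_le K hQ).2
  rw [h5] at h10
  have h11 : Module.finrank K L ≤ 1 := (Nat.pow_le_pow_iff_right hQ).1 (by simpa using h10)
  have h12 : 0 < Module.finrank K L := Module.finrank_pos
  omega

theorem exists_residue {R : Type} [Ring R] [Finite R] [Nontrivial R]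
    (hR : ∀ a : R, IsUnit a ∨ IsNilpotent a) : ∃ (L : Type) (_ : Field L) (π : R →+* L),
      Function.Surjective π ∧ (∀ r, IsNilpotent r → π r = 0) ∧
      ∃ N : ℕ, ∀ f : Fin N → R, (∀ j, π (f j) = 0) → (List.ofFn f).prod = 0 := by
  have hnil : ∀ a b : R, IsNilpotent a → IsNilpotent (b * a) := by
    intro a b ha
    refine (hR (b * a)).resolve_left fun hu => ?_
    obtain ⟨n, hn⟩ := ha
    obtain ⟨u, hu⟩ := hu
    have h1 : (u⁻¹.1 * b) * a = 1 := by rw [mul_assoc, ← hu]; simp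
    have : ∀ n : ℕ, a ^ n = 0 → False := by
      intro n
      induction n with
      | zero => simp
      | succ n ih =>
        intro h
        apply ih
        rw [← one_mul (a ^ n), ← h1, mul_assoc, ← pow_succ', h, mul_zero]
    exact this n hn
  have hmem : ∀ a : R, IsNilpotent a → a ∈ Ring.jacobson R := by
    intro a ha
    rw [← Ideal.jacobson_bot, Ideal.mem_jacobson_iff]
    intro y
    obtain ⟨u, hu⟩ := (hnil a y ha).isUnit_one_add
    refine ⟨u⁻¹.1, ?_⟩
    rw [Ideal.mem_bot, mul_assoc]
    have : u⁻¹.1 * (1 + y * a) = 1 := by rw [← hu]; simp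
    rw [mul_add, mul_one] at this
    rw [add_comm (_ * _), this, sub_self]
  have htop : Ring.jacobson R ≠ ⊤ := by
    rw [← Ideal.jacobson_bot]
    rw [Ne, Ideal.jacobson_eq_top_iff]
    exact bot_ne_top
  have hun : ∀ a ∉ Ring.jacobson R, IsUnit a := fun a ha =>
    (hR a).resolve_right fun h => ha (hmem a h)
  have hun' : ∀ a, IsUnit a → a ∉ Ring.jacobson R := fun a ha h =>
    htop (Ideal.eq_top_of_isUnit_mem _ h ha)
  have hnt : Nontrivial (R ⧸ Ring.jacobson R) := Ideal.Quotient.nontrivial_iff.2 htop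
  have hnz : NoZeroDivisors (R ⧸ Ring.jacobson R) := ⟨by
    intro a b h
    obtain ⟨a, rfl⟩ := Ideal.Quotient.mk_surjective a
    obtain ⟨b, rfl⟩ := Ideal.Quotient.mk_surjective b
    rw [← map_mul, Ideal.Quotient.eq_zero_iff_mem] at h
    rw [Ideal.Quotient.eq_zero_iff_mem, Ideal.Quotient.eq_zero_iff_mem]
    by_contra! hc
    exact hun' _ ((hun a hc.1).mul (hun b hc.2)) h⟩
  have hdom : IsDomain (R ⧸ Ring.jacobson R) := NoZeroDivisors.to_isDomain _
  have : Finite (R ⧸ Ring.jacobson R) := Finite.of_surjective _ Ideal.Quotient.mk_surjective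
  have hf := Finite.isDomain_to_isField (R ⧸ Ring.jacobson R)
  refine ⟨R ⧸ Ring.jacobson R, hf.toField, Ideal.Quotient.mk (Ring.jacobson R),
    Ideal.Quotient.mk_surjective, fun r hr => Ideal.Quotient.eq_zero_iff_mem.2 (hmem r hr), ?_⟩
  obtain ⟨N, hN⟩ := IsArtinianRing.isNilpotent_jacobson_bot (R := R)
  rw [Ideal.jacobson_bot] at hN
  refine ⟨N, fun f hf => ?_⟩
  have : ∀ (J : Ideal R) (n : ℕ) (f : Fin n → R), (∀ j, f j ∈ J) → 
      (List.ofFn f).prod ∈ J ^ n := by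
    intro J n
    induction n with
    | zero => intro f _; rw [Submodule.pow_zero, Ideal.one_eq_top]; trivial
    | succ n ih =>
      intro f hf
      rw [List.ofFn_succ', List.concat_eq_append, List.prod_append, List.prod_singleton,
        Submodule.pow_succ]
      exact Ideal.mul_mem_mul (ih _ fun j => hf _) (hf _)
  have := this _ N f fun j => Ideal.Quotient.eq_zero_iff_mem.1 (hf j)
  rw [hN] at this
  exact this

theorem local_split {K R : Type} [Field K] [Finite K] [Ring R] [Finite R] [Nontrivial R] [Algebra K R]
    (hR : ∀ a : R, IsUnit a ∨ IsNilpotent a) {Q g : ℕ} (hQ : 1 < Q) (hg : 0 < g)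
    (hK : Nat.card K = Q ^ g) (hd : ∀ d, 0 < d → d ≤ Module.finrank K R → d ∣ g)
    (ψ : R →+* R) (hψ : ∀ c : K, ψ (algebraMap K R c) = algebraMap K R (c ^ Q))
    (u : R) (hu : IsUnit u) (hψu : ∀ r, ψ^[g] r * u = u * r) :
    ∃ (J : Set R), (∀ r, ∃ c : K, r - algebraMap K R c ∈ J) ∧ 
      ∃ N : ℕ, ∀ f : Fin N → R, (∀ j, f j ∈ J) → (List.ofFn f).prod = 0 := by
  obtain ⟨L, _, π, hπ, hnil, hN⟩ := exists_residue hR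
  refine ⟨{r | π r = 0}, ?_, hN⟩
  let _ : Algebra K L := (π.comp (algebraMap K R)).toAlgebra
  have hal : ∀ c : K, algebraMap K L c = π (algebraMap K R c) := fun _ => rfl
  have : Finite L := Finite.of_surjective π hπ
  have hfin : Module.finrank K L ≤ Module.finrank K R := by
    have : Module.Finite K R := Module.Finite.of_finite
    refine LinearMap.finrank_le_finrank_of_surjective (f := ({ π with map_smul' := ?_ } : R →ₗ[K] L)) hπ
    intro c r
    change π (c • r) = algebraMap K L c * π r
    rw [Algebra.smul_def, map_mul, hal]
  have hker : ∀ r, π r = 0 → π (ψ r) = 0 := by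
    intro r hr
    apply hnil
    refine IsNilpotent.map ((hR r).resolve_left fun h => ?_) ψ
    exact (h.map π).ne_zero hr
  let S0 : L →+* L := RingHom.liftOfSurjective π hπ ⟨π.comp ψ, fun r hr => hker r hr⟩
  have hS0 : ∀ r, S0 (π r) = π (ψ r) := fun r =>
    RingHom.liftOfRightInverse_comp_apply _ _ _ ⟨π.comp ψ, fun r hr => hker r hr⟩ r
  let S : L ≃+* L := RingEquiv.ofBijective S0 (Finite.injective_iff_bijective.1 S0.injective)
  have hS : ∀ r, S (π r) = π (ψ r) := hS0
  have hSn : ∀ n r, (S ^ n) (π r) = π (ψ^[n] r) := by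
    intro n r
    induction n with
    | zero => rfl
    | succ n ih => rw [pow_succ', RingAut.mul_apply, ih, hS, Function.iterate_succ_apply']
  have h1 : Module.finrank K L = 1 := by
    refine finrank_one_of_aut hQ hg hK (hd _ Module.finrank_pos hfin) S ?_ ?_
    · intro c
      rw [hal, hS, hψ, hal]
    · ext l
      obtain ⟨r, rfl⟩ := hπ l
      rw [hSn]
      have := congrArg π (hψu r)
      rw [map_mul, map_mul, mul_comm] at this
      exact mul_left_cancel₀ (hu.map π).ne_zero this
  intro r
  obtain ⟨c, hc⟩ := (finrank_eq_one_iff_of_nonzero' (1 : L) one_ne_zero).1 h1 (π r)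
  refine ⟨c, ?_⟩
  change π _ = 0
  rw [map_sub, ← hal, ← hc, Algebra.smul_def, mul_one, sub_self]

namespace QRep

variable {k : Type} [Field k] {I E : Type} {s t : E → I}

/-- endomorphisms, as matrices -/
def matEnd (α : I → ℕ) (x : Mats k s t α) : Subalgebra k (∀ i, Matrix (Fin (α i)) (Fin (α i)) k) where
  carrier := {θ | ∀ e, θ (t e) * x e = x e * θ (s e)}
  mul_mem' := by
    intro a b ha hb e
    change (a (t e) * b (t e)) * x e = x e * (a (s e) * b (s e))
    rw [Matrix.mul_assoc, hb, ← Matrix.mul_assoc, ha, Matrix.mul_assoc]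
  add_mem' := by
    intro a b ha hb e
    change (a (t e) + b (t e)) * x e = x e * (a (s e) + b (s e))
    rw [Matrix.add_mul, ha, hb, Matrix.mul_add]
  algebraMap_mem' := by
    intro c e
    simp [Algebra.algebraMap_eq_smul_one]

theorem mem_matEnd {α : I → ℕ} {x : Mats k s t α} {θ : ∀ i, Matrix (Fin (α i)) (Fin (α i)) k} :
    θ ∈ matEnd α x ↔ ∀ e, θ (t e) * x e = x e * θ (s e) := Iff.rfl

theorem indec_ofMat_iff {α : I → ℕ} {x : Mats k s t α} : (ofMat α x).Indecomposable ↔ α ≠ 0 ∧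
    ∀ θ : ∀ i, Matrix (Fin (α i)) (Fin (α i)) k, (∀ e, θ (t e) * x e = x e * θ (s e)) →
      (∀ i, θ i * θ i = θ i) → (∀ i, θ i = 0) ∨ (∀ i, θ i = 1) := by
  rw [indec_iff, isTrivial_iff, dimVec_ofMat]
  refine and_congr_right fun _ => ⟨fun h θ hθ hi => ?_, fun h p hp hi => ?_⟩
  · refine (h (fun i => (θ i).mulVecLin) ?_ ?_).imp (fun h i => ?_) (fun h i => ?_)
    · intro e v
      have : ∀ v, (θ (t e)).mulVec ((x e).mulVec v) = (x e).mulVec ((θ (s e)).mulVec v) := fun v => by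
        rw [Matrix.mulVec_mulVec, Matrix.mulVec_mulVec, hθ]
      exact this v
    · intro i v
      have : ∀ v, (θ i).mulVec ((θ i).mulVec v) = (θ i).mulVec v := fun v => by
        rw [Matrix.mulVec_mulVec, hi]
      exact this v
    · apply Matrix.toLin'.injective
      have e : ∀ v : Fin (α i) → k, 0 = Matrix.toLin' (0 : Matrix (Fin (α i)) (Fin (α i)) k) v := by simp
      exact LinearMap.ext fun v => (h i v).trans (e v)
    · apply Matrix.toLin'.injective
      have e : ∀ v : Fin (α i) → k, v = Matrix.toLin' (1 : Matrix (Fin (α i)) (Fin (α i)) k) v := by simp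
      exact LinearMap.ext fun v => (h i v).trans (e v)
  · let q : ∀ i, (Fin (α i) → k) →ₗ[k] (Fin (α i) → k) := p
    have hq : ∀ i v, q i v = (LinearMap.toMatrix' (q i)).mulVec v := fun i v => by
      rw [LinearMap.toMatrix'_mulVec]
    refine (h (fun i => LinearMap.toMatrix' (q i)) ?_ ?_).imp (fun h i v => ?_) (fun h i v => ?_)
    · intro e
      apply Matrix.toLin'.injective
      rw [Matrix.toLin'_mul, Matrix.toLin'_mul, Matrix.toLin'_toMatrix', Matrix.toLin'_toMatrix']
      exact LinearMap.ext fun v => hp e v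
    · intro i
      rw [← LinearMap.toMatrix'_mul]
      congr 1
      exact LinearMap.ext fun v => hi i v
    · refine (hq i v).trans ?_
      rw [h i]; exact Matrix.zero_mulVec (m := Fin (α i)) (n := Fin (α i)) v
    · refine (hq i v).trans ?_
      rw [h i]; exact Matrix.one_mulVec (m := Fin (α i)) v

theorem matEnd_idem {α : I → ℕ} {x : Mats k s t α} (h : (ofMat α x).Indecomposable)
    (e : matEnd α x) (he : e * e = e) : e = 0 ∨ e = 1 := by
  refine ((indec_ofMat_iff.1 h).2 e.1 e.2 fun i => congrFun (congrArg Subtype.val he) i).imp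
    (fun h => Subtype.ext (funext h)) (fun h => Subtype.ext (funext h))

theorem matEnd_nontrivial {α : I → ℕ} {x : Mats k s t α} (h : α ≠ 0) :
    Nontrivial (matEnd α x) := by
  obtain ⟨i, hi⟩ := Function.ne_iff.1 h
  refine ⟨0, 1, fun h => ?_⟩
  have := congrFun (congrArg Subtype.val h) i
  have h0 : 0 < α i := Nat.pos_of_ne_zero hi
  have := congrFun (congrFun this ⟨0, h0⟩) ⟨0, h0⟩
  simp at this

/-- entrywise ring homs -/
def mapA {K K' : Type} [Field K] [Field K'] (α : I → ℕ) (f : K →+* K') :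
    (∀ i, Matrix (Fin (α i)) (Fin (α i)) K) →+* (∀ i, Matrix (Fin (α i)) (Fin (α i)) K') :=
  RingHom.pi fun i => f.mapMatrix.comp (Pi.evalRingHom _ i)

theorem mapA_apply {K K' : Type} [Field K] [Field K'] (α : I → ℕ) (f : K →+* K')
    (θ : ∀ i, Matrix (Fin (α i)) (Fin (α i)) K) (i : I) : mapA α f θ i = (θ i).map f := rfl

theorem map_mul_lin {K : Type} [Field K] [Algebra K k] {a b c : ℕ} (l : k →ₗ[K] K)
    (A : Matrix (Fin a) (Fin b) k) (B : Matrix (Fin b) (Fin c) K) :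
    (A * B.map (algebraMap K k)).map l = A.map l * B := by
  ext i j
  simp only [Matrix.map_apply, Matrix.mul_apply, map_sum]
  refine Finset.sum_congr rfl fun m _ => ?_
  rw [mul_comm, ← Algebra.smul_def, map_smul, smul_eq_mul, mul_comm]

theorem map_lin_mul {K : Type} [Field K] [Algebra K k] {a b c : ℕ} (l : k →ₗ[K] K)
    (A : Matrix (Fin b) (Fin c) k) (B : Matrix (Fin a) (Fin b) K) :
    (B.map (algebraMap K k) * A).map l = B * A.map l := by
  ext i j
  simp only [Matrix.map_apply, Matrix.mul_apply, map_sum]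
  refine Finset.sum_congr rfl fun m _ => ?_
  rw [← Algebra.smul_def, map_smul, smul_eq_mul]

theorem idem_of_scalar {A : Type*} [Ring A] [Algebra k A] [Nontrivial A] {a : A} {c : k} (ha : a * a = a)
    (hn : IsNilpotent (a - algebraMap k A c)) : a = 0 ∨ a = 1 := by
  have nid : ∀ b : A, b * b = b → IsNilpotent b → b = 0 := by
    rintro b hb ⟨n, hn⟩
    have : ∀ n : ℕ, b ^ (n + 1) = b := by
      intro n
      induction n with
      | zero => simp
      | succ n ih => rw [pow_succ, ih, hb]
    cases n with
    | zero => 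
      rw [pow_zero] at hn; exact (one_ne_zero hn).elim
    | succ n => rw [← this n, hn]
  have h1 : (a - algebraMap k A c) * (1 - algebraMap k A c - a) = algebraMap k A (c * c - c) := by
    rw [map_sub, map_mul]
    have := Algebra.commutes c a
    simp only [mul_sub, sub_mul, mul_one, ha, this]
    abel
  have hc : Commute (a - algebraMap k A c) (1 - algebraMap k A c - a) := by
    have h2 : Commute (algebraMap k A c) a := Algebra.commutes c a
    refine Commute.sub_right (Commute.sub_right (Commute.one_right _) ?_) ?_
    · exact (h2.symm.sub_left (Commute.refl _))
    · exact (Commute.refl a).sub_left h2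
  have h2 := hc.isNilpotent_mul_right hn
  rw [h1, IsNilpotent.map_iff (algebraMap k A).injective] at h2
  have h3 : c * (c - 1) = 0 := by rw [mul_sub, mul_one]; exact h2.eq_zero
  rcases mul_eq_zero.1 h3 with h | h
  · left
    rw [h, map_zero, sub_zero] at hn
    exact nid a ha hn
  · right
    have h4 : c = 1 := sub_eq_zero.1 h
    rw [h4, map_one] at hn
    have := nid (1 - a) (by rw [mul_sub, sub_mul, sub_mul, ha]; simp) (by simpa using hn.neg)
    exact (sub_eq_zero.1 this).symm

open Pointwise in
theorem base_indec [Fintype I] {K : Type} [Field K] [Algebra K k] {α : I → ℕ} (h0 : α ≠ 0)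
    (x : Mats K s t α) (J : Set (matEnd α x))
    (hJ : ∀ r, ∃ c : K, r - algebraMap K _ c ∈ J) (N : ℕ) 
    (hN : ∀ f : Fin N → (matEnd α x), (∀ j, f j ∈ J) → (List.ofFn f).prod = 0) :
    (ofMat α (fun e => (x e).map (algebraMap K k)) : QRep k I E s t).Indecomposable := by
  classical
  rw [indec_ofMat_iff]
  refine ⟨h0, fun θ hθ hi => ?_⟩
  have hnt : Nontrivial (∀ i, Matrix (Fin (α i)) (Fin (α i)) k) := by
    have := matEnd_nontrivial (x := (fun e => (x e).map (algebraMap K k) : Mats k s t α)) h0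
    exact (Subtype.val_injective (p := fun y => y ∈ matEnd α (fun e => (x e).map (algebraMap K k)))).nontrivial
  let b := Module.Basis.ofVectorSpace K k
  let Θ : Module.Basis.ofVectorSpaceIndex K k → matEnd α x := fun j =>
    ⟨fun i => (θ i).map (b.coord j), fun e => by
      change (θ (t e)).map (b.coord j) * x e = x e * (θ (s e)).map (b.coord j)
      rw [← map_mul_lin, hθ, map_lin_mul]⟩
  choose c hc using fun j => hJ (Θ j)
  let S : Set (∀ i, Matrix (Fin (α i)) (Fin (α i)) k) := (fun r : matEnd α x => mapA α (algebraMap K k) r.1) '' J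
  let F : Finset (Module.Basis.ofVectorSpaceIndex K k) :=
    Finset.univ.biUnion fun q : (Σ i, Fin (α i) × Fin (α i)) => (b.repr (θ q.1 q.2.1 q.2.2)).support
  have hsum : ∀ i u v, θ i u v = ∑ j ∈ F, algebraMap K k (b.coord j (θ i u v)) * b j := by
    intro i u v
    conv_lhs => rw [← b.linearCombination_repr (θ i u v), Finsupp.linearCombination_apply]
    rw [Finsupp.sum_of_support_subset (s := F)]
    · exact Finset.sum_congr rfl fun j _ => Algebra.smul_def _ _
    · exact Finset.subset_biUnion_of_mem (fun q : (Σ i, Fin (α i) × Fin (α i)) =>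
        (b.repr (θ q.1 q.2.1 q.2.2)).support) (Finset.mem_univ ⟨i, u, v⟩)
    · simp
  have hmem : θ - algebraMap k _ (∑ j ∈ F, algebraMap K k (c j) * b j) ∈ Submodule.span k S := by
    have : θ - algebraMap k _ (∑ j ∈ F, algebraMap K k (c j) * b j) =
        ∑ j ∈ F, b j • mapA α (algebraMap K k) (Θ j - algebraMap K _ (c j)).1 := by
      funext i
      ext u v
      rw [Finset.sum_apply, Matrix.sum_apply]
      simp only [Pi.sub_apply, Matrix.sub_apply, Pi.smul_apply, Matrix.smul_apply, mapA_apply,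
        Matrix.map_apply]
      rw [hsum i u v, Pi.algebraMap_apply, Matrix.algebraMap_matrix_apply]
      have e1 : ∀ j, (Θ j - algebraMap K (matEnd α x) (c j)).1 i u v =
          b.coord j (θ i u v) - (if u = v then c j else 0) := by
        intro j
        change b.coord j (θ i u v) - (algebraMap K (Matrix (Fin (α i)) (Fin (α i)) K) (c j)) u v = _
        rw [Matrix.algebraMap_matrix_apply]; rfl
      simp only [e1, map_sub, smul_eq_mul, mul_sub, Finset.sum_sub_distrib]
      congr 1
      · exact Finset.sum_congr rfl fun j _ => mul_comm _ _
      · split_ifs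
        · exact Finset.sum_congr rfl fun j _ => mul_comm _ _
        · simp
    rw [this]
    exact Submodule.sum_mem _ fun j _ => Submodule.smul_mem _ _
      (Submodule.subset_span ⟨_, hc j, rfl⟩)
  have hnil : IsNilpotent (θ - algebraMap k _ (∑ j ∈ F, algebraMap K k (c j) * b j)) := by
    refine ⟨N, ?_⟩
    have h1 := Submodule.pow_mem_pow _ hmem N
    rw [Submodule.span_pow] at h1
    have h2 : S ^ N ⊆ {0} := by
      intro y hy
      rw [Set.mem_pow] at hy
      obtain ⟨f, rfl⟩ := hy
      choose r hr hr' using fun j => (f j).2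
      have e1 : (fun j => ((f j : _) : ∀ i, Matrix (Fin (α i)) (Fin (α i)) k)) =
        fun j => (mapA α (algebraMap K k)).comp (matEnd α x).toSubring.subtype (r j) :=
        funext fun j => (hr' j).symm
      rw [e1]
      have e2 : (fun j => (mapA α (algebraMap K k)).comp (matEnd α x).toSubring.subtype (r j)) =
        ((mapA α (algebraMap K k)).comp (matEnd α x).toSubring.subtype) ∘ r := rfl
      rw [e2, ← List.map_ofFn, ← map_list_prod]
      exact (congrArg _ (hN r hr)).trans (map_zero _)
    have h3 := Submodule.span_mono (R := k) h2 h1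
    simpa using h3
  refine (idem_of_scalar (k := k) (a := θ) (funext hi) hnil).imp congrFun congrFun

end QRep

namespace QRep

variable {k : Type} [Field k] {I E : Type} {s t : E → I}

section
variable {K : Type} [Field K] {α : I → ℕ}

theorem twist_data {x : Mats K s t α} (σ : K →+* K) (γ γ' : ∀ i, Matrix (Fin (α i)) (Fin (α i)) K)
    (h1 : γ * γ' = 1) (h2 : γ' * γ = 1)
    (hx : ∀ e, γ (t e) * (x e).map σ = x e * γ (s e)) {g : ℕ} (hσ : ∀ c, σ^[g] c = c) :
    ∃ ψ : matEnd α x →+* matEnd α x, (∀ c : K, ψ (algebraMap K _ c) = algebraMap K _ (σ c)) ∧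
      ∃ u : matEnd α x, IsUnit u ∧ ∀ r, ψ^[g] r * u = u * r := by
  have h1' : ∀ i, γ i * γ' i = 1 := fun i => congrFun h1 i
  have h2' : ∀ i, γ' i * γ i = 1 := fun i => congrFun h2 i
  have hx' : ∀ e, γ' (t e) * x e = (x e).map σ * γ' (s e) := by
    intro e
    calc γ' (t e) * x e = γ' (t e) * (x e * γ (s e)) * γ' (s e) := by
          rw [Matrix.mul_assoc, Matrix.mul_assoc, h1', Matrix.mul_one]
      _ = _ := by rw [← hx, ← Matrix.mul_assoc, h2', Matrix.one_mul]
  obtain ⟨T, hT⟩ : ∃ T, T = mapA α σ := ⟨_, rfl⟩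
  have hTa : ∀ θ i, T θ i = (θ i).map σ := by intro θ i; rw [hT]; rfl
  have mmul : ∀ {a b c : ℕ} (X : Matrix (Fin a) (Fin b) K)
      (Y : Matrix (Fin b) (Fin c) K), (X * Y).map σ = X.map σ * Y.map σ :=
      fun X Y => Matrix.map_mul (f := σ)
  have hmem : ∀ θ ∈ matEnd α x, γ * T θ * γ' ∈ matEnd α x := by
    intro θ hθ e
    change γ (t e) * T θ (t e) * γ' (t e) * x e = x e * (γ (s e) * T θ (s e) * γ' (s e))
    rw [Matrix.mul_assoc, hx', hTa, hTa, ← Matrix.mul_assoc, Matrix.mul_assoc (γ _), ← mmul, hθ e, mmul,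
      ← Matrix.mul_assoc, hx]
    simp only [Matrix.mul_assoc]
  let ψ : matEnd α x →+* matEnd α x :=
    { toFun := fun θ => ⟨γ * T θ.1 * γ', hmem _ θ.2⟩
      map_one' := Subtype.ext (by
        change γ * T 1 * γ' = 1
        rw [map_one, mul_one, h1])
      map_zero' := Subtype.ext (by
        change γ * T 0 * γ' = 0
        rw [map_zero, mul_zero, zero_mul])
      map_mul' := fun a b => Subtype.ext (by
        change γ * T (a.1 * b.1) * γ' = (γ * T a.1 * γ') * (γ * T b.1 * γ')
        rw [map_mul]
        calc γ * (T a.1 * T b.1) * γ' = γ * T a.1 * (1 * T b.1 * γ') := by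
              simp only [mul_assoc, one_mul]
          _ = _ := by rw [← h2]; simp only [mul_assoc])
      map_add' := fun a b => Subtype.ext (by
        change γ * T (a.1 + b.1) * γ' = (γ * T a.1 * γ') + (γ * T b.1 * γ')
        rw [map_add, mul_add, add_mul]) }
  have hψ : ∀ θ, (ψ θ).1 = γ * T θ.1 * γ' := fun _ => rfl
  let h : ℕ → ∀ i, Matrix (Fin (α i)) (Fin (α i)) K := fun n => Nat.rec 1 (fun _ a => γ * T a) n
  let h' : ℕ → ∀ i, Matrix (Fin (α i)) (Fin (α i)) K := fun n => Nat.rec 1 (fun _ a => T a * γ') n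
  have hs : ∀ n, h (n + 1) = γ * T (h n) := fun _ => rfl
  have hs' : ∀ n, h' (n + 1) = T (h' n) * γ' := fun _ => rfl
  have hh : ∀ n, h n * h' n = 1 ∧ h' n * h n = 1 := by
    intro n
    induction n with
    | zero => exact ⟨mul_one _, mul_one _⟩
    | succ n ih =>
      rw [hs, hs']
      constructor
      · rw [mul_assoc, ← mul_assoc (T _), ← map_mul, ih.1, map_one, one_mul, h1]
      · rw [mul_assoc, ← mul_assoc γ', h2, one_mul, ← map_mul, ih.2, map_one]
  have hmap : ∀ {a b : ℕ} (X : Matrix (Fin a) (Fin b) K) (n : ℕ),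
      (X.map σ^[n]).map σ = X.map σ^[n + 1] := by
    intro a b X n
    ext
    simp only [Matrix.map_apply, Function.iterate_succ_apply']
  have hxn : ∀ n e, h n (t e) * (x e).map σ^[n] = x e * h n (s e) := by
    intro n e
    induction n with
    | zero => 
      change (1 : Matrix _ _ _) * (x e).map id = x e * (1 : Matrix _ _ _)
      rw [Matrix.map_id, Matrix.mul_one, Matrix.one_mul]
    | succ n ih =>
      rw [← hmap, hs]
      change γ (t e) * T (h n) (t e) * _ = x e * (γ (s e) * T (h n) (s e))
      rw [hTa, Matrix.mul_assoc, ← mmul, ih, mmul, ← Matrix.mul_assoc, hx, hTa, Matrix.mul_assoc]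
  have hTn : ∀ θ i, (T^[g] θ) i = θ i := by
    intro θ i
    have : ∀ n, (T^[n] θ) i = (θ i).map σ^[n] := by
      intro n
      induction n with
      | zero => simp
      | succ n ih => rw [Function.iterate_succ_apply', hTa, ih, hmap]
    rw [this]
    ext u v
    exact hσ _
  have hconj : ∀ n r, (ψ^[n] r).1 * h n = h n * T^[n] r.1 := by
    intro n r
    induction n with
    | zero => exact (mul_one _).trans (one_mul _).symm
    | succ n ih =>
      rw [Function.iterate_succ_apply', hψ, hs, Function.iterate_succ_apply', mul_assoc _ γ',
        ← mul_assoc γ', h2, one_mul, mul_assoc, ← map_mul, ih, map_mul, mul_assoc]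
  have hσ' : ∀ e, (x e).map σ^[g] = x e := fun e => by ext; exact hσ _
  have hu : h g ∈ matEnd α x := fun e => by
    have := hxn g e
    rwa [hσ'] at this
  have hu' : h' g ∈ matEnd α x := fun e => by
    have ha : ∀ i, h g i * h' g i = 1 := fun i => congrFun (hh g).1 i
    have hb : ∀ i, h' g i * h g i = 1 := fun i => congrFun (hh g).2 i
    calc h' g (t e) * x e = h' g (t e) * (x e * h g (s e)) * h' g (s e) := by
          rw [Matrix.mul_assoc, Matrix.mul_assoc, ha, Matrix.mul_one]
      _ = _ := by rw [← hu e, ← Matrix.mul_assoc, hb, Matrix.one_mul]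
  refine ⟨ψ, fun c => Subtype.ext ?_, ⟨h g, hu⟩, ⟨⟨⟨h g, hu⟩, ⟨h' g, hu'⟩, Subtype.ext (hh g).1,
    Subtype.ext (hh g).2⟩, rfl⟩, fun r => Subtype.ext ?_⟩
  · rw [hψ]
    have : T (algebraMap K _ c) = algebraMap K _ (σ c) := by
      funext i
      rw [hTa, Pi.algebraMap_apply, Pi.algebraMap_apply]
      ext u v
      rw [Matrix.map_apply, Matrix.algebraMap_matrix_apply, Matrix.algebraMap_matrix_apply]
      split_ifs <;> simp
    change γ * T (algebraMap K _ c) * γ' = algebraMap K _ (σ c)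
    rw [this, mul_assoc, Algebra.commutes, ← mul_assoc, h1, one_mul]
  · change (ψ^[g] r).1 * h g = h g * r.1
    rw [hconj]
    congr 1
    exact funext (hTn r.1)

theorem abs_indec [Fintype I] [Finite K] [Algebra K k] {Q g : ℕ} (hQ : 1 < Q) (hg : 0 < g)
    (hK : Nat.card K = Q ^ g) (hd : ∀ d, 0 < d → d ≤ ∑ i, α i * α i → d ∣ g)
    (σ : K ≃+* K) (hσ : ∀ c, σ c = c ^ Q) (x : Mats K s t α) (hx : (ofMat α x).Indecomposable)
    (hs : SIso σ (ofMat α x) (ofMat α x)) :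
    (ofMat α (fun e => (x e).map (algebraMap K k)) : QRep k I E s t).Indecomposable := by
  obtain ⟨γ, hγ⟩ := sIso_ofMat_iff.1 hs
  have hα := (indec_ofMat_iff.1 hx).1
  have hit : ∀ n c, σ.toRingHom^[n] c = c ^ Q ^ n := by
    intro n c
    induction n with
    | zero => simp
    | succ n ih => 
      rw [Function.iterate_succ_apply', ih, pow_succ, pow_mul]; exact hσ _
  have : Fintype K := Fintype.ofFinite K
  obtain ⟨ψ, h1, u, h2, h3⟩ := twist_data (x := x) σ.toRingHom (fun i => (γ i).1)
    (fun i => (γ i)⁻¹.1) (funext fun i => (γ i).mul_inv) (funext fun i => (γ i).inv_mul) hγ (g := g)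
    (fun c => by rw [hit, ← hK, Nat.card_eq_fintype_card, FiniteField.pow_card])
  have : Nontrivial (matEnd α x) := matEnd_nontrivial hα
  have hfin : Module.finrank K (matEnd α x) ≤ ∑ i, α i * α i := by
    refine (Submodule.finrank_le (Subalgebra.toSubmodule (matEnd α x))).trans ?_
    rw [Module.finrank_pi_fintype]
    exact Finset.sum_le_sum fun i _ => by simp [Module.finrank_matrix]
  have : Module.Finite K (matEnd α x) :=
    inferInstanceAs (Module.Finite K (Subalgebra.toSubmodule (matEnd α x)))
  obtain ⟨J, hJ, N, hN⟩ := local_split (K := K) (R := matEnd α x)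
    (unit_or_nilp_of_idem (k := K) (matEnd_idem hx)) hQ hg hK
    (fun d h0 hd' => hd d h0 (hd'.trans hfin)) ψ (fun c => by rw [h1]; congr 1; exact hσ c) u h2 h3
  exact base_indec hα x J hJ N hN

end

variable (k s t) in
/-- `α` is the dimension vector of an indecomposable. -/
def HasInd (α : I → ℕ) : Prop := ∃ M : QRep k I E s t, M.Indecomposable ∧ M.dimVec = α

theorem hasInd_iff {α : I → ℕ} :
    HasInd k s t α ↔ ∃ x : Mats k s t α, (ofMat α x).Indecomposable :=
  ⟨fun ⟨M, h, hd⟩ => (exists_ofMat M hd).imp fun _ hx => hx.indec h,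
    fun ⟨x, hx⟩ => ⟨_, hx, dimVec_ofMat α x⟩⟩

theorem exists_pow_fix {p : ℕ} [Fact p.Prime] [Algebra (ZMod p) k] [Algebra.IsAlgebraic (ZMod p) k]
    {ι : Type*} [Finite ι] (a : ι → k) : ∃ c : ℕ, 0 < c ∧ ∀ i, a i ^ p ^ c = a i := by
  have h1 : ∀ b : k, ∃ c : ℕ, 0 < c ∧ b ^ p ^ c = b := by
    intro b
    have hb := Algebra.IsIntegral.isIntegral (R := ZMod p) b
    have : FiniteDimensional (ZMod p) (IntermediateField.adjoin (ZMod p) {b}) :=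
      IntermediateField.adjoin.finiteDimensional hb
    have : Finite (IntermediateField.adjoin (ZMod p) {b}) := Module.finite_of_finite (ZMod p)
    have : Fintype (IntermediateField.adjoin (ZMod p) {b}) := Fintype.ofFinite _
    refine ⟨Module.finrank (ZMod p) (IntermediateField.adjoin (ZMod p) {b}), Module.finrank_pos, ?_⟩
    have h2 := FiniteField.pow_card
      (⟨b, IntermediateField.mem_adjoin_simple_self _ b⟩ : IntermediateField.adjoin (ZMod p) {b})
    rw [← Nat.card_eq_fintype_card, Module.natCard_eq_pow_finrank (K := ZMod p), Nat.card_zmod] at h2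
    exact congrArg Subtype.val h2
  have := Fintype.ofFinite ι
  choose c hc hc' using h1
  refine ⟨∏ i, c (a i), Finset.prod_pos fun i _ => hc _, fun i => ?_⟩
  obtain ⟨j, hj⟩ := Finset.dvd_prod_of_mem (fun i => c (a i)) (Finset.mem_univ i)
  rw [hj, pow_mul]
  exact pow_iter_fix (hc' _) j

theorem indec_of_base {K : Type} [Field K] [Algebra K k] {α : I → ℕ} (x : Mats K s t α)
    (h : (ofMat α (fun e => (x e).map (algebraMap K k)) : QRep k I E s t).Indecomposable) :
    (ofMat α x).Indecomposable := by
  rw [indec_ofMat_iff] at h ⊢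
  have mmul : ∀ {a b c : ℕ} (X : Matrix (Fin a) (Fin b) K)
      (Y : Matrix (Fin b) (Fin c) K), (X * Y).map (algebraMap K k) =
      X.map (algebraMap K k) * Y.map (algebraMap K k) :=
      fun X Y => Matrix.map_mul (f := algebraMap K k)
  have inj : ∀ {a b : ℕ}, Function.Injective
      (fun X : Matrix (Fin a) (Fin b) K => X.map (algebraMap K k)) :=
    fun {_ _} => Matrix.map_injective (algebraMap K k).injective
  refine ⟨h.1, fun θ hθ hi => (h.2 (fun i => (θ i).map (algebraMap K k)) (fun e => ?_) (fun i => ?_)).imp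
    (fun h i => inj ?_) (fun h i => inj ?_)⟩
  · rw [← mmul, ← mmul, hθ]
  · rw [← mmul, hi]
  · exact (h i).trans (by simp)
  · exact (h i).trans (by simp)

theorem orient [Fintype I] [Finite E] {p : ℕ} [Fact p.Prime] [Algebra (ZMod p) k]
    [Algebra.IsAlgebraic (ZMod p) k] [IsAlgClosed k] {s' t' : E → I} (hr : Reor s t s' t')
    {α : I → ℕ} (h : HasInd k s t α) : HasInd k s' t' α := by
  obtain ⟨x, hx⟩ := hasInd_iff.1 h
  have hp : p.Prime := Fact.out
  have : CharP k p := (Algebra.charP_iff (ZMod p) k p).1 inferInstance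
  obtain ⟨c, hc, hxc⟩ := exists_pow_fix (p := p) (k := k)
    (ι := Σ e : E, Fin (α (t e)) × Fin (α (s e))) (fun q => x q.1 q.2.1 q.2.2)
  have hxc' : ∀ e u v, x e u v ^ p ^ c = x e u v := fun e u v => hxc ⟨e, u, v⟩
  obtain ⟨g, hg⟩ : ∃ g, g = (∑ i, α i * α i).factorial := ⟨_, rfl⟩
  have hg0 : 0 < g := hg ▸ Nat.factorial_pos _
  have : ExpChar k p := ExpChar.prime hp
  let K : Subfield k := (iterateFrobenius k p (c * g)).eqLocusField (RingHom.id k)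
  have hKm : ∀ z : k, z ∈ K ↔ z ^ p ^ (c * g) = z := fun z => by
    change iterateFrobenius k p (c * g) z = z ↔ _
    rw [iterateFrobenius_def]
  have hcg : c * g ≠ 0 := (Nat.mul_pos hc hg0).ne'
  have hKc : Nat.card K = (p ^ c) ^ g := by
    rw [← pow_mul, ← natCard_fix_eq k p (c * g) hp hcg]
    exact Nat.card_congr (Equiv.subtypeEquivRight hKm)
  have hKf : Finite K := Nat.finite_of_card_ne_zero (by rw [hKc]; exact pow_ne_zero _ (pow_ne_zero _ hp.ne_zero))
  let x' : Mats K s t α := fun e u v => ⟨x e u v, (hKm _).2 (by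
    rw [pow_mul]; exact pow_iter_fix (hxc' e u v) g)⟩
  have hxx : (fun e => (x' e).map (algebraMap K k) : Mats k s t α) = x := rfl
  have hx' : (ofMat α x').Indecomposable := indec_of_base (k := k) x' (by rw [hxx]; exact hx)
  have : CharP K p := inferInstance
  have : ExpChar K p := ExpChar.prime hp
  let σ : K ≃+* K := RingEquiv.ofBijective (iterateFrobenius K p c)
    (Finite.injective_iff_bijective.1 (iterateFrobenius K p c).injective)
  have hσ : ∀ z, σ z = z ^ p ^ c := fun z => iterateFrobenius_def (R := K) p c z
  have hs : SIso σ (ofMat α x') (ofMat α x') := by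
    have := sIso_ofMat (s := s) (t := t) σ α x'
    have e : (fun e => (x' e).map σ : Mats K s t α) = x' := by
      funext e
      ext u v
      rw [Matrix.map_apply, hσ]
      exact hxc' e u v
    rwa [e] at this
  obtain ⟨N, hN, hNd, hNs⟩ := orient_fin hr σ α _ hx' (dimVec_ofMat α x') hs
  obtain ⟨y, hy⟩ := exists_ofMat N hNd
  refine hasInd_iff.2 ⟨_, abs_indec (k := k) (Q := p ^ c) (g := g) (Nat.one_lt_pow hc.ne' hp.one_lt)
    hg0 hKc ?_ σ hσ y (hy.indec hN) ((hy.symm.trans_sIso hNs).trans_iso hy)⟩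
  intro d hd hd'
  rw [hg]
  exact Nat.dvd_factorial hd hd'

end QRep

namespace QRep

variable {k : Type} [Field k] {I E : Type} {s t : E → I}

def castV (M : QRep k I E s t) {a b : I} (h : a = b) : M.V a ≃ₗ[k] M.V b :=
  h ▸ LinearEquiv.refl k (M.V a)

theorem castV_nat (M : QRep k I E s t) {a b : I} (h : a = b) (θ : ∀ i, M.V i →ₗ[k] M.V i)
    (v : M.V a) : θ b (M.castV h v) = M.castV h (θ a v) := by
  subst h; rfl

theorem castV_cast (M : QRep k I E s t) {a b : I} (h : a = b) (h' : b = a) (v : M.V a) :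
    M.castV h' (M.castV h v) = v := by
  subst h; rfl

/-- the sum of the incoming maps at `i` -/
noncomputable def inMap [Fintype E] [DecidableEq I] (M : QRep k I E s t) (i : I) :
    (∀ e : {e : E // t e = i}, M.V (s e)) →ₗ[k] M.V i :=
  ∑ e : {e : E // t e = i}, (M.castV e.2).toLinearMap ∘ₗ M.f e ∘ₗ LinearMap.proj e

theorem inMap_apply [Fintype E] [DecidableEq I] (M : QRep k I E s t) (i : I)
    (τ : ∀ e : {e : E // t e = i}, M.V (s e)) :
    M.inMap i τ = ∑ e : {e : E // t e = i}, M.castV e.2 (M.f e (τ e)) := by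
  simp [inMap]

theorem inMap_single [Fintype E] [DecidableEq E] [DecidableEq I] (M : QRep k I E s t) (i : I)
    (e : {e : E // t e = i}) (v : M.V (s e)) :
    M.inMap i (Pi.single e v) = M.castV e.2 (M.f e v) := by
  rw [inMap_apply, Finset.sum_eq_single e]
  · simp
  · intro b _ hb
    rw [Pi.single_eq_of_ne hb]; simp
  · simp

theorem inMap_surj [Fintype E] [DecidableEq I] (M : QRep k I E s t) (i : I)
    (hs : ∀ e, s e ≠ i) (hM : M.Indecomposable)
    (hd : M.dimVec ≠ fun j => if j = i then 1 else 0) :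
    Function.Surjective (M.inMap i) := by
  classical
  by_contra hn
  obtain ⟨w, hw⟩ : ∃ w, w ∉ LinearMap.range (M.inMap i) := by
    by_contra h
    push Not at h
    exact hn h
  obtain ⟨f, hf, hle⟩ := Submodule.exists_le_ker_of_notMem hw
  obtain ⟨p, hp⟩ : ∃ p : ∀ j, M.V j →ₗ[k] M.V j,
    p = Function.update (fun j => (0 : M.V j →ₗ[k] M.V j)) i ((f w)⁻¹ • f.smulRight w) :=
    ⟨_, rfl⟩
  have hpi : ∀ v, p i v = (f w)⁻¹ • f v • w := fun v => by rw [hp]; simp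
  have hpj : ∀ j, j ≠ i → ∀ v, p j v = 0 := fun j hj v => by
    rw [hp, Function.update_of_ne hj]; rfl
  have hhom : IsHom M M p := by
    intro e v
    rw [hpj _ (hs e), map_zero]
    by_cases h : t e = i
    · have h1 := hpi (M.castV h (M.f e v))
      rw [castV_nat] at h1
      have h2 : f (M.castV h (M.f e v)) = 0 := by
        apply hle
        exact ⟨Pi.single ⟨e, h⟩ v, inMap_single M i ⟨e, h⟩ v⟩
      rw [h2, zero_smul, smul_zero] at h1
      exact (M.castV h).map_eq_zero_iff.1 h1
    · exact hpj _ h _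
  have hid : ∀ j v, p j (p j v) = p j v := by
    intro j v
    by_cases h : j = i
    · subst h
      simp only [hpi, smul_smul, map_smul, smul_eq_mul]
      congr 1
      field_simp
    · simp [hpj j h]
  have hw0 : w ≠ 0 := by rintro rfl; simp at hf
  rcases ((indec_iff M).1 hM).2 p hhom hid with h | h
  · have := h i w
    rw [hpi, smul_smul, inv_mul_cancel₀ hf, one_smul] at this
    exact hw0 this
  · apply hd
    funext j
    unfold dimVec
    split_ifs with hj
    · subst hj
      refine finrank_eq_one w hw0 fun v => ⟨(f w)⁻¹ * f v, ?_⟩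
      rw [mul_smul, ← hpi, h]
    · rw [Module.finrank_eq_zero_iff_of_free]
      exact ⟨fun a b => by rw [← h j a, ← h j b, hpj j hj, hpj j hj]⟩

/-- the underlying spaces of the reflected representation -/
noncomputable def reflU [Fintype E] [DecidableEq I] (M : QRep k I E s t) (i j : I) :
    Submodule k (M.V j × (∀ e : {e : E // t e = i}, M.V (s e))) :=
  Submodule.prod (if j = i then ⊥ else ⊤) (if j = i then LinearMap.ker (M.inMap i) else ⊥)

theorem finrank_reflU_ne [Fintype E] [DecidableEq I] (M : QRep k I E s t) (i j : I)
    (h : j ≠ i) : Module.finrank k (M.reflU i j) = Module.finrank k (M.V j) := by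
  unfold reflU
  rw [if_neg h, if_neg h]
  refine LinearEquiv.finrank_eq (LinearEquiv.ofBijective
    (LinearMap.fst k _ _ ∘ₗ Submodule.subtype _) ⟨?_, ?_⟩)
  · rintro ⟨⟨a, b⟩, h1, h2⟩ ⟨⟨c, d⟩, h3, h4⟩ h5
    have h2 : b = 0 := h2
    have h4 : d = 0 := h4
    have h5 : a = c := h5
    subst h2 h4 h5; rfl
  · intro v
    exact ⟨⟨(v, 0), trivial, rfl⟩, rfl⟩

theorem finrank_reflU_self [Fintype E] [DecidableEq I] (M : QRep k I E s t) (i : I) :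
    Module.finrank k (M.reflU i i) = Module.finrank k (LinearMap.ker (M.inMap i)) := by
  unfold reflU
  rw [if_pos rfl, if_pos rfl]
  refine LinearEquiv.finrank_eq (LinearEquiv.ofBijective
    ((LinearMap.snd k _ _ ∘ₗ Submodule.subtype (Submodule.prod ⊥ (LinearMap.ker (M.inMap i)))
      ).codRestrict (LinearMap.ker (M.inMap i)) (fun x => x.2.2)) ⟨?_, ?_⟩)
  · rintro ⟨⟨a, b⟩, h1, h2⟩ ⟨⟨c, d⟩, h3, h4⟩ h5
    have h1 : a = 0 := h1
    have h3 : c = 0 := h3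
    have h6 : b = d := congrArg Subtype.val h5
    subst h1 h3 h6; rfl
  · intro v
    exact ⟨⟨(0, v.1), rfl, v.2⟩, rfl⟩

theorem exists_refl [Fintype E] [DecidableEq I] (M : QRep k I E s t) (i : I)
    (hs : ∀ e, s e ≠ i) (hM : M.Indecomposable) (hsu : Function.Surjective (M.inMap i))
    {s' t' : E → I} (h1 : ∀ e, t e = i → s' e = i ∧ t' e = s e)
    (h2 : ∀ e, t e ≠ i → s' e = s e ∧ t' e = t e) :
    ∃ N : QRep k I E s' t', N.Indecomposable ∧ (∀ j, j ≠ i → N.dimVec j = M.dimVec j) ∧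
      N.dimVec i = Module.finrank k (LinearMap.ker (M.inMap i)) := by
  classical
  have ht' : ∀ e, t' e ≠ i := by
    intro e
    by_cases h : t e = i
    · rw [(h1 e h).2]; exact hs e
    · rw [(h2 e h).2]; exact h
  have hF : ∀ e, ∃ F : (M.V (s' e) × (∀ e : {e : E // t e = i}, M.V (s e))) →ₗ[k] M.V (t' e),
      (∀ h : t e = i, ∀ v, F v = M.castV (h1 e h).2.symm (v.2 ⟨e, h⟩)) ∧
      (∀ h : t e ≠ i, ∀ v, F v =
        M.castV (h2 e h).2.symm (M.f e (M.castV (h2 e h).1 v.1))) := by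
    intro e
    by_cases h : t e = i
    · exact ⟨(M.castV (h1 e h).2.symm).toLinearMap ∘ₗ 
        LinearMap.proj (φ := fun e : {e : E // t e = i} => M.V (s e)) ⟨e, h⟩ ∘ₗ
        LinearMap.snd k _ _, fun h v => rfl, fun h' => absurd h h'⟩
    · exact ⟨(M.castV (h2 e h).2.symm).toLinearMap ∘ₗ M.f e ∘ₗ
        (M.castV (h2 e h).1).toLinearMap ∘ₗ LinearMap.fst k _ _,
        fun h' => absurd h' h, fun h v => rfl⟩
  choose F hF1 hF2 using hF
  have memU : ∀ j, j ≠ i → ∀ v : M.V j, (v, 0) ∈ M.reflU i j := by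
    intro j hj v
    unfold reflU
    rw [if_neg hj, if_neg hj]
    exact ⟨trivial, rfl⟩
  have U2 : ∀ j, j ≠ i → ∀ u ∈ M.reflU i j, u.2 = 0 := by
    intro j hj u hu
    unfold reflU at hu
    rw [if_neg hj, if_neg hj] at hu
    exact hu.2
  have memK : ∀ j, j = i → ∀ τ, M.inMap i τ = 0 → (0, τ) ∈ M.reflU i j := by
    intro j hj v hv
    unfold reflU
    rw [if_pos hj, if_pos hj]
    exact ⟨rfl, hv⟩
  have K2 : ∀ j, j = i → ∀ u ∈ M.reflU i j, u.1 = 0 ∧ M.inMap i u.2 = 0 := by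
    intro j hj u hu
    unfold reflU at hu
    rw [if_pos hj, if_pos hj] at hu
    exact hu
  let N : QRep k I E s' t' :=
    { V := fun j => M.reflU i j
      f := fun e => (LinearMap.inl k _ _ ∘ₗ F e ∘ₗ Submodule.subtype _).codRestrict _
        (fun u => memU _ (ht' e) _) }
  have hNf : ∀ e (u : M.reflU i (s' e)), (N.f e u).1 = (F e u.1, 0) := fun e u => rfl
  refine ⟨N, (indec_iff N).2 ⟨?_, ?_⟩, fun j hj => finrank_reflU_ne M i j hj,
    finrank_reflU_self M i⟩
  · intro hN
    have hMj : ∀ j, j ≠ i → ∀ v : M.V j, v = 0 := by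
      intro j hj v
      have := (hN j).elim ⟨(v, 0), memU j hj v⟩ 0
      exact congrArg Prod.fst (congrArg Subtype.val this)
    apply hM.1
    intro j
    by_cases hj : j = i
    · subst hj
      refine ⟨fun a b => ?_⟩
      obtain ⟨x, rfl⟩ := hsu a
      obtain ⟨y, rfl⟩ := hsu b
      congr 1
      funext e
      rw [hMj _ (hs e) (x e), hMj _ (hs e) (y e)]
    · exact ⟨fun a b => by rw [hMj j hj a, hMj j hj b]⟩
  · intro p hp hpp
    -- the induced maps
    have hb : ∀ j, ∃ b : M.V j →ₗ[k] M.reflU i j, j ≠ i → ∀ v, (b v).1 = (v, 0) := by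
      intro j
      by_cases hj : j = i
      · exact ⟨0, fun h => absurd hj h⟩
      · exact ⟨(LinearMap.inl k _ _).codRestrict _ (memU j hj), fun _ v => rfl⟩
    choose b hb using hb
    let q : ∀ j, M.V j →ₗ[k] M.V j := fun j =>
      LinearMap.fst k _ _ ∘ₗ Submodule.subtype _ ∘ₗ p j ∘ₗ b j
    have hq : ∀ j v, q j v = (p j (b j v)).1.1 := fun j v => rfl
    have hqb : ∀ j, j ≠ i → ∀ u : M.reflU i j, u = b j u.1.1 := by
      intro j hj u
      apply Subtype.ext
      rw [hb j hj]
      exact Prod.ext rfl (U2 j hj _ u.2)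
    have hqu : ∀ j, j ≠ i → ∀ u : M.reflU i j, (p j u).1.1 = q j u.1.1 := by
      intro j hj u
      rw [hq, ← hqb j hj]
    have hqq : ∀ j, j ≠ i → ∀ v, q j (q j v) = q j v := by
      intro j hj v
      rw [hq j v, ← hqu j hj, hpp]
    have hphom : ∀ e (u : M.reflU i (s' e)), q (t' e) (F e u.1) = F e (p (s' e) u).1 := by
      intro e u
      have h3 := congrArg (fun z : M.reflU i (t' e) => z.1.1) (hp e u)
      have h4 := hqu (t' e) (ht' e) (N.f e u)
      exact h4.symm.trans h3
    have hq1 : ∀ e, t e ≠ i → ∀ v, q (t e) (M.f e v) = M.f e (q (s e) v) := by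
      intro e he v
      have hs' : s' e ≠ i := by rw [(h2 e he).1]; exact hs e
      have h3 := hphom e (b _ (M.castV (h2 e he).1.symm v))
      rw [hF2 e he, hF2 e he, hb _ hs', hqu _ hs', hb _ hs'] at h3
      simp only [castV_cast, castV_nat] at h3
      exact (M.castV _).injective h3
    have hker : ∀ j (hj : j = i) (τ : ∀ e : {e : E // t e = i}, M.V (s e))
        (hτ : M.inMap i τ = 0),
        (p j ⟨(0, τ), memK j hj τ hτ⟩).1 = (0, fun e : {e : E // t e = i} => q (s e) (τ e)) := by
      intro j hj τ hτ
      refine Prod.ext (K2 j hj _ (p j _).2).1 ?_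
      funext e
      obtain ⟨e, he⟩ := e
      have hj' : j = s' e := by rw [hj, (h1 e he).1]
      subst hj'
      have h3 := hphom e ⟨(0, τ), memK _ (h1 e he).1 τ hτ⟩
      rw [hF1 e he, hF1 e he, castV_nat] at h3
      exact ((M.castV _).injective h3).symm
    let qT : (∀ e : {e : E // t e = i}, M.V (s e)) →ₗ[k]
      (∀ e : {e : E // t e = i}, M.V (s e)) := LinearMap.pi fun e => q (s e) ∘ₗ LinearMap.proj e
    have hqT : ∀ τ e, qT τ e = q (s e) (τ e) := fun τ e => rfl
    have hqTk : ∀ τ, M.inMap i τ = 0 → M.inMap i (qT τ) = 0 := by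
      intro τ hτ
      have h3 := hker i rfl τ hτ
      have h4 := (K2 i rfl _ (p i ⟨(0, τ), memK i rfl τ hτ⟩).2).2
      rw [h3] at h4
      exact h4
    obtain ⟨g, hg⟩ := LinearMap.exists_rightInverse_of_surjective (M.inMap i)
      (LinearMap.range_eq_top.2 hsu)
    have hg' : ∀ v, M.inMap i (g v) = v := fun v => LinearMap.congr_fun hg v
    let θ : ∀ j, M.V j →ₗ[k] M.V j := Function.update q i (M.inMap i ∘ₗ qT ∘ₗ g)
    have hθi : ∀ v, θ i v = M.inMap i (qT (g v)) := fun v => by simp [θ]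
    have hθj : ∀ j, j ≠ i → θ j = q j := fun j hj => by simp [θ, hj]
    have hθh : ∀ τ, θ i (M.inMap i τ) = M.inMap i (qT τ) := by
      intro τ
      rw [hθi, ← sub_eq_zero, ← map_sub, ← map_sub]
      apply hqTk
      rw [map_sub, hg', sub_self]
    have hθhom : IsHom M M θ := by
      intro e v
      rw [hθj _ (hs e)]
      by_cases he : t e = i
      · have h3 := hθh (Pi.single ⟨e, he⟩ v)
        have h4 : qT (Pi.single ⟨e, he⟩ v) = Pi.single ⟨e, he⟩ (q (s e) v) := by
          funext e'
          rw [hqT]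
          by_cases hee : e' = ⟨e, he⟩
          · subst hee; simp
          · rw [Pi.single_eq_of_ne hee, Pi.single_eq_of_ne hee, map_zero]
        rw [h4, inMap_single, inMap_single, castV_nat] at h3
        exact (M.castV _).injective h3
      · rw [hθj _ he, hq1 e he]
    have hθθ : ∀ j v, θ j (θ j v) = θ j v := by
      intro j v
      by_cases hj : j = i
      · subst hj
        obtain ⟨τ, rfl⟩ := hsu v
        rw [hθh, hθh]
        congr 1
        funext e
        simp only [hqT]
        exact hqq _ (hs e) _
      · rw [hθj j hj, hqq j hj]
    rcases ((indec_iff M).1 hM).2 θ hθhom hθθ with h | h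
    · left
      intro j u
      apply Subtype.ext
      by_cases hj : j = i
      · have hu : u = ⟨(0, u.1.2), memK j hj _ (K2 j hj _ u.2).2⟩ :=
          Subtype.ext (Prod.ext (K2 j hj _ u.2).1 rfl)
        rw [hu, hker j hj _ (K2 j hj _ u.2).2]
        refine Prod.ext rfl (funext fun e => ?_)
        have := h (s e) (u.1.2 e)
        rw [hθj _ (hs e)] at this
        exact this
      · refine Prod.ext ?_ (U2 j hj _ (p j u).2)
        rw [hqu j hj, ← hθj j hj]
        exact h j _
    · right
      intro j u
      apply Subtype.ext
      by_cases hj : j = i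
      · have hu : u = ⟨(0, u.1.2), memK j hj _ (K2 j hj _ u.2).2⟩ :=
          Subtype.ext (Prod.ext (K2 j hj _ u.2).1 rfl)
        rw [hu, hker j hj _ (K2 j hj _ u.2).2]
        refine Prod.ext rfl (funext fun e => ?_)
        have := h (s e) (u.1.2 e)
        rw [hθj _ (hs e)] at this
        exact this
      · refine Prod.ext ?_ ((U2 j hj _ (p j u).2).trans (U2 j hj _ u.2).symm)
        rw [hqu j hj, ← hθj j hj]
        exact h j _

end QRep

theorem cartan_sum {I E : Type} [Fintype I] [Fintype E] [DecidableEq I] (s t : E → I) (i : I)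
    (x : I → ℤ) : ∑ l, cartanMatrix s t i l * x l = 2 * x i -
      ∑ e, ((if s e = i then x (t e) else 0) + (if t e = i then x (s e) else 0)) := by
  classical
  have key : ∀ f g : E → I, ∑ l, (Nat.card {e : E // f e = i ∧ g e = l} : ℤ) * x l =
      ∑ e, (if f e = i then x (g e) else 0) := by
    intro f g
    have : ∀ l, (Nat.card {e : E // f e = i ∧ g e = l} : ℤ) * x l =
        ∑ e, if f e = i then (if g e = l then x l else 0) else 0 := by
      intro l
      rw [Nat.card_eq_fintype_card, Fintype.card_subtype, Finset.card_filter, Nat.cast_sum,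
        Finset.sum_mul]
      refine Finset.sum_congr rfl fun e _ => ?_
      by_cases h1 : f e = i <;> by_cases h2 : g e = l <;> simp [h1, h2]
    simp only [this]
    rw [Finset.sum_comm]
    refine Finset.sum_congr rfl fun e _ => ?_
    by_cases h1 : f e = i <;> simp [h1]
  have e2 : ∀ l, (Nat.card {e : E // s e = l ∧ t e = i} : ℤ) =
      (Nat.card {e : E // t e = i ∧ s e = l} : ℤ) := by
    intro l
    simp only [and_comm]
  unfold cartanMatrix
  simp only [e2, sub_mul, add_mul, Finset.sum_sub_distrib, Finset.sum_add_distrib, key]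
  simp

theorem simpleRefl_apply {I E : Type} [Fintype I] [Fintype E] [DecidableEq I] (s t : E → I) (i : I)
    (x : I → ℤ) : simpleRefl (cartanMatrix s t) i x i = - x i +
      ∑ e, ((if s e = i then x (t e) else 0) + (if t e = i then x (s e) else 0)) := by
  unfold simpleRefl
  rw [cartan_sum]
  simp; ring

theorem simpleRefl_ne {I : Type} [Fintype I] [DecidableEq I] (C : I → I → ℤ) {i j : I}
    (x : I → ℤ) (h : j ≠ i) : simpleRefl C i x j = x j := by
  unfold simpleRefl
  simp [h]

namespace QRep

variable {k : Type} [Field k] {I E : Type} {s t : E → I}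

theorem refl_ind [Fintype I] [Fintype E] [DecidableEq I] {p : ℕ} [Fact p.Prime]
    [Algebra (ZMod p) k] [Algebra.IsAlgebraic (ZMod p) k] [IsAlgClosed k] (i : I)
    (hl : ∀ e, ¬ (s e = i ∧ t e = i)) {α : I → ℕ} (h : HasInd k s t α)
    (hα : α ≠ fun j => if j = i then 1 else 0) :
    ∃ α' : I → ℕ, HasInd k s t α' ∧
      (fun j => (α' j : ℤ)) = simpleRefl (cartanMatrix s t) i (fun j => (α j : ℤ)) := by
  classical
  obtain ⟨s0, hs0⟩ : ∃ s0 : E → I, s0 = fun e => if s e = i then t e else s e := ⟨_, rfl⟩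
  obtain ⟨t0, ht0⟩ : ∃ t0 : E → I, t0 = fun e => if s e = i then i else t e := ⟨_, rfl⟩
  have hr : Reor s t s0 t0 := by
    intro e
    rw [hs0, ht0]
    by_cases h1 : s e = i <;> simp [h1]
  obtain ⟨M, hM, hMd⟩ := orient (p := p) hr h
  have hs : ∀ e, s0 e ≠ i := by
    intro e
    rw [hs0]
    by_cases h1 : s e = i
    · simpa [h1] using fun h2 => hl e ⟨h1, h2⟩
    · simpa [h1] using h1
  have hsu := inMap_surj M i hs hM (by rwa [hMd])
  obtain ⟨s', hs'⟩ : ∃ s' : E → I, s' = fun e => if t0 e = i then i else s0 e := ⟨_, rfl⟩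
  obtain ⟨t', ht'⟩ : ∃ t' : E → I, t' = fun e => if t0 e = i then s0 e else t0 e := ⟨_, rfl⟩
  obtain ⟨N, hN, hN1, hN2⟩ := exists_refl M i hs hM hsu (s' := s') (t' := t')
    (fun e he => by rw [hs', ht']; simp [he]) (fun e he => by rw [hs', ht']; simp [he])
  have hr' : Reor s' t' s t := by
    intro e
    rw [hs', ht']
    by_cases h2 : t0 e = i
    · simp only [h2, if_true]
      rcases hr e with ⟨h3, h4⟩ | ⟨h3, h4⟩
      · right; exact ⟨h3.symm, h4.symm.trans h2⟩
      · left; exact ⟨h4.symm.trans h2, h3.symm⟩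
    · simp only [h2, if_false]
      rcases hr e with ⟨h3, h4⟩ | ⟨h3, h4⟩
      · left; exact ⟨h3.symm, h4.symm⟩
      · right; exact ⟨h4.symm, h3.symm⟩
  refine ⟨N.dimVec, orient (p := p) hr' ⟨N, hN, rfl⟩, ?_⟩
  funext j
  by_cases hj : j = i
  · subst hj
    have h1 := LinearMap.finrank_range_add_finrank_ker (M.inMap j)
    rw [LinearMap.range_eq_top.2 hsu, finrank_top, Module.finrank_pi_fintype, ← hN2] at h1
    have h2 : ∀ l, Module.finrank k (M.V l) = α l := fun l => congrFun hMd l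
    simp only [h2] at h1
    rw [simpleRefl_apply]
    have h3 : (∑ e : {e : E // t0 e = j}, α (s0 e)) = ∑ e, if t0 e = j then α (s0 e) else 0 := by
      rw [← Finset.sum_filter, Finset.sum_subtype (Finset.univ.filter fun e => t0 e = j)]
      simp
    rw [h3] at h1
    have h4 : ((α j : ℤ) + N.dimVec j) = ∑ e, if t0 e = j then (α (s0 e) : ℤ) else 0 := by
      exact_mod_cast h1
    have h5 : (∑ e, if t0 e = j then (α (s0 e) : ℤ) else 0) =
      ∑ e, ((if s e = j then (α (t e) : ℤ) else 0) + (if t e = j then (α (s e) : ℤ) else 0)) := by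
      refine Finset.sum_congr rfl fun e _ => ?_
      rw [hs0, ht0]
      have := hl e
      by_cases h1 : s e = j
      · have h2 : t e ≠ j := fun h => this ⟨h1, h⟩
        simp [h1, h2]
      · simp [h1]
    rw [h5] at h4
    linarith
  · rw [simpleRefl_ne _ _ hj, hN1 j hj, hMd]

end QRep

theorem finrank_le_of_exact {k V W U : Type*} [Field k] [AddCommGroup V] [Module k V]
    [AddCommGroup W] [Module k W] [AddCommGroup U] [Module k U] [FiniteDimensional k V]
    [FiniteDimensional k W] [FiniteDimensional k U] (P : V →ₗ[k] W) (Q : U →ₗ[k] V)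
    (S : Submodule k V) (R : Submodule k W) (T : Submodule k U) (h1 : ∀ v ∈ S, P v ∈ R)
    (h2 : ∀ v ∈ S, P v = 0 → ∃ u ∈ T, Q u = v) :
    Module.finrank k S ≤ Module.finrank k T + Module.finrank k R ∧
    ((∃ r ∈ R, ∀ v ∈ S, P v ≠ r) →
      Module.finrank k S < Module.finrank k T + Module.finrank k R) := by
  have e := LinearMap.finrank_range_add_finrank_ker (P.domRestrict S)
  have hr : LinearMap.range (P.domRestrict S) ≤ R := by
    rintro _ ⟨v, rfl⟩
    exact h1 v v.2
  have hk : (LinearMap.ker (P.domRestrict S)).map S.subtype ≤ T.map Q := by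
    rintro _ ⟨v, hv, rfl⟩
    exact h2 v v.2 hv
  have e1 := Submodule.finrank_mono hk
  rw [(Submodule.equivMapOfInjective S.subtype S.subtype_injective _).finrank_eq.symm] at e1
  have e2 := Submodule.finrank_map_le Q T
  refine ⟨?_, ?_⟩
  · have := Submodule.finrank_mono hr
    omega
  · rintro ⟨r, hr1, hr2⟩
    have : LinearMap.range (P.domRestrict S) < R := by
      refine lt_of_le_of_ne hr fun h => ?_
      rw [← h] at hr1
      obtain ⟨v, hv⟩ := hr1
      exact hr2 v v.2 hv
    have := Submodule.finrank_lt_finrank_of_lt this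
    omega

/-- The Euler form. -/
def eul {I E : Type} [Fintype I] [Fintype E] (s t : E → I) (x y : I → ℤ) : ℤ :=
  ∑ i, x i * y i - ∑ e, x (s e) * y (t e)

namespace QRep

variable {k : Type} [Field k] {I E : Type} {s t : E → I}

noncomputable def dz (M : QRep k I E s t) : I → ℤ := fun i => (M.dimVec i : ℤ)

theorem euler [Fintype I] [Fintype E] (A B : QRep k I E s t) :
    eul s t A.dz B.dz + Module.finrank k (∀ e, A.V (s e) →ₗ[k] B.V (t e)) =
      Module.finrank k (homs A B) + Module.finrank k (LinearMap.range (dmap A B)) := by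
  have h := LinearMap.finrank_range_add_finrank_ker (dmap A B)
  have h1 : Module.finrank k (∀ i, A.V i →ₗ[k] B.V i) = ∑ i, A.dimVec i * B.dimVec i := by
    rw [Module.finrank_pi_fintype]
    simp only [Module.finrank_linearMap]
    rfl
  have h2 : Module.finrank k (∀ e, A.V (s e) →ₗ[k] B.V (t e)) =
      ∑ e, A.dimVec (s e) * B.dimVec (t e) := by
    rw [Module.finrank_pi_fintype]
    simp only [Module.finrank_linearMap]
    rfl
  rw [h1] at h
  rw [h2]
  unfold eul dz homs
  push_cast
  have h' : ((∑ i, A.dimVec i * B.dimVec i : ℕ) : ℤ) = ∑ i, (A.dimVec i : ℤ) * B.dimVec i := by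
    push_cast; rfl
  rw [← h', ← h]
  push_cast
  ring

theorem euler_surj [Fintype I] [Fintype E] {A B : QRep k I E s t}
    (h : Function.Surjective (dmap A B)) :
    eul s t A.dz B.dz = Module.finrank k (homs A B) := by
  have := euler A B
  rw [LinearMap.range_eq_top.2 h, finrank_top] at this
  linarith

theorem euler_not_surj [Fintype I] [Fintype E] {A B : QRep k I E s t}
    (h : ¬ Function.Surjective (dmap A B)) :
    eul s t A.dz B.dz < Module.finrank k (homs A B) := by
  have := euler A B
  have h2 : Module.finrank k (LinearMap.range (dmap A B)) <
      Module.finrank k (∀ e, A.V (s e) →ₗ[k] B.V (t e)) :=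
    Submodule.finrank_lt (fun h' => h (LinearMap.range_eq_top.1 h'))
  have h3 : (Module.finrank k (LinearMap.range (dmap A B)) : ℤ) <
      Module.finrank k (∀ e, A.V (s e) →ₗ[k] B.V (t e)) := by exact_mod_cast h2
  linarith

/-- The extension of `A` by `B` given by a cocycle. -/
def extRep (A B : QRep k I E s t) (ξ : ∀ e, A.V (s e) →ₗ[k] B.V (t e)) : QRep k I E s t where
  V i := B.V i × A.V i
  f e := (B.f e ∘ₗ LinearMap.fst k _ _ + ξ e ∘ₗ LinearMap.snd k _ _).prod
    (A.f e ∘ₗ LinearMap.snd k _ _)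

def preL {A B : QRep k I E s t} (j : ∀ i, A.V i →ₗ[k] B.V i) (X : QRep k I E s t) :
    (∀ i, B.V i →ₗ[k] X.V i) →ₗ[k] (∀ i, A.V i →ₗ[k] X.V i) where
  toFun φ i := φ i ∘ₗ j i
  map_add' φ ψ := by funext i; ext v; simp
  map_smul' c φ := by funext i; ext v; simp

def postL {A B : QRep k I E s t} (X : QRep k I E s t) (j : ∀ i, A.V i →ₗ[k] B.V i) :
    (∀ i, X.V i →ₗ[k] A.V i) →ₗ[k] (∀ i, X.V i →ₗ[k] B.V i) where
  toFun φ i := j i ∘ₗ φ i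
  map_add' φ ψ := by funext i; ext v; simp
  map_smul' c φ := by funext i; ext v; simp

section ext
variable (A B : QRep k I E s t) (ξ : ∀ e, A.V (s e) →ₗ[k] B.V (t e))

def eInl (i : I) : B.V i →ₗ[k] (extRep A B ξ).V i := LinearMap.inl k _ _
def eSnd (i : I) : (extRep A B ξ).V i →ₗ[k] A.V i := LinearMap.snd k _ _

theorem eInl_hom : IsHom B (extRep A B ξ) (eInl A B ξ) := by
  intro e v
  refine Prod.ext ?_ ?_
  · change B.f e v = B.f e v + ξ e 0
    simp
  · change (0 : A.V (t e)) = A.f e 0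
    simp

theorem eSnd_hom : IsHom (extRep A B ξ) A (eSnd A B ξ) := fun _ _ => rfl

theorem dimVec_extRep (i : I) : (extRep A B ξ).dimVec i = A.dimVec i + B.dimVec i := by
  rw [add_comm]
  exact Module.finrank_prod

variable [Fintype I]

theorem hom_ext_pre (X : QRep k I E s t) :
    Module.finrank k (homs (extRep A B ξ) X) ≤
      Module.finrank k (homs A X) + Module.finrank k (homs B X) ∧
    ((∃ r ∈ homs B X, ∀ v ∈ homs (extRep A B ξ) X, preL (eInl A B ξ) X v ≠ r) →
      Module.finrank k (homs (extRep A B ξ) X) <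
        Module.finrank k (homs A X) + Module.finrank k (homs B X)) := by
  refine finrank_le_of_exact (preL (eInl A B ξ) X) (preL (eSnd A B ξ) X) _ _ _ ?_ ?_
  · intro v hv
    exact mem_homs.2 ((mem_homs.1 hv).comp (eInl_hom A B ξ))
  · intro φ hφ h0
    have h0' : ∀ i (b : B.V i), φ i (b, (0 : A.V i)) = 0 := fun i b =>
      LinearMap.congr_fun (congrFun h0 i) b
    have hs : ∀ i (b : B.V i) (a : A.V i), φ i (b, a) = φ i ((0 : B.V i), a) := by
      intro i b a
      have : ((b, a) : B.V i × A.V i) = (b, 0) + (0, a) := by simp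
      calc φ i (b, a) = φ i ((b, (0 : A.V i)) + ((0 : B.V i), a) : B.V i × A.V i) := by rw [← this]
        _ = φ i (b, (0 : A.V i)) + φ i ((0 : B.V i), a) := (φ i).map_add _ _
        _ = _ := by rw [h0', zero_add]
    refine ⟨fun i => φ i ∘ₗ LinearMap.inr k (B.V i) (A.V i), mem_homs.2 ?_, ?_⟩
    · intro e a
      have h3 := mem_homs.1 hφ e ((0 : B.V (s e)), a)
      refine Eq.trans ?_ h3
      exact (hs _ _ _).symm
    · funext i
      refine LinearMap.ext fun v => ?_
      exact (hs i v.1 v.2).symm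

theorem hom_ext_post (X : QRep k I E s t) :
    Module.finrank k (homs X (extRep A B ξ)) ≤
      Module.finrank k (homs X B) + Module.finrank k (homs X A) := by
  refine (finrank_le_of_exact (postL X (eSnd A B ξ)) (postL X (eInl A B ξ)) _ _ _ ?_ ?_).1
  · intro v hv
    exact mem_homs.2 ((eSnd_hom A B ξ).comp (mem_homs.1 hv))
  · intro φ hφ h0
    have h0' : ∀ i v, (φ i v).2 = 0 := fun i v =>
      LinearMap.congr_fun (congrFun h0 i) v
    refine ⟨fun i => LinearMap.fst k (B.V i) (A.V i) ∘ₗ φ i, mem_homs.2 ?_, ?_⟩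
    · intro e a
      have h3 := congrArg Prod.fst (mem_homs.1 hφ e a)
      refine Eq.trans h3 ?_
      have h4 : ξ e (φ (s e) a).2 = 0 := by rw [h0', map_zero]
      exact (congrArg (fun z => B.f e (φ (s e) a).1 + z) h4).trans (add_zero _)
    · funext i
      refine LinearMap.ext fun v => ?_
      exact Prod.ext rfl (h0' i v).symm

theorem hom_ext_lt (hξ : ξ ∉ LinearMap.range (dmap A B)) :
    Module.finrank k (homs (extRep A B ξ) (extRep A B ξ)) <
      Module.finrank k (homs A A) + Module.finrank k (homs A B) +
      Module.finrank k (homs B A) + Module.finrank k (homs B B) := by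
  have h1 := hom_ext_post A B ξ (extRep A B ξ)
  have h2 := (hom_ext_pre A B ξ A).1
  have h3 := (hom_ext_pre A B ξ B).2 (by
    refine ⟨fun _ => LinearMap.id, mem_homs.2 (isHom_id B), fun φ hφ h => hξ ?_⟩
    have h0' : ∀ i (b : B.V i), φ i (b, (0 : A.V i)) = b := fun i b =>
      LinearMap.congr_fun (congrFun h i) b
    have hs : ∀ i (b : B.V i) (a : A.V i), φ i (b, a) = b + φ i ((0 : B.V i), a) := by
      intro i b a
      have : ((b, a) : B.V i × A.V i) = (b, 0) + (0, a) := by simp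
      calc φ i (b, a) = φ i ((b, (0 : A.V i)) + ((0 : B.V i), a) : B.V i × A.V i) := by rw [← this]
        _ = φ i (b, (0 : A.V i)) + φ i ((0 : B.V i), a) := (φ i).map_add _ _
        _ = _ := by rw [h0']
    refine ⟨fun i => -(φ i ∘ₗ LinearMap.inr k (B.V i) (A.V i)), ?_⟩
    funext e
    refine LinearMap.ext fun a => ?_
    have h3 := mem_homs.1 hφ e ((0 : B.V (s e)), a)
    have h4 : φ (t e) (B.f e 0 + ξ e a, A.f e a) = B.f e (φ (s e) ((0 : B.V (s e)), a)) := h3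
    rw [hs, map_zero, zero_add] at h4
    change -φ (t e) ((0 : B.V (t e)), A.f e a) - B.f e (-φ (s e) ((0 : B.V (s e)), a)) = ξ e a
    rw [map_neg, ← h4]
    abel)
  omega

end ext

theorem hom_bip_ge [Fintype I] {M A B : QRep k I E s t} (h : Bip M A B) :
    Module.finrank k (homs A A) + Module.finrank k (homs A B) +
      Module.finrank k (homs B A) + Module.finrank k (homs B B) ≤
      Module.finrank k (homs M M) := by
  let F : (homs A A × homs A B) × (homs B A × homs B B) →ₗ[k] (∀ i, M.V i →ₗ[k] M.V i) :=
    LinearMap.coprod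
      (LinearMap.coprod (preL h.pa M ∘ₗ postL A h.ia ∘ₗ (homs A A).subtype)
        (preL h.pa M ∘ₗ postL A h.ib ∘ₗ (homs A B).subtype))
      (LinearMap.coprod (preL h.pb M ∘ₗ postL B h.ia ∘ₗ (homs B A).subtype)
        (preL h.pb M ∘ₗ postL B h.ib ∘ₗ (homs B B).subtype))
  have hF : ∀ x i v, F x i v = h.ia i (x.1.1.1 i (h.pa i v)) + h.ib i (x.1.2.1 i (h.pa i v)) +
      (h.ia i (x.2.1.1 i (h.pb i v)) + h.ib i (x.2.2.1 i (h.pb i v))) := fun x i v => rfl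
  have hm : ∀ x, F x ∈ homs M M := by
    intro x
    refine Submodule.add_mem _ (Submodule.add_mem _ ?_ ?_) (Submodule.add_mem _ ?_ ?_)
    · exact mem_homs.2 ((h.hia.comp (mem_homs.1 x.1.1.2)).comp h.hpa)
    · exact mem_homs.2 ((h.hib.comp (mem_homs.1 x.1.2.2)).comp h.hpa)
    · exact mem_homs.2 ((h.hia.comp (mem_homs.1 x.2.1.2)).comp h.hpb)
    · exact mem_homs.2 ((h.hib.comp (mem_homs.1 x.2.2.2)).comp h.hpb)
  have hinj : Function.Injective (F.codRestrict _ hm) := by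
    rw [injective_iff_map_eq_zero]
    intro x hx
    have hx0 : ∀ i v, F x i v = 0 := fun i v =>
      LinearMap.congr_fun (congrFun (congrArg Subtype.val hx) i) v
    have z1 : ∀ i v, x.1.1.1 i v = 0 := fun i v => by
      have := congrArg (h.pa i) (hx0 i (h.ia i v))
      simpa [hF, h.paia, h.pbia, h.paib, h.pbib] using this
    have z2 : ∀ i v, x.1.2.1 i v = 0 := fun i v => by
      have := congrArg (h.pb i) (hx0 i (h.ia i v))
      simpa [hF, h.paia, h.pbia, h.paib, h.pbib] using this
    have z3 : ∀ i v, x.2.1.1 i v = 0 := fun i v => by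
      have := congrArg (h.pa i) (hx0 i (h.ib i v))
      simpa [hF, h.paia, h.pbia, h.paib, h.pbib] using this
    have z4 : ∀ i v, x.2.2.1 i v = 0 := fun i v => by
      have := congrArg (h.pb i) (hx0 i (h.ib i v))
      simpa [hF, h.paia, h.pbia, h.paib, h.pbib] using this
    refine Prod.ext (Prod.ext ?_ ?_) (Prod.ext ?_ ?_)
    · exact Subtype.ext (funext fun i => LinearMap.ext (z1 i))
    · exact Subtype.ext (funext fun i => LinearMap.ext (z2 i))
    · exact Subtype.ext (funext fun i => LinearMap.ext (z3 i))
    · exact Subtype.ext (funext fun i => LinearMap.ext (z4 i))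
  have := LinearMap.finrank_le_finrank_of_injective hinj
  rw [Module.finrank_prod, Module.finrank_prod, Module.finrank_prod] at this
  omega

/-- Generic representations are indecomposable if all decompositions have negative pairing. -/
theorem hasInd_of_neg [Fintype I] [Fintype E] {β : I → ℕ} (h0 : β ≠ 0)
    (h : ∀ x y : I → ℕ, x ≠ 0 → y ≠ 0 → β = x + y →
      eul s t (fun i => (x i : ℤ)) (fun i => (y i : ℤ)) +
        eul s t (fun i => (y i : ℤ)) (fun i => (x i : ℤ)) < 0) : HasInd k s t β := by
  classical
  have hex : ∃ n, ∃ M : QRep k I E s t, M.dimVec = β ∧ Module.finrank k (homs M M) = n :=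
    ⟨_, ofMat β (fun _ => 0), dimVec_ofMat β _, rfl⟩
  obtain ⟨M, hM, hMn⟩ := Nat.find_spec hex
  refine ⟨M, ⟨fun ht => h0 ?_, fun A B hA hB hAB => ?_⟩, hM⟩
  · rw [← hM]; exact (isTrivial_iff M).1 ht
  obtain ⟨b⟩ := hAB.bip
  have key : ∀ {A B : QRep k I E s t} (b : Bip M A B), Function.Surjective (dmap A B) := by
    intro A B b
    by_contra hn
    obtain ⟨ξ, hξ⟩ : ∃ ξ, ξ ∉ LinearMap.range (dmap A B) := by
      by_contra h
      push Not at h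
      exact hn h
    have h1 := hom_ext_lt A B ξ hξ
    have h2 := hom_bip_ge b
    refine Nat.find_min hex (m := Module.finrank k (homs (extRep A B ξ) (extRep A B ξ)))
      (by omega) ⟨_, ?_, rfl⟩
    funext i
    rw [dimVec_extRep, ← hM, bip_dimVec b]
    rfl
  have h1 := euler_surj (key b)
  have h2 := euler_surj (key b.swap)
  have h3 := h A.dimVec B.dimVec (fun h => hA ((isTrivial_iff A).2 h))
    (fun h => hB ((isTrivial_iff B).2 h)) (by rw [← hM, bip_dimVec b])
  change eul s t A.dz B.dz + eul s t B.dz A.dz < 0 at h3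
  omega

end QRep

theorem exists_factor {k V W U : Type*} [Field k] [AddCommGroup V] [Module k V]
    [AddCommGroup W] [Module k W] [AddCommGroup U] [Module k U] (f : V →ₗ[k] W) (g : V →ₗ[k] U)
    (h : ∀ v, g v = 0 → f v = 0) : ∃ l : U →ₗ[k] W, ∀ v, f v = l (g v) := by
  obtain ⟨σ, hσ⟩ := LinearMap.exists_rightInverse_of_surjective g.rangeRestrict
    (LinearMap.range_rangeRestrict g)
  obtain ⟨l, hl⟩ := LinearMap.exists_extend (f ∘ₗ σ)
  refine ⟨l, fun v => ?_⟩
  have h1 : l (g v) = f (σ ⟨g v, v, rfl⟩) := LinearMap.congr_fun hl ⟨g v, v, rfl⟩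
  have h2 : g (σ ⟨g v, v, rfl⟩) = g v :=
    congrArg Subtype.val (LinearMap.congr_fun hσ ⟨g v, v, rfl⟩)
  rw [h1, ← sub_eq_zero, ← map_sub]
  apply h
  rw [map_sub, h2, sub_self]

namespace QRep

variable {k : Type} [Field k] {I E : Type} {s t : E → I}

theorem exists_sq_zero [Fintype I] [IsAlgClosed k] {X : QRep k I E s t} (hX : X.Indecomposable)
    {φ : ∀ i, X.V i →ₗ[k] X.V i} (hφ : IsHom X X φ) (hn : ¬ ∃ c : k, ∀ i v, φ i v = c • v) :
    ∃ θ, IsHom X X θ ∧ (∀ i v, θ i (θ i v) = 0) ∧ ∃ i v, θ i v ≠ 0 := by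
  have hnt : Nontrivial X.endAlg := ((indec_iff_endAlg X).1 hX).1
  obtain ⟨c, hc⟩ := spectrum.nonempty_of_isAlgClosed_of_finiteDimensional k (hφ.toEnd)
  rw [spectrum.mem_iff] at hc
  have hnil := (hX.unit_or_nilp _).resolve_left hc
  obtain ⟨a, ha⟩ : ∃ a, a = algebraMap k X.endAlg c - hφ.toEnd := ⟨_, rfl⟩
  rw [← ha] at hnil
  have ha0 : a ≠ 0 := by
    intro h0
    apply hn
    refine ⟨c, fun i v => ?_⟩
    rw [ha, sub_eq_zero] at h0
    exact (LinearMap.congr_fun (congrFun (congrArg Subtype.val h0) i) v).symm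
  classical
  have hex : ∃ n, a ^ n = 0 := hnil
  have h1 := Nat.find_spec hex
  have h2 : Nat.find hex ≠ 0 := by
    intro h; rw [h, pow_zero] at h1; exact one_ne_zero h1
  have h3 : Nat.find hex ≠ 1 := by
    intro h; rw [h, pow_one] at h1; exact ha0 h1
  obtain ⟨b, hb⟩ : ∃ b, b = a ^ (Nat.find hex - 1) := ⟨_, rfl⟩
  have hb0 : b ≠ 0 := by rw [hb]; exact Nat.find_min hex (by omega)
  have hbb : b * b = 0 := by
    rw [hb, ← pow_add]
    exact pow_eq_zero_of_le (by omega) h1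
  refine ⟨b.1, b.2, fun i v => LinearMap.congr_fun (congrFun (congrArg Subtype.val hbb) i) v, ?_⟩
  by_contra h
  push Not at h
  exact hb0 (Subtype.ext (funext fun i => LinearMap.ext (h i)))

theorem exists_summand {K X : QRep k I E s t} [Fintype I] {η : ∀ i, X.V i →ₗ[k] K.V i}
    (hη : ∃ i v, η i v ≠ 0) :
    ∃ (L : QRep k I E s t) (ia : ∀ i, L.V i →ₗ[k] K.V i) (pa : ∀ i, K.V i →ₗ[k] L.V i),
      IsHom L K ia ∧ IsHom K L pa ∧ (∀ i v, pa i (ia i v) = v) ∧ L.Indecomposable ∧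
      ∃ i v, pa i (η i v) ≠ 0 := by
  classical
  have hex : ∃ n, ∃ (L : QRep k I E s t) (ia : ∀ i, L.V i →ₗ[k] K.V i)
      (pa : ∀ i, K.V i →ₗ[k] L.V i), IsHom L K ia ∧ IsHom K L pa ∧ (∀ i v, pa i (ia i v) = v) ∧
      (∃ i v, pa i (η i v) ≠ 0) ∧ ∑ i, L.dimVec i = n :=
    ⟨_, K, fun _ => LinearMap.id, fun _ => LinearMap.id, isHom_id K, isHom_id K,
      fun _ _ => rfl, hη, rfl⟩
  obtain ⟨L, ia, pa, hia, hpa, hpi, ⟨i, v, hiv⟩, hn⟩ := Nat.find_spec hex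
  refine ⟨L, ia, pa, hia, hpa, hpi, ⟨?_, ?_⟩, i, v, hiv⟩
  · intro h
    exact hiv ((h i).elim _ _)
  · intro A B hA hB hAB
    obtain ⟨c⟩ := hAB.bip
    have key : ∀ {A B : QRep k I E s t} (c : Bip L A B), ¬ B.IsTrivial →
        c.pa i (pa i (η i v)) = 0 := by
      intro A B c hB
      by_contra hne
      have hd := bip_dimVec c
      have h1 : ∑ i, L.dimVec i = ∑ i, A.dimVec i + ∑ i, B.dimVec i := by
        rw [hd, ← Finset.sum_add_distrib]; rfl
      have h2 : 0 < ∑ i, B.dimVec i := by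
        rw [Nat.pos_iff_ne_zero]
        intro h
        rw [Finset.sum_eq_zero_iff] at h
        exact hB ((isTrivial_iff B).2 (funext fun i => h i (Finset.mem_univ i)))
      exact Nat.find_min hex (m := ∑ i, A.dimVec i) (by omega)
        ⟨A, _, _, hia.comp c.hia, c.hpa.comp hpa, fun i v => by simp [hpi, c.paia],
          ⟨i, v, hne⟩, rfl⟩
    have h1 := key c hB
    have h2 := key c.swap hA
    have h3 := c.tot i (pa i (η i v))
    have h4 : c.pb i (pa i (η i v)) = 0 := h2
    rw [h1, h4, map_zero, map_zero, add_zero] at h3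
    exact hiv h3.symm

theorem exists_self_ext [Fintype I] {X : QRep k I E s t} (hX : X.Indecomposable)
    (hex0 : ∃ θ, IsHom X X θ ∧ (∀ i v, θ i (θ i v) = 0) ∧ ∃ i v, θ i v ≠ 0) :
    ∃ L : QRep k I E s t, L.Indecomposable ∧ L.dimVec ≤ X.dimVec ∧ L.dimVec ≠ X.dimVec ∧
      ¬ Function.Surjective (dmap L L) := by
  classical
  have hex : ∃ n, ∃ θ, IsHom X X θ ∧ (∀ i v, θ i (θ i v) = 0) ∧ (∃ i v, θ i v ≠ 0) ∧
      ∑ i, Module.finrank k (LinearMap.range (θ i)) = n := by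
    obtain ⟨θ, h1, h2, h3⟩ := hex0
    exact ⟨_, θ, h1, h2, h3, rfl⟩
  obtain ⟨θ, hθ, hθθ, hθ0, hrk⟩ := Nat.find_spec hex
  have hU : ∀ e, ∀ v ∈ LinearMap.ker (θ (s e)), X.f e v ∈ LinearMap.ker (θ (t e)) := by
    intro e v hv
    rw [LinearMap.mem_ker] at hv ⊢
    rw [hθ, hv, map_zero]
  obtain ⟨K, hK⟩ : ∃ K, K = X.subrep (fun i => LinearMap.ker (θ i)) hU := ⟨_, rfl⟩
  obtain ⟨inc, hinc, hinj, hinc0, η, hη, hincη, hKer⟩ : ∃ inc : ∀ i, K.V i →ₗ[k] X.V i,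
      IsHom K X inc ∧ (∀ i, Function.Injective (inc i)) ∧ (∀ i v, θ i (inc i v) = 0) ∧
      ∃ η : ∀ i, X.V i →ₗ[k] K.V i, IsHom X K η ∧ (∀ i v, inc i (η i v) = θ i v) ∧
      (∀ i v, θ i v = 0 → ∃ w, inc i w = v) := by
    subst hK
    exact ⟨subInc X _ hU, isHom_subInc X _ hU, subInc_inj X _ hU, fun i v => v.2,
      subLift X _ hU θ hθθ, isHom_subLift X _ hU θ hθθ hθ, fun i v => rfl,
      fun i v hv => ⟨⟨v, hv⟩, rfl⟩⟩
  have hηinc : ∀ i v, η i (inc i v) = 0 := fun i v => hinj i (by rw [hincη, hinc0, map_zero])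
  obtain ⟨L, ia, pa, hia, hpa, hpi, hL, i0, v0, hiv⟩ := exists_summand (η := η) (by
    obtain ⟨i, v, h⟩ := hθ0
    exact ⟨i, v, fun h' => h (by rw [← hincη, h', map_zero])⟩)
  have hiai : ∀ i, Function.Injective (ia i) := fun i a b h => by rw [← hpi i a, h, hpi]
  -- kernel of `pa ∘ η`
  have hker : ∀ i v, pa i (η i v) = 0 → θ i v = 0 := by
    obtain ⟨θ', hθ'⟩ : ∃ θ' : ∀ i, X.V i →ₗ[k] X.V i,
      θ' = fun i => inc i ∘ₗ ia i ∘ₗ pa i ∘ₗ η i := ⟨_, rfl⟩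
    have e' : ∀ i v, θ' i v = inc i (ia i (pa i (η i v))) := fun i v => by rw [hθ']; rfl
    have h1 : ¬ (∑ i, Module.finrank k (LinearMap.range (θ' i)) < Nat.find hex) := by
      intro hlt
      refine Nat.find_min hex hlt ⟨θ', ?_, ?_, ⟨i0, v0, ?_⟩, rfl⟩
      · rw [hθ']
        exact hinc.comp (hia.comp (hpa.comp hη))
      · intro i v
        rw [e' i (θ' i v), e' i v, hηinc]; simp
      · rw [e']
        intro h
        apply hiv
        apply hiai
        apply hinj
        rw [h, map_zero, map_zero]
    have h2 : ∀ i, LinearMap.ker (θ i) ≤ LinearMap.ker (θ' i) := by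
      intro i v hv
      rw [LinearMap.mem_ker] at hv ⊢
      have : η i v = 0 := hinj i (by rw [hincη, hv, map_zero])
      rw [e', this]; simp
    intro i v hv
    have h3 : ∀ i, Module.finrank k (LinearMap.range (θ' i)) ≤
        Module.finrank k (LinearMap.range (θ i)) := by
      intro i
      have a1 := LinearMap.finrank_range_add_finrank_ker (θ i)
      have a2 := LinearMap.finrank_range_add_finrank_ker (θ' i)
      have a3 := Submodule.finrank_mono (h2 i)
      omega
    have h4 : LinearMap.ker (θ i) = LinearMap.ker (θ' i) := by
      refine Submodule.eq_of_le_of_finrank_le (h2 i) ?_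
      by_contra hlt
      push Not at hlt
      have a1 := LinearMap.finrank_range_add_finrank_ker (θ i)
      have a2 := LinearMap.finrank_range_add_finrank_ker (θ' i)
      apply h1
      rw [← hrk]
      exact Finset.sum_lt_sum (fun i _ => h3 i) ⟨i, Finset.mem_univ i, by omega⟩
    have : v ∈ LinearMap.ker (θ' i) := by
      rw [LinearMap.mem_ker, e', hv]; simp
    rw [← h4] at this
    exact this
  have hle : L.dimVec ≤ X.dimVec := fun i =>
    LinearMap.finrank_le_finrank_of_injective (f := inc i ∘ₗ ia i) ((hinj i).comp (hiai i))
  refine ⟨L, hL, hle, ?_, ?_⟩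
  · intro heq
    obtain ⟨i, v, h⟩ := hθ0
    have hsu : Function.Surjective (inc i ∘ₗ ia i) :=
      (LinearMap.injective_iff_surjective_of_finrank_eq_finrank
        (congrFun heq i)).1 ((hinj i).comp (hiai i))
    obtain ⟨w, rfl⟩ := hsu v
    exact h (hinc0 i _)
  · intro hsurj
    have hρ : ∀ i, ∃ ρ : X.V i →ₗ[k] L.V i, ∀ w, pa i w = ρ (inc i w) := fun i =>
      exists_factor (pa i) (inc i) (fun w hw => by
        rw [hinj i (hw.trans (map_zero _).symm), map_zero])
    choose ρ hρ using hρ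
    have hD : ∀ e, ∃ D : L.V (s e) →ₗ[k] L.V (t e), ∀ v,
        (ρ (t e) ∘ₗ X.f e - L.f e ∘ₗ ρ (s e)) v = D ((pa (s e) ∘ₗ η (s e)) v) := by
      intro e
      refine exists_factor _ _ fun v hv => ?_
      obtain ⟨w, rfl⟩ := hKer _ v (hker _ v hv)
      simp only [LinearMap.sub_apply, LinearMap.comp_apply]
      rw [← hinc, ← hρ, ← hρ, hpa, sub_self]
    choose D hD using hD
    obtain ⟨φ, hφ⟩ := hsurj D
    have hφ' : ∀ e v, D e v = φ (t e) (L.f e v) - L.f e (φ (s e) v) := fun e v => by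
      rw [← hφ]; rfl
    obtain ⟨r, hr⟩ : ∃ r : ∀ i, X.V i →ₗ[k] L.V i, r = fun i => ρ i - φ i ∘ₗ pa i ∘ₗ η i :=
      ⟨_, rfl⟩
    have hr' : ∀ i v, r i v = ρ i v - φ i (pa i (η i v)) := fun i v => by rw [hr]; rfl
    have hrhom : IsHom X L r := by
      intro e v
      have h1 := hD e v
      simp only [LinearMap.sub_apply, LinearMap.comp_apply] at h1
      rw [hφ'] at h1
      rw [hr', hr', hη, hpa, map_sub]
      rw [sub_eq_sub_iff_add_eq_add] at h1 ⊢
      rw [add_comm (L.f e _)]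
      rw [h1]
    have hri : ∀ i v, r i (inc i (ia i v)) = v := by
      intro i v
      rw [hr', hηinc, ← hρ, hpi]; simp
    rcases ((indec_iff X).1 hX).2 _ ((hinc.comp hia).comp hrhom)
      (fun i v => by simp [hri]) with h | h
    · apply hL.1
      intro i
      refine ⟨fun a b => ?_⟩
      have : ∀ a, a = (0 : L.V i) := fun a => by
        have := h i (inc i (ia i a))
        simp only [LinearMap.comp_apply, hri] at this
        exact hiai i (hinj i (by rw [this]; simp))
      rw [this a, this b]
    · obtain ⟨i, v, h'⟩ := hθ0
      apply h'
      rw [← h i v]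
      exact hinc0 i _

theorem brick [Fintype I] [Fintype E] [IsAlgClosed k] {δ : I → ℕ}
    (hpos : ∀ x : I → ℕ, x ≤ δ → x ≠ 0 → x ≠ δ →
      0 < eul s t (fun i => (x i : ℤ)) (fun i => (x i : ℤ))) :
    ∀ (n : ℕ) (X : QRep k I E s t), ∑ i, X.dimVec i = n → X.Indecomposable → X.dimVec ≤ δ →
      ∀ φ, IsHom X X φ → ∃ c : k, ∀ i v, φ i v = c • v := by
  intro n
  induction n using Nat.strong_induction_on with
  | _ n ih =>
  intro X hn hX hle φ hφ
  by_contra hc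
  obtain ⟨L, hL, hLX, hne, hns⟩ := exists_self_ext hX (exists_sq_zero hX hφ hc)
  have h1 : ∑ i, L.dimVec i < n := by
    rw [← hn]
    obtain ⟨i, hi⟩ := Function.ne_iff.1 hne
    exact Finset.sum_lt_sum (fun i _ => hLX i) ⟨i, Finset.mem_univ i, lt_of_le_of_ne (hLX i) hi⟩
  have h2 := ih _ h1 L rfl hL (hLX.trans hle)
  have h3 : Module.finrank k (homs L L) ≤ 1 := by
    refine finrank_le_one (⟨fun _ => LinearMap.id, mem_homs.2 (isHom_id L)⟩ : homs L L) fun w => ?_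
    obtain ⟨c, hc⟩ := h2 w.1 (mem_homs.1 w.2)
    refine ⟨c, Subtype.ext (funext fun i => LinearMap.ext fun v => ?_)⟩
    exact (hc i v).symm
  have h4 := euler_not_surj hns
  have h5 := hpos L.dimVec (hLX.trans hle) (fun h => hL.1 ((isTrivial_iff L).2 h))
    (fun h => hne (le_antisymm hLX (h ▸ hle)))
  change 0 < eul s t L.dz L.dz at h5
  omega

end QRep

namespace QRep

variable {k : Type} [Field k] {I E : Type} {s t : E → I}

def towerF (M : QRep k I E s t) (ξ : ∀ e, M.V (s e) →ₗ[k] M.V (t e)) (m : ℕ) (e : E) :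
    (Fin m → M.V (s e)) →ₗ[k] (Fin m → M.V (t e)) :=
  LinearMap.pi fun j => M.f e ∘ₗ LinearMap.proj j +
    ∑ l : Fin m, (if l.val + 1 = j.val then (1 : k) else 0) • (ξ e ∘ₗ LinearMap.proj l)

/-- Iterated self-extension. -/
def tower (M : QRep k I E s t) (ξ : ∀ e, M.V (s e) →ₗ[k] M.V (t e)) (m : ℕ) :
    QRep k I E s t where
  V i := Fin m → M.V i
  f e := towerF M ξ m e

theorem tower_f (M : QRep k I E s t) (ξ : ∀ e, M.V (s e) →ₗ[k] M.V (t e)) (m : ℕ) (e : E)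
    (v : Fin m → M.V (s e)) (j : Fin m) : towerF M ξ m e v j =
      M.f e (v j) + ∑ l : Fin m, (if l.val + 1 = j.val then (1 : k) else 0) • ξ e (v l) := by
  simp only [towerF, LinearMap.pi_apply, LinearMap.add_apply, LinearMap.comp_apply,
    LinearMap.proj_apply, LinearMap.sum_apply, LinearMap.smul_apply]

theorem dimVec_tower (M : QRep k I E s t) (ξ : ∀ e, M.V (s e) →ₗ[k] M.V (t e)) (m : ℕ) (i : I) :
    (tower M ξ m).dimVec i = m * M.dimVec i := by
  have : Module.finrank k (Fin m → M.V i) = m * Module.finrank k (M.V i) := by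
    rw [Module.finrank_pi_fintype]; simp
  exact this

theorem toeplitz_up {m : ℕ} {c : Fin m → Fin m → k}
    (h1 : ∀ j l, ∑ j' : Fin m, (if j'.val + 1 = j.val then (1 : k) else 0) * c j' l =
      ∑ l' : Fin m, (if l.val + 1 = l'.val then (1 : k) else 0) * c j l') :
    ∀ n (j l : Fin m), j.val = n → j < l → c j l = 0 := by
  intro n
  induction n with
  | zero => 
    intro j l hj hl
    have hl' : l.val - 1 < m := by omega
    have := h1 j ⟨l.val - 1, hl'⟩
    rw [Finset.sum_eq_zero, Finset.sum_eq_single l] at this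
    · rw [if_pos (by simp only; have := Fin.lt_def.1 hl; omega), one_mul] at this
      exact this.symm
    · intro b _ hb
      rw [if_neg, zero_mul]
      intro h
      apply hb
      apply Fin.ext
      simp only at h
      have := Fin.lt_def.1 hl
      omega
    · simp
    · intro a _
      rw [if_neg (by omega), zero_mul]
  | succ n ih =>
    intro j l hj hl
    have hl1 := Fin.lt_def.1 hl
    have hl' : l.val - 1 < m := by omega
    have hj' : n < m := by omega
    have := h1 j ⟨l.val - 1, hl'⟩
    rw [Finset.sum_eq_single ⟨n, hj'⟩, Finset.sum_eq_single l] at this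
    · rw [if_pos (by simp only; omega), if_pos (by simp only; omega), one_mul, one_mul] at this
      rw [← this]
      exact ih _ _ rfl (by rw [Fin.lt_def]; simp only; omega)
    · intro b _ hb
      rw [if_neg, zero_mul]
      intro h
      apply hb
      apply Fin.ext
      simp only at h
      omega
    · simp
    · intro b _ hb
      rw [if_neg, zero_mul]
      intro h
      apply hb
      apply Fin.ext
      simp only at h ⊢
      omega
    · simp

/-- lower triangular Toeplitz idempotents are trivial -/
theorem toeplitz_zero {m : ℕ} {c : Fin m → Fin m → k}
    (h1 : ∀ j l, ∑ j' : Fin m, (if j'.val + 1 = j.val then (1 : k) else 0) * c j' l =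
      ∑ l' : Fin m, (if l.val + 1 = l'.val then (1 : k) else 0) * c j l')
    (h2 : ∀ j l, ∑ a, c j a * c a l = c j l) (h0 : ∀ j, j.val = 0 → c j j = 0) :
    ∀ j l, c j l = 0 := by
  have hup := toeplitz_up h1
  have hshift : ∀ (j l j' l' : Fin m), j'.val + 1 = j.val → l'.val + 1 = l.val →
      c j l = c j' l' := by
    intro j l j' l' hj hl
    have := h1 j l'
    rw [Finset.sum_eq_single j', Finset.sum_eq_single l, if_pos hj, if_pos hl] at this
    · simpa using this.symm
    · intro b _ hb
      rw [if_neg (fun h => hb (Fin.ext (by omega))), zero_mul]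
    · simp
    · intro b _ hb
      rw [if_neg (fun h => hb (Fin.ext (by omega))), zero_mul]
    · simp
  have hdiag : ∀ n (j : Fin m), j.val = n → c j j = 0 := by
    intro n
    induction n with
    | zero => exact h0
    | succ n ih =>
      intro j hj
      have hn : n < m := by omega
      rw [hshift j j ⟨n, hn⟩ ⟨n, hn⟩ hj.symm hj.symm]
      exact ih _ rfl
  have hmain : ∀ d : ℕ, ∀ j l : Fin m, j.val = l.val + d → c j l = 0 := by
    intro d
    induction d using Nat.strong_induction_on with
    | _ d ih =>
    intro j l hjl
    rw [← h2]
    refine Finset.sum_eq_zero fun a _ => ?_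
    rcases lt_trichotomy a l with h | h | h
    · rw [hup _ a l rfl h, mul_zero]
    · subst h
      rw [hdiag _ a rfl, mul_zero]
    · by_cases h' : a < j
      · rw [ih (j.val - a.val) (by have := Fin.lt_def.1 h; have := Fin.lt_def.1 h'; omega) j a
          (by have := Fin.lt_def.1 h'; omega), zero_mul]
      · rcases lt_or_eq_of_le (not_lt.1 h') with h'' | h''
        · rw [hup _ j a rfl h'', zero_mul]
        · subst h''
          rw [hdiag _ j rfl, zero_mul]
  intro j l
  rcases lt_or_ge j l with h | h
  · exact hup _ j l rfl h
  · exact hmain (j.val - l.val) j l (by have := Fin.le_def.1 h; omega)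

theorem toeplitz_idem {m : ℕ} {c : Fin m → Fin m → k}
    (h1 : ∀ j l, ∑ j' : Fin m, (if j'.val + 1 = j.val then (1 : k) else 0) * c j' l =
      ∑ l' : Fin m, (if l.val + 1 = l'.val then (1 : k) else 0) * c j l')
    (h2 : ∀ j l, ∑ a, c j a * c a l = c j l) :
    (∀ j l, c j l = 0) ∨ ∀ j l, c j l = if j = l then 1 else 0 := by
  have hup := toeplitz_up h1
  by_cases h0 : ∀ j, j.val = 0 → c j j = 0
  · exact Or.inl (toeplitz_zero h1 h2 h0)
  right
  push Not at h0
  obtain ⟨z, hz, hz0⟩ := h0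
  have hz1 : c z z = 1 := by
    have := h2 z z
    rw [Finset.sum_eq_single z] at this
    · exact mul_left_cancel₀ hz0 (by rw [this, mul_one])
    · intro b _ hb
      have : z.val ≠ b.val := fun h => hb (Fin.ext h.symm)
      rw [hup _ z b rfl (by rw [Fin.lt_def]; omega), zero_mul]
    · simp
  have key := toeplitz_zero (c := fun j l => (if j = l then 1 else 0) - c j l) (by
    intro j l
    simp only [mul_sub, Finset.sum_sub_distrib, h1]
    simp) (by
    intro j l
    simp only [mul_sub, sub_mul, Finset.sum_sub_distrib, h2]
    simp) (by
    intro j hj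
    have : j = z := Fin.ext (by omega)
    subst this
    simp [hz1])
  intro j l
  exact (sub_eq_zero.1 (key j l)).symm

theorem tower_scalar {M : QRep k I E s t} {ξ : ∀ e, M.V (s e) →ₗ[k] M.V (t e)}
    (hb : ∀ φ, IsHom M M φ → ∃ c : k, ∀ i v, φ i v = c • v)
    (hξ : ξ ∉ LinearMap.range (dmap M M)) {m : ℕ}
    (ψ : Fin m → Fin m → ∀ i, M.V i →ₗ[k] M.V i)
    (hψ : ∀ j l e v, ψ j l (t e) (M.f e v) +
      ∑ l' : Fin m, (if l.val + 1 = l'.val then (1 : k) else 0) • ψ j l' (t e) (ξ e v) =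
      M.f e (ψ j l (s e) v) +
      ∑ j' : Fin m, (if j'.val + 1 = j.val then (1 : k) else 0) • ξ e (ψ j' l (s e) v)) :
    ∃ c : Fin m → Fin m → k, (∀ j l i v, ψ j l i v = c j l • v) ∧
      ∀ j l, ∑ j' : Fin m, (if j'.val + 1 = j.val then (1 : k) else 0) * c j' l =
      ∑ l' : Fin m, (if l.val + 1 = l'.val then (1 : k) else 0) * c j l' := by
  classical
  obtain ⟨c, hc⟩ : ∃ c : Fin m → Fin m → k, ∀ j l, (∃ c : k, ∀ i v, ψ j l i v = c • v) →
      ∀ i v, ψ j l i v = c j l • v := by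
    have : ∀ j l, ∃ c : k, (∃ c : k, ∀ i v, ψ j l i v = c • v) → ∀ i v, ψ j l i v = c • v := by
      intro j l
      by_cases h : ∃ c : k, ∀ i v, ψ j l i v = c • v
      · exact ⟨h.choose, fun _ => h.choose_spec⟩
      · exact ⟨0, fun h' => absurd h' h⟩
    choose c hc using this
    exact ⟨c, hc⟩
  have hξ' : ∀ (γ : k) (φ : ∀ i, M.V i →ₗ[k] M.V i), dmap M M φ = γ • ξ → γ = 0 := by
    intro γ φ h
    by_contra hγ
    apply hξ
    refine ⟨γ⁻¹ • φ, ?_⟩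
    rw [map_smul, h, smul_smul, inv_mul_cancel₀ hγ, one_smul]
  have step : ∀ j l, (∀ j' : Fin m, j'.val + 1 = j.val → ∀ i v, ψ j' l i v = c j' l • v) →
      (∀ l' : Fin m, l.val + 1 = l'.val → ∀ i v, ψ j l' i v = c j l' • v) →
      (∀ i v, ψ j l i v = c j l • v) ∧
      ∑ j' : Fin m, (if j'.val + 1 = j.val then (1 : k) else 0) * c j' l =
      ∑ l' : Fin m, (if l.val + 1 = l'.val then (1 : k) else 0) * c j l' := by
    intro j l h1 h2
    have e1 : ∀ e v, ∑ l' : Fin m, (if l.val + 1 = l'.val then (1 : k) else 0) •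
        ψ j l' (t e) (ξ e v) =
        (∑ l' : Fin m, (if l.val + 1 = l'.val then (1 : k) else 0) * c j l') • ξ e v := by
      intro e v
      rw [Finset.sum_smul]
      refine Finset.sum_congr rfl fun l' _ => ?_
      split_ifs with h
      · rw [h2 l' h, smul_smul]
      · simp
    have e2 : ∀ e v, ∑ j' : Fin m, (if j'.val + 1 = j.val then (1 : k) else 0) •
        ξ e (ψ j' l (s e) v) =
        (∑ j' : Fin m, (if j'.val + 1 = j.val then (1 : k) else 0) * c j' l) • ξ e v := by
      intro e v
      rw [Finset.sum_smul]
      refine Finset.sum_congr rfl fun l' _ => ?_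
      split_ifs with h
      · rw [h1 l' h, map_smul, smul_smul]
      · simp
    have h3 : dmap M M (ψ j l) =
      (∑ j' : Fin m, (if j'.val + 1 = j.val then (1 : k) else 0) * c j' l -
        ∑ l' : Fin m, (if l.val + 1 = l'.val then (1 : k) else 0) * c j l') • ξ := by
      funext e
      refine LinearMap.ext fun v => ?_
      have := hψ j l e v
      rw [e1, e2] at this
      change ψ j l (t e) (M.f e v) - M.f e (ψ j l (s e) v) = (_ : k) • ξ e v
      rw [sub_smul, sub_eq_sub_iff_add_eq_add, this]
      abel
    have h4 := hξ' _ _ h3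
    refine ⟨hc j l (hb _ (mem_homs.1 ?_)), sub_eq_zero.1 h4⟩
    rw [h4, zero_smul] at h3
    exact h3
  have hall : ∀ n (j l : Fin m), j.val + (m - 1 - l.val) = n → ∀ i v, ψ j l i v = c j l • v := by
    intro n
    induction n with
    | zero =>
      intro j l hn
      refine (step j l (fun j' hj' => ?_) (fun l' hl' => ?_)).1 <;> exfalso <;> omega
    | succ n ih =>
      intro j l hn
      refine (step j l (fun j' hj' => ih _ _ ?_) (fun l' hl' => ih _ _ ?_)).1 <;> omega
  exact ⟨c, fun j l => hall _ j l rfl, fun j l =>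
    (step j l (fun j' _ => hall _ j' l rfl) (fun l' _ => hall _ j l' rfl)).2⟩

theorem tower_indec {M : QRep k I E s t} {ξ : ∀ e, M.V (s e) →ₗ[k] M.V (t e)}
    (hM : ¬ M.IsTrivial) (hb : ∀ φ, IsHom M M φ → ∃ c : k, ∀ i v, φ i v = c • v)
    (hξ : ξ ∉ LinearMap.range (dmap M M)) {m : ℕ} (hm : 0 < m) :
    (tower M ξ m).Indecomposable := by
  classical
  obtain ⟨i0, hi0⟩ : ∃ i, Nontrivial (M.V i) := by
    by_contra h
    push Not at h
    exact hM fun i => h i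
  obtain ⟨v0, hv0⟩ := exists_ne (0 : M.V i0)
  have hmain : ∀ q : ∀ i, (Fin m → M.V i) →ₗ[k] (Fin m → M.V i),
      (∀ e v, q (t e) (towerF M ξ m e v) = towerF M ξ m e (q (s e) v)) →
      (∀ i v, q i (q i v) = q i v) → (∀ i v, q i v = 0) ∨ (∀ i v, q i v = v) := by
    intro q hq0 hpp
    have hq : ∀ e (v : Fin m → M.V (s e)) j, q (t e) (towerF M ξ m e v) j =
        M.f e (q (s e) v j) + ∑ l : Fin m, (if l.val + 1 = j.val then (1 : k) else 0) •
          ξ e (q (s e) v l) := by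
      intro e v j
      rw [← tower_f, hq0]
    let ψ : Fin m → Fin m → ∀ i, M.V i →ₗ[k] M.V i := fun j l i =>
      LinearMap.proj j ∘ₗ q i ∘ₗ LinearMap.single k (fun _ => M.V i) l
    have hψ : ∀ j l i v, ψ j l i v = q i (Pi.single l v) j := fun _ _ _ _ => rfl
    have hf : ∀ e l v, towerF M ξ m e (Pi.single l v) =
        Pi.single l (M.f e v) + ∑ l' : Fin m, (if l.val + 1 = l'.val then (1 : k) else 0) •
          Pi.single l' (ξ e v) := by
      intro e l v
      funext j
      rw [tower_f, Pi.add_apply, Finset.sum_apply]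
      congr 1
      · by_cases h : j = l
        · subst h; simp
        · simp [h]
      · rw [Finset.sum_eq_single l, Finset.sum_eq_single j]
        · simp
        · intro b _ hb
          simp [hb.symm]
        · simp
        · intro b _ hb
          simp [hb]
        · simp
    obtain ⟨c, hc1, hc2⟩ := tower_scalar hb hξ ψ (by
      intro j l e v
      have h1 := hq e (Pi.single l v) j
      rw [hf, map_add, map_sum, Pi.add_apply, Finset.sum_apply] at h1
      simp only [map_smul, Pi.smul_apply] at h1
      simpa only [hψ] using h1)
    have hqc : ∀ i (v : Fin m → M.V i) j, q i v j = ∑ l, c j l • v l := by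
      intro i v j
      have h1 : v = ∑ l, Pi.single l (v l) := (Finset.univ_sum_single v).symm
      conv_lhs => rw [h1]
      rw [map_sum, Finset.sum_apply]
      exact Finset.sum_congr rfl fun l _ => hc1 j l i (v l)
    have hcc : ∀ j l, ∑ a, c j a * c a l = c j l := by
     intro j l
     have h1 : q i0 (q i0 (Pi.single l v0)) j = q i0 (Pi.single l v0) j :=
      congrFun (hpp i0 _) j
     have h2 : ∀ j, q i0 (Pi.single l v0) j = c j l • v0 := fun j => hc1 j l i0 v0
     rw [hqc, h2] at h1
     simp only [h2, smul_smul] at h1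
     rw [← Finset.sum_smul] at h1
     exact smul_left_injective k hv0 h1
    rcases toeplitz_idem hc2 hcc with h | h
    · left
      intro i v
      funext j
      rw [hqc]
      simp [h]
    · right
      intro i v
      funext j
      rw [hqc]
      simp [h]
  refine (indec_iff _).2 ⟨?_, ?_⟩
  · rw [isTrivial_iff] at hM ⊢
    intro h
    apply hM
    funext i
    have := congrFun h i
    rw [dimVec_tower] at this
    rcases Nat.mul_eq_zero.1 this with h | h
    · omega
    · exact h
  · intro p hp hpp
    exact hmain p hp hpp

end QRep

theorem eul_add {I E : Type} [Fintype I] [Fintype E] [DecidableEq I] (s t : E → I) (x y : I → ℤ) :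
    eul s t x y + eul s t y x = ∑ i, x i * ∑ l, cartanMatrix s t i l * y l := by
  simp only [cartan_sum, mul_sub, Finset.sum_sub_distrib, Finset.mul_sum]
  rw [Finset.sum_comm (s := Finset.univ (α := I)) (t := Finset.univ (α := E))]
  have h : ∀ e, ∑ i, x i * ((if s e = i then y (t e) else 0) + (if t e = i then y (s e) else 0)) =
      x (s e) * y (t e) + y (s e) * x (t e) := by
    intro e
    simp only [mul_add, Finset.sum_add_distrib, mul_ite, mul_zero, Finset.sum_ite_eq,
      Finset.mem_univ, if_true]
    ring
  simp only [h, Finset.sum_add_distrib]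
  unfold eul
  have h2 : ∑ i, x i * (2 * y i) = ∑ i, x i * y i + ∑ i, y i * x i := by
    rw [← Finset.sum_add_distrib]
    exact Finset.sum_congr rfl fun i _ => by ring
  rw [h2]
  ring

theorem cartan_symm {I E : Type} [DecidableEq I] (s t : E → I) (i j : I) :
    cartanMatrix s t i j = cartanMatrix s t j i := by
  unfold cartanMatrix
  rw [add_comm (Nat.card {e : E // s e = i ∧ t e = j} : ℤ)]
  simp only [eq_comm]

theorem cartan_nonpos {I E : Type} [DecidableEq I] (s t : E → I) {i j : I} (h : i ≠ j) :
    cartanMatrix s t i j ≤ 0 := by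
  unfold cartanMatrix
  rw [if_neg h]
  omega

theorem form_ident {I : Type} [Fintype I] {C : I → I → ℚ} (hs : ∀ i j, C i j = C j i)
    (b u : I → ℚ) : 2 * ∑ i, (u i * b i) * ∑ l, C i l * ((1 - u l) * b l) =
      2 * ∑ i, u i * (1 - u i) * (b i * ∑ l, C i l * b l) +
        ∑ i, ∑ l, C i l * b i * b l * (u i - u l) ^ 2 := by
  have h1 : ∑ i, ∑ l, C i l * b i * b l * (u l) ^ 2 = ∑ i, ∑ l, C i l * b i * b l * (u i) ^ 2 := by
    rw [Finset.sum_comm]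
    refine Finset.sum_congr rfl fun i _ => Finset.sum_congr rfl fun l _ => ?_
    rw [hs]; ring
  have h2 : ∑ i, ∑ l, C i l * b i * b l * (u i - u l) ^ 2 =
      2 * ∑ i, ∑ l, C i l * b i * b l * (u i) ^ 2 - 2 * ∑ i, ∑ l, C i l * b i * b l * (u i * u l) := by
    have : ∑ i, ∑ l, C i l * b i * b l * (u i - u l) ^ 2 = ∑ i, ∑ l, C i l * b i * b l * (u i) ^ 2 +
      ∑ i, ∑ l, C i l * b i * b l * (u l) ^ 2 - 2 * ∑ i, ∑ l, C i l * b i * b l * (u i * u l) := by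
      simp only [Finset.mul_sum, ← Finset.sum_add_distrib, ← Finset.sum_sub_distrib]
      refine Finset.sum_congr rfl fun i _ => Finset.sum_congr rfl fun l _ => ?_
      ring
    rw [this, h1]; ring
  rw [h2]
  simp only [Finset.mul_sum, ← Finset.sum_add_distrib, ← Finset.sum_sub_distrib]
  refine Finset.sum_congr rfl fun i _ => Finset.sum_congr rfl fun l _ => ?_
  ring

theorem form_nonpos {I : Type} [Fintype I] {C : I → I → ℤ} (hs : ∀ i j, C i j = C j i)
    (hn : ∀ i j, i ≠ j → C i j ≤ 0) {x y : I → ℕ}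
    (hd : ∀ i, ∑ l, C i l * ((x l + y l : ℕ) : ℤ) ≤ 0)
    (h0 : 0 ≤ ∑ i, (x i : ℤ) * ∑ l, C i l * (y l : ℤ)) :
    (∀ i, ∑ l, C i l * ((x l + y l : ℕ) : ℤ) < 0 → x i = 0 ∨ y i = 0) ∧
    (∀ i l, C i l < 0 → x i * (x l + y l) = x l * (x i + y i)) := by
  obtain ⟨b, hb⟩ : ∃ b : I → ℚ, b = fun i => ((x i : ℚ) + y i) := ⟨_, rfl⟩
  obtain ⟨u, hu⟩ : ∃ u : I → ℚ, u = fun i => (x i : ℚ) / b i := ⟨_, rfl⟩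
  have hb0 : ∀ i, 0 ≤ b i := fun i => by rw [hb]; positivity
  have hx : ∀ i, u i * b i = x i := by
    intro i
    rw [hu]
    by_cases h : b i = 0
    · have : (x i : ℚ) = 0 := by
        rw [hb] at h
        have h1 : (0 : ℚ) ≤ x i := by positivity
        have h2 : (0 : ℚ) ≤ y i := by positivity
        simp only at h
        linarith
      simp [h, this]
    · simp only
      field_simp
  have hy : ∀ i, (1 - u i) * b i = y i := by
    intro i
    rw [sub_mul, hx, hb]; simp
  have hd' : ∀ i, ∑ l, (C i l : ℚ) * b l = ((∑ l, C i l * ((x l + y l : ℕ) : ℤ) : ℤ) : ℚ) := by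
    intro i; rw [hb]; push_cast; rfl
  have hid := form_ident (C := fun i l => (C i l : ℚ)) (fun i j => by simp only [hs i j]) b u
  simp only [hx, hy, hd'] at hid
  have h0' : (0 : ℚ) ≤ ∑ i, (x i : ℚ) * ∑ l, (C i l : ℚ) * (y l : ℚ) := by exact_mod_cast h0
  have u0 : ∀ i, 0 ≤ u i := fun i => by rw [hu]; exact div_nonneg (by positivity) (hb0 i)
  have hA : ∀ i, u i * (1 - u i) * (b i * ((∑ l, C i l * ((x l + y l : ℕ) : ℤ) : ℤ) : ℚ)) ≤ 0 := by
    intro i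
    have h1 : ((∑ l, C i l * ((x l + y l : ℕ) : ℤ) : ℤ) : ℚ) ≤ 0 := by exact_mod_cast hd i
    have : u i * (1 - u i) * (b i * ((∑ l, C i l * ((x l + y l : ℕ) : ℤ) : ℤ) : ℚ)) =
      u i * y i * ((∑ l, C i l * ((x l + y l : ℕ) : ℤ) : ℤ) : ℚ) := by rw [← hy i]; ring
    rw [this]
    exact mul_nonpos_of_nonneg_of_nonpos (mul_nonneg (u0 i) (by positivity)) h1
  have hB : ∀ i l, (C i l : ℚ) * b i * b l * (u i - u l) ^ 2 ≤ 0 := by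
    intro i l
    by_cases h : i = l
    · subst h; simp
    have h1 : (C i l : ℚ) ≤ 0 := by exact_mod_cast hn i l h
    have := mul_nonneg (mul_nonneg (hb0 i) (hb0 l)) (sq_nonneg (u i - u l))
    nlinarith
  have hAs := Finset.sum_nonpos fun i (_ : i ∈ Finset.univ) => hA i
  have hBs := Finset.sum_nonpos fun i (_ : i ∈ Finset.univ) =>
    Finset.sum_nonpos fun l (_ : l ∈ Finset.univ) => hB i l
  have hA0 := (Finset.sum_eq_zero_iff_of_nonpos fun i _ => hA i).1 (le_antisymm hAs (by linarith))
  have hB0 := (Finset.sum_eq_zero_iff_of_nonpos fun i _ => Finset.sum_nonpos fun l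
    (_ : l ∈ Finset.univ) => hB i l).1 (le_antisymm hBs (by linarith))
  constructor
  · intro i hi
    have h1 := hA0 i (Finset.mem_univ _)
    have h2 : ((∑ l, C i l * ((x l + y l : ℕ) : ℤ) : ℤ) : ℚ) ≠ 0 := by exact_mod_cast hi.ne
    have h3 : (x i : ℚ) * y i = 0 := by
      have : (x i : ℚ) * y i * ((∑ l, C i l * ((x l + y l : ℕ) : ℤ) : ℤ) : ℚ) = 0 := by
        rw [← hx i, ← hy i]
        linear_combination b i * h1
      exact (mul_eq_zero.1 this).resolve_right h2
    have : x i * y i = 0 := by exact_mod_cast h3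
    exact mul_eq_zero.1 this
  · intro i l hil
    have h1 := (Finset.sum_eq_zero_iff_of_nonpos fun l _ => hB i l).1 (hB0 i (Finset.mem_univ _)) l
      (Finset.mem_univ _)
    have h2 : (C i l : ℚ) ≠ 0 := by exact_mod_cast hil.ne
    have h3 : b i * b l * (u i - u l) = 0 := by
      have : (C i l : ℚ) * (b i * b l * (u i - u l)) ^ 2 = 0 := by
        linear_combination b i * b l * h1
      exact pow_eq_zero_iff (two_ne_zero) |>.1 ((mul_eq_zero.1 this).resolve_left h2)
    have h4 : (x i : ℚ) * ((x l : ℚ) + y l) = x l * ((x i : ℚ) + y i) := by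
      have e1 : b i = (x i : ℚ) + y i := by rw [hb]
      have e2 : b l = (x l : ℚ) + y l := by rw [hb]
      rw [← e1, ← e2, ← hx i, ← hx l]
      linear_combination h3
    exact_mod_cast h4

theorem form_neg {I : Type} [Fintype I] {C : I → I → ℤ} (hs : ∀ i j, C i j = C j i)
    (hn : ∀ i j, i ≠ j → C i j ≤ 0) {β : I → ℕ}
    (hd : ∀ i, ∑ l, C i l * (β l : ℤ) ≤ 0)
    (hc : SuppConnected C (fun i => (β i : ℤ)))
    (h : (∃ i, β i ≠ 0 ∧ ∑ l, C i l * (β l : ℤ) < 0) ∨ Finset.univ.gcd β = 1)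
    (x y : I → ℕ) (hx : x ≠ 0) (hy : y ≠ 0) (hxy : β = x + y) :
    ∑ i, (x i : ℤ) * ∑ l, C i l * (y l : ℤ) < 0 := by
  by_contra h0
  push Not at h0
  have hβ : ∀ i, β i = x i + y i := fun i => by rw [hxy]; rfl
  obtain ⟨h1, h2⟩ := form_nonpos hs hn (x := x) (y := y) (by simpa only [← hβ] using hd) h0
  simp only [← hβ] at h1 h2
  have h3 : ∀ i j, β i ≠ 0 → β j ≠ 0 → x i * β j = x j * β i := by
    intro i j hi hj
    have := hc i j (Nat.cast_ne_zero.2 hi) (Nat.cast_ne_zero.2 hj)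
    clear hj
    induction this with
    | refl => rfl
    | @tail b c _ hab ih =>
      obtain ⟨ha, hb, hab⟩ := hab
      have hb' := h2 _ _ hab
      have ha' : β b ≠ 0 := Nat.cast_ne_zero.1 ha
      refine Nat.eq_of_mul_eq_mul_left (Nat.pos_of_ne_zero ha') ?_
      calc β b * (x i * β c) = (x i * β b) * β c := by ring
        _ = (x b * β c) * β i := by rw [ih]; ring
        _ = β b * (x c * β i) := by rw [hb']; ring
  have h3' : ∀ i j, x i * β j = x j * β i := by
    intro i j
    by_cases hi : β i = 0
    · have : x i = 0 := by have := hβ i; omega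
      simp [hi, this]
    by_cases hj : β j = 0
    · have : x j = 0 := by have := hβ j; omega
      simp [hj, this]
    exact h3 i j hi hj
  have key : ∃ i, β i ≠ 0 ∧ (x i = 0 ∨ y i = 0) := by
    rcases h with ⟨i, hi, hi'⟩ | hg
    · exact ⟨i, hi, h1 i hi'⟩
    · obtain ⟨i, hi⟩ : ∃ i, x i ≠ 0 := by
        by_contra hh; push Not at hh; exact hx (funext hh)
      have hb : β i ≠ 0 := by have := hβ i; omega
      refine ⟨i, hb, ?_⟩
      have : β i ∣ Finset.univ.gcd (fun j => x i * β j) :=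
        Finset.dvd_gcd fun j _ => ⟨x j, by rw [h3' i j, mul_comm]⟩
      rw [Finset.gcd_mul_left, hg] at this
      simp only [normalize_eq, mul_one] at this
      have := Nat.le_of_dvd (Nat.pos_of_ne_zero hi) this
      have := hβ i; omega
  obtain ⟨i, hi, hi'⟩ := key
  rcases hi' with h | h
  · refine hx (funext fun j => ?_)
    have := h3' i j
    rw [h, zero_mul] at this
    exact (mul_eq_zero.1 this.symm).resolve_right hi
  · refine hy (funext fun j => ?_)
    have := h3' i j
    have e : x i = β i := by have := hβ i; omega
    rw [e, mul_comm] at this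
    have := Nat.eq_of_mul_eq_mul_right (Nat.pos_of_ne_zero hi) this
    have := hβ j
    simp only [Pi.zero_apply]; omega

namespace QRep

variable {k : Type} [Field k] {I E : Type} {s t : E → I}

theorem hasInd_fund [Fintype I] [Fintype E] [DecidableEq I] [IsAlgClosed k] {β : I → ℕ}
    (h0 : β ≠ 0) (hc : SuppConnected (cartanMatrix s t) (fun i => (β i : ℤ)))
    (hd : ∀ i, ∑ l, cartanMatrix s t i l * (β l : ℤ) ≤ 0) : HasInd k s t β := by
  classical
  by_cases hneg : ∃ i, β i ≠ 0 ∧ ∑ l, cartanMatrix s t i l * (β l : ℤ) < 0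
  · refine hasInd_of_neg h0 fun x y hx hy hxy => ?_
    rw [eul_add]
    exact form_neg (cartan_symm s t) (fun i j h => cartan_nonpos s t h) hd hc (Or.inl hneg) x y hx hy hxy
  push Not at hneg
  obtain ⟨i0, hi0⟩ : ∃ i, β i ≠ 0 := by
    by_contra hh; push Not at hh; exact h0 (funext hh)
  obtain ⟨δ, hδ, hg⟩ := Finset.extract_gcd β (s := Finset.univ) ⟨i0, Finset.mem_univ _⟩
  obtain ⟨m, hm⟩ : ∃ m, m = Finset.univ.gcd β := ⟨_, rfl⟩
  rw [← hm] at hδ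
  have hδ : ∀ i, β i = m * δ i := fun i => hδ i (Finset.mem_univ _)
  have hm0 : 0 < m := by
    rcases Nat.eq_zero_or_pos m with h | h
    · have := hδ i0; rw [h] at this; omega
    · exact h
  have hδ0 : ∀ i, δ i ≠ 0 ↔ β i ≠ 0 := by
    intro i; rw [hδ i]; simp [hm0.ne']
  have hδne : δ ≠ 0 := fun h => (hδ0 i0).2 hi0 (by rw [h]; rfl)
  have hsum : ∀ i, ∑ l, cartanMatrix s t i l * (β l : ℤ) =
      m * ∑ l, cartanMatrix s t i l * (δ l : ℤ) := by
    intro i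
    rw [Finset.mul_sum]
    refine Finset.sum_congr rfl fun l _ => ?_
    rw [hδ l]; push_cast; ring
  have hmz : (0 : ℤ) < m := by exact_mod_cast hm0
  have hdδ : ∀ i, ∑ l, cartanMatrix s t i l * (δ l : ℤ) ≤ 0 := by
    intro i
    have := hd i
    rw [hsum i] at this
    by_contra hh
    push Not at hh
    have := mul_pos hmz hh
    linarith
  have hdδ0 : ∀ i, δ i ≠ 0 → ∑ l, cartanMatrix s t i l * (δ l : ℤ) = 0 := by
    intro i hi
    have := hneg i ((hδ0 i).1 hi)
    rw [hsum i] at this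
    refine le_antisymm (hdδ i) ?_
    by_contra hh
    push Not at hh
    have := mul_neg_of_pos_of_neg hmz hh
    linarith
  have hcδ : SuppConnected (cartanMatrix s t) (fun i => (δ i : ℤ)) := by
    intro i j hi hj
    have e : ∀ a, (δ a : ℤ) ≠ 0 ↔ (β a : ℤ) ≠ 0 := by
      intro a; have := hδ0 a; exact_mod_cast this
    have := hc i j ((e i).1 hi) ((e j).1 hj)
    exact Relation.ReflTransGen.mono (fun a b ⟨h1, h2, h3⟩ => ⟨(e a).2 h1, (e b).2 h2, h3⟩) _ _ this
  have hfn := form_neg (cartan_symm s t) (fun i j h => cartan_nonpos s t h) hdδ hcδ (Or.inr hg)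
  obtain ⟨M, hM, hMδ⟩ := hasInd_of_neg (k := k) (s := s) (t := t) hδne fun x y hx hy hxy => by
    rw [eul_add]
    exact hfn x y hx hy hxy
  have hb := brick (k := k) (s := s) (t := t) (δ := δ) (by
    intro x hx hx0 hxδ
    have h1 := hfn x (δ - x) hx0 (fun h => hxδ (le_antisymm hx (tsub_eq_zero_iff_le.1 h)))
      (by rw [add_tsub_cancel_of_le hx])
    have h2 : ∑ i, (x i : ℤ) * ∑ l, cartanMatrix s t i l * (δ l : ℤ) = 0 := by
      refine Finset.sum_eq_zero fun i _ => ?_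
      by_cases hi : δ i = 0
      · have := hx i
        rw [hi] at this
        simp [Nat.le_zero.1 this]
      · rw [hdδ0 i hi, mul_zero]
    have h3 := eul_add s t (fun i => (x i : ℤ)) (fun i => (x i : ℤ))
    have h4 : ∑ i, (x i : ℤ) * ∑ l, cartanMatrix s t i l * (((δ - x) l : ℕ) : ℤ) =
      ∑ i, (x i : ℤ) * ∑ l, cartanMatrix s t i l * (δ l : ℤ) -
      ∑ i, (x i : ℤ) * ∑ l, cartanMatrix s t i l * (x l : ℤ) := by
      rw [← Finset.sum_sub_distrib]
      refine Finset.sum_congr rfl fun i _ => ?_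
      rw [← mul_sub, ← Finset.sum_sub_distrib]
      congr 1
      refine Finset.sum_congr rfl fun l _ => ?_
      rw [Pi.sub_apply, Nat.cast_sub (hx l)]
      ring
    rw [h4, h2, ← h3] at h1
    linarith) _ M rfl hM hMδ.le
  have hns : ¬ Function.Surjective (dmap M M) := by
    intro hsurj
    have h1 := euler_surj hsurj
    have hdz : M.dz = fun i => (δ i : ℤ) := by rw [← hMδ]; rfl
    rw [hdz] at h1
    have h2 := eul_add s t (fun i => (δ i : ℤ)) (fun i => (δ i : ℤ))
    have h3 : ∑ i, (δ i : ℤ) * ∑ l, cartanMatrix s t i l * (δ l : ℤ) = 0 := by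
      refine Finset.sum_eq_zero fun i _ => ?_
      by_cases hi : δ i = 0
      · simp [hi]
      · rw [hdδ0 i hi, mul_zero]
    rw [h3] at h2
    have h4 : Module.finrank k (homs M M) = 0 := by
      have : (Module.finrank k (homs M M) : ℤ) = 0 := by linarith
      exact_mod_cast this
    have h5 := Submodule.finrank_eq_zero.1 h4
    have h6 : (fun i => (LinearMap.id : M.V i →ₗ[k] M.V i)) ∈ homs M M := mem_homs.2 (isHom_id M)
    rw [h5] at h6
    refine hM.1 fun i => ⟨fun v w => ?_⟩
    have := congrFun ((Submodule.mem_bot k).1 h6) i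
    have hv : ∀ v : M.V i, v = 0 := fun v => by
      simpa using LinearMap.congr_fun this v
    rw [hv v, hv w]
  obtain ⟨ξ, hξ⟩ : ∃ ξ, ξ ∉ LinearMap.range (dmap M M) := by
    by_contra hh
    push Not at hh
    exact hns hh
  refine ⟨tower M ξ m, tower_indec hM.1 hb hξ hm0, funext fun i => ?_⟩
  rw [dimVec_tower, hMδ, hδ i]

end QRep

namespace QRep

variable {k : Type} [Field k] {I E : Type} {s t : E → I}

theorem ext_indec {A B : QRep k I E s t} (hA : A.Indecomposable) (hB : B.Indecomposable)
    (hBA : ∀ φ, IsHom B A φ → ∀ i v, φ i v = 0) {ξ : ∀ e, A.V (s e) →ₗ[k] B.V (t e)}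
    (hξ : ∀ g : ∀ i, A.V i →ₗ[k] B.V i,
      ¬ ∀ e v, ξ e v = B.f e (g (s e) v) - g (t e) (A.f e v)) :
    (extRep A B ξ).Indecomposable := by
  have hA' := (indec_iff A).1 hA
  have hB' := (indec_iff B).1 hB
  have main : ∀ p : ∀ i, (B.V i × A.V i) →ₗ[k] (B.V i × A.V i),
      (∀ e b a, p (t e) (B.f e b + ξ e a, A.f e a) =
        (B.f e (p (s e) (b, a)).1 + ξ e (p (s e) (b, a)).2, A.f e (p (s e) (b, a)).2)) →
      (∀ i v, p i (p i v) = p i v) → (∀ i v, (p i v).2 = 0) → (∀ i v, p i v = 0) := by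
    intro p hp hpp h2
    have hB2 := hB'.2 (fun i => LinearMap.fst k _ _ ∘ₗ p i ∘ₗ LinearMap.inl k _ _) (by
      intro e v
      have := congrArg Prod.fst (hp e v 0)
      simp only [map_zero, add_zero, h2] at this
      exact this) (by
      intro i v
      have := congrArg Prod.fst (hpp i (v, 0))
      have e : p i (v, 0) = ((p i (v, 0)).1, 0) := Prod.ext rfl (h2 _ _)
      rw [e] at this
      exact this)
    rcases hB2 with h | h
    · intro i v
      have e : p i v = ((p i v).1, 0) := Prod.ext rfl (h2 _ _)
      have h3 : (p i ((p i v).1, 0)).1 = 0 := h i (p i v).1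
      rw [← hpp i v, e]
      exact Prod.ext h3 (h2 _ _)
    · exfalso
      refine hξ (fun i => LinearMap.fst k _ _ ∘ₗ p i ∘ₗ LinearMap.inr k _ _) fun e a => ?_
      have h1 := congrArg Prod.fst (hp e 0 a)
      have h3 : (p (t e) (B.f e 0 + ξ e a, A.f e a)).1 = ξ e a + (p (t e) (0, A.f e a)).1 := by
        have e1 : (B.f e 0 + ξ e a, A.f e a) = ((ξ e a, 0) : B.V (t e) × A.V (t e)) + (0, A.f e a) := by
          ext <;> simp
        rw [e1, map_add, Prod.fst_add]
        congr 1
        exact h (t e) (ξ e a)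
      rw [h3] at h1
      simp only [h2, map_zero, add_zero] at h1
      rw [eq_sub_iff_add_eq]
      exact h1
  refine (indec_iff _).2 ⟨fun ht => hA.1 fun i => ?_, fun p hp hpp => ?_⟩
  · have : Subsingleton (B.V i × A.V i) := ht i
    exact ⟨fun a b => congrArg Prod.snd (Subsingleton.elim ((0, a) : B.V i × A.V i) (0, b))⟩
  · obtain ⟨q, hq⟩ : ∃ q : ∀ i, (B.V i × A.V i) →ₗ[k] (B.V i × A.V i), q = p := ⟨p, rfl⟩
    have hq1 : ∀ e b a, q (t e) (B.f e b + ξ e a, A.f e a) =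
        (B.f e (q (s e) (b, a)).1 + ξ e (q (s e) (b, a)).2, A.f e (q (s e) (b, a)).2) := by
      intro e b a
      rw [hq]
      exact hp e (b, a)
    have hq2 : ∀ i v, q i (q i v) = q i v := by rw [hq]; exact hpp
    have goal : (∀ i v, q i v = 0) ∨ (∀ i v, q i v = v) := by
      have h0 : ∀ i b, (q i (b, 0)).2 = 0 := by
        refine hBA (fun i => LinearMap.snd k _ _ ∘ₗ q i ∘ₗ LinearMap.inl k _ _) ?_
        intro e v
        have := congrArg Prod.snd (hq1 e v 0)
        simp only [map_zero, add_zero] at this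
        exact this
      have h1 : ∀ i b a, (q i (b, a)).2 = (q i (0, a)).2 := by
        intro i b a
        have e1 : ((b, a) : B.V i × A.V i) = (b, 0) + (0, a) := by ext <;> simp
        rw [e1, map_add, Prod.snd_add, h0, zero_add]
      have hA2 := hA'.2 (fun i => LinearMap.snd k _ _ ∘ₗ q i ∘ₗ LinearMap.inr k _ _) (by
        intro e a
        have := congrArg Prod.snd (hq1 e 0 a)
        simp only [h1 (t e)] at this
        exact this) (by
        intro i a
        have := congrArg Prod.snd (hq2 i (0, a))
        change (q i ((q i (0, a)).1, (q i (0, a)).2)).2 = _ at this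
        rw [h1] at this
        exact this)
      rcases hA2 with h | h
      · exact Or.inl (main q hq1 hq2 fun i v => (h1 i v.1 v.2).trans (h i v.2))
      · refine Or.inr fun i v => ?_
        have := main (fun i => LinearMap.id - q i) (by
          intro e b a
          have := hq1 e b a
          simp only [LinearMap.sub_apply, LinearMap.id_apply, this]
          ext
          · simp only [Prod.fst_sub, Prod.snd_sub, map_sub]; abel
          · simp only [Prod.snd_sub, map_sub]) (by
          intro i v
          simp only [LinearMap.sub_apply, LinearMap.id_apply, map_sub, hq2]
          abel) (by
          intro i v
          have e : (q i v).2 = v.2 := (h1 i v.1 v.2).trans (h i v.2)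
          simp only [LinearMap.sub_apply, LinearMap.id_apply, Prod.snd_sub, e, sub_self]) i v
        simp only [LinearMap.sub_apply, LinearMap.id_apply, sub_eq_zero] at this
        exact this.symm
    rw [hq] at goal
    exact goal

theorem indec_simple [Fintype I] [DecidableEq I] {S : QRep k I E s t} {i : I}
    (h : S.dimVec = fun j => if j = i then 1 else 0) : S.Indecomposable := by
  refine ⟨fun ht => ?_, fun A B hA hB hAB => ?_⟩
  · have := congrFun ((isTrivial_iff S).1 ht) i
    rw [h] at this
    simp at this
  · have h1 := hAB.dimVec
    rw [h] at h1
    rw [isTrivial_iff] at hA hB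
    have h2 := congrArg (fun f : I → ℕ => ∑ j, f j) h1
    simp only [Finset.sum_ite_eq', Finset.mem_univ, if_true, dimVec_dsum,
      Finset.sum_add_distrib] at h2
    have pos : ∀ f : I → ℕ, f ≠ 0 → 0 < ∑ j, f j := by
      intro f hf
      obtain ⟨j, hj⟩ : ∃ j, f j ≠ 0 := by
        by_contra hh; push Not at hh; exact hf (funext hh)
      exact Finset.sum_pos' (fun _ _ => Nat.zero_le _) ⟨j, Finset.mem_univ _, Nat.pos_of_ne_zero hj⟩
    have := pos _ hA
    have := pos _ hB
    omega

def loopEnd (M : QRep k I E s t) {i : I} {l : E} (h1 : s l = i) (h2 : t l = i) :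
    M.V i →ₗ[k] M.V i :=
  (M.castV h2).toLinearMap ∘ₗ M.f l ∘ₗ (M.castV h1.symm).toLinearMap

theorem loopEnd_nat {M N : QRep k I E s t} {i : I} {l : E} (h1 : s l = i) (h2 : t l = i)
    (φ : ∀ i, M.V i →ₗ[k] N.V i) (h : ∀ v, φ (t l) (M.f l v) = N.f l (φ (s l) v)) (v : M.V i) :
    φ i (M.loopEnd h1 h2 v) = N.loopEnd h1 h2 (φ i v) := by
  have cn : ∀ {a b : I} (h : a = b) (v : M.V a), φ b (M.castV h v) = N.castV h (φ a v) := by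
    intro a b h v; subst h; rfl
  simp only [loopEnd, LinearMap.comp_apply, LinearEquiv.coe_coe]
  rw [cn, h, cn]

theorem exists_simple [Fintype I] [DecidableEq I] {i : I} {l : E} (h1 : s l = i) (h2 : t l = i) (c : k) :
    ∃ S : QRep k I E s t, S.dimVec = (fun j => if j = i then 1 else 0) ∧
      ∀ v, S.loopEnd h1 h2 v = c • v := by
  refine ⟨ofMat (fun j => if j = i then 1 else 0) (fun _ => Matrix.of fun _ _ => c),
    dimVec_ofMat _ _, ?_⟩
  obtain ⟨α, hα⟩ : ∃ α : I → ℕ, α = fun j => if j = i then 1 else 0 := ⟨_, rfl⟩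
  rw [← hα]
  have hi : α i = 1 := by rw [hα]; simp
  obtain ⟨x, hx⟩ : ∃ x : Mats k s t α, x = fun _ => Matrix.of fun _ _ => c := ⟨_, rfl⟩
  rw [← hx]
  have cc : ∀ {a b : I} (h : a = b) (d : k), (ofMat α x).castV h (fun _ => d) = (fun _ => d) := by
    intro a b h d; subst h; rfl
  have aux : ∀ {n : ℕ} (hn : n = 1) (v : Fin n → k), ∃ d, v = fun _ => d := by
    intro n hn v
    subst hn
    exact ⟨v 0, funext fun j => by rw [Subsingleton.elim j 0]⟩
  intro v
  obtain ⟨d, hd⟩ := aux hi v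
  rw [hd]
  change (ofMat α x).castV h2 ((ofMat α x).f l ((ofMat α x).castV h1.symm (fun _ => d))) = _
  rw [cc]
  have e : (ofMat α x).f l (fun _ => d) = fun _ => c * d := by
    rw [ofMat_f, hx]
    funext j
    have : α (s l) = 1 := by rw [h1, hi]
    simp [Matrix.mulVec, dotProduct, this]
  rw [e, cc]
  rfl

theorem loop_add [Fintype I] [DecidableEq I] [IsAlgClosed k] {α : I → ℕ} {i : I} {l e0 : E}
    (h1 : s l = i) (h2 : t l = i) (he : e0 ≠ l) (ht : t e0 = i) (hs : α (s e0) ≠ 0)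
    (h : HasInd k s t α) : HasInd k s t (fun j => α j + if j = i then 1 else 0) := by
  classical
  obtain ⟨M, hM, hMα⟩ := h
  obtain ⟨c, hc⟩ : ∃ c : k, ¬ Module.End.HasEigenvalue (M.loopEnd h1 h2) c := by
    have hf : Set.Finite {c | Module.End.HasEigenvalue (M.loopEnd h1 h2) c} :=
      Module.End.finite_hasEigenvalue _
    have : Infinite k := IsAlgClosed.instInfinite
    exact hf.infinite_compl.nonempty
  have hinj : ∀ v, M.loopEnd h1 h2 v = c • v → v = 0 := by
    intro v hv
    by_contra h0
    exact hc (Module.End.hasEigenvalue_of_hasEigenvector ⟨Module.End.mem_eigenspace_iff.2 hv, h0⟩)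
  have hsurj : ∀ w, ∃ v, M.loopEnd h1 h2 v - c • v = w := by
    have : Function.Injective (M.loopEnd h1 h2 - c • LinearMap.id : M.V i →ₗ[k] M.V i) := by
      rw [injective_iff_map_eq_zero]
      intro v hv
      exact hinj v (sub_eq_zero.1 hv)
    exact fun w => LinearMap.injective_iff_surjective.1 this w
  obtain ⟨S, hS, hSc⟩ := exists_simple (k := k) h1 h2 c
  have hSs : ∀ j, j ≠ i → ∀ v : S.V j, v = 0 := by
    intro j hj v
    have : Module.finrank k (S.V j) = 0 := by
      refine (congrFun hS j).trans ?_
      simp [hj]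
    have := Module.finrank_zero_iff.1 this
    exact Subsingleton.elim _ _
  obtain ⟨f, hf⟩ : ∃ f : M.V (s e0) →ₗ[k] S.V (t e0), f ≠ 0 := by
    have : 0 < Module.finrank k (M.V (s e0) →ₗ[k] S.V (t e0)) := by
      rw [Module.finrank_linearMap]
      have a1 : Module.finrank k (M.V (s e0)) = α (s e0) := congrFun hMα _
      have a2 : Module.finrank k (S.V (t e0)) = 1 := by
        refine (congrFun hS (t e0)).trans ?_
        simp [ht]
      rw [a1, a2]; omega
    have := Module.finrank_pos_iff.1 this
    exact exists_ne 0
  refine ⟨extRep M S (Function.update (fun _ => 0) e0 f), ext_indec hM (indec_simple hS) ?_ ?_, ?_⟩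
  · intro φ hφ j v
    by_cases hj : j = i
    · subst hj
      refine hinj _ ?_
      rw [← loopEnd_nat h1 h2 φ (hφ l), hSc, map_smul]
    · rw [hSs j hj v, map_zero]
  · intro g hg
    have g0 : ∀ j v, g j v = 0 := by
      intro j v
      by_cases hj : j = i
      · subst hj
        obtain ⟨w, rfl⟩ := hsurj v
        have := loopEnd_nat h1 h2 g (fun v => by
          have := hg l v
          rw [Function.update_of_ne he.symm] at this
          exact (sub_eq_zero.1 this.symm).symm) w
        rw [map_sub, this, hSc, map_smul, sub_self]
      · exact hSs j hj _
    apply hf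
    ext v
    have := hg e0 v
    rw [g0, g0, map_zero, sub_zero, Function.update_self] at this
    exact this
  · funext j
    rw [dimVec_extRep, hMα, hS]

theorem loop_step [Fintype I] [Fintype E] [DecidableEq I] {p : ℕ} [Fact p.Prime]
    [Algebra (ZMod p) k] [Algebra.IsAlgebraic (ZMod p) k] [IsAlgClosed k] {i : I} {l : E}
    (h1 : s l = i) (h2 : t l = i) {α : I → ℕ} (h : HasInd k s t α)
    (hn : ∑ j, cartanMatrix s t i j * (α j : ℤ) < 0) :
    HasInd k s t (fun j => α j + if j = i then 1 else 0) := by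
  classical
  rw [cartan_sum] at hn
  obtain ⟨e0, he, h0⟩ : ∃ e0, e0 ≠ l ∧ ((s e0 = i ∧ α (t e0) ≠ 0) ∨ (t e0 = i ∧ α (s e0) ≠ 0)) := by
    by_contra hh
    push Not at hh
    rw [Finset.sum_eq_single l (fun e _ he => by
      obtain ⟨a, b⟩ := hh e he
      have e1 : (if s e = i then (α (t e) : ℤ) else 0) = 0 := by
        split_ifs with h
        · exact_mod_cast a h
        · rfl
      have e2 : (if t e = i then (α (s e) : ℤ) else 0) = 0 := by
        split_ifs with h
        · exact_mod_cast b h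
        · rfl
      rw [e1, e2, add_zero]) (by simp)] at hn
    rw [h1, h2] at hn
    simp only [if_true] at hn
    omega
  rcases h0 with ⟨ha, hb⟩ | ⟨ha, hb⟩
  · obtain ⟨s', hs'⟩ : ∃ s', s' = Function.update s e0 (t e0) := ⟨_, rfl⟩
    obtain ⟨t', ht'⟩ : ∃ t', t' = Function.update t e0 (s e0) := ⟨_, rfl⟩
    have hr : Reor s t s' t' := by
      intro e
      rw [hs', ht']
      by_cases h : e = e0
      · subst h; right; simp
      · left; simp [h]
    have hr' : Reor s' t' s t := by
      intro e
      rcases hr e with ⟨a, b⟩ | ⟨a, b⟩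
      · exact Or.inl ⟨a.symm, b.symm⟩
      · exact Or.inr ⟨b.symm, a.symm⟩
    refine orient (p := p) hr' (loop_add (l := l) (e0 := e0) ?_ ?_ he ?_ ?_ (orient (p := p) hr h))
    · rw [hs', Function.update_of_ne he.symm, h1]
    · rw [ht', Function.update_of_ne he.symm, h2]
    · rw [ht', Function.update_self, ha]
    · rw [hs', Function.update_self]; exact hb
  · exact loop_add h1 h2 he ha hb h

theorem cartan_loop [Finite E] [DecidableEq I] {i : I} {l : E} (h1 : s l = i) (h2 : t l = i) :
    cartanMatrix s t i i ≤ 0 := by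
  unfold cartanMatrix
  have : 0 < Nat.card {e : E // s e = i ∧ t e = i} := by
    have : Nonempty {e : E // s e = i ∧ t e = i} := ⟨⟨l, h1, h2⟩⟩
    exact Nat.card_pos
  simp only [if_true]
  omega

theorem loop_refl [Fintype I] [Fintype E] [DecidableEq I] {p : ℕ} [Fact p.Prime]
    [Algebra (ZMod p) k] [Algebra.IsAlgebraic (ZMod p) k] [IsAlgClosed k] {i : I} {l : E}
    (h1 : s l = i) (h2 : t l = i) {α : I → ℕ} (h : HasInd k s t α) :
    ∃ α' : I → ℕ, HasInd k s t α' ∧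
      (fun j => (α' j : ℤ)) = simpleRefl (cartanMatrix s t) i (fun j => (α j : ℤ)) := by
  have hC : ∀ j, cartanMatrix s t i j ≤ 0 := by
    intro j
    by_cases hj : i = j
    · subst hj; exact cartan_loop h1 h2
    · exact cartan_nonpos s t hj
  have hle : ∑ j, cartanMatrix s t i j * (α j : ℤ) ≤ 0 :=
    Finset.sum_nonpos fun j _ => mul_nonpos_of_nonpos_of_nonneg (hC j) (by positivity)
  have hmany : ∀ n : ℕ, ∑ j, cartanMatrix s t i j * (α j : ℤ) < 0 →
      HasInd k s t (fun j => α j + if j = i then n else 0) := by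
    intro n hneg
    induction n with
    | zero => simpa using h
    | succ n ih =>
      have := loop_step (p := p) h1 h2 ih (by
        push_cast
        simp only [mul_add, Finset.sum_add_distrib]
        have := cartan_loop (s := s) (t := t) h1 h2
        simp only [mul_ite, mul_zero, Finset.sum_ite_eq', Finset.mem_univ, if_true]
        have := mul_nonpos_of_nonpos_of_nonneg this (Nat.cast_nonneg (α := ℤ) n)
        linarith)
      convert this using 2 with j
      split_ifs <;> omega
  obtain ⟨n, hn⟩ := Int.eq_ofNat_of_zero_le (neg_nonneg.2 hle)
  refine ⟨fun j => α j + if j = i then n else 0, ?_, ?_⟩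
  · rcases hle.lt_or_eq with hlt | heq
    · exact hmany n hlt
    · have : n = 0 := by omega
      subst this
      simpa using h
  · funext j
    unfold simpleRefl
    push_cast
    split_ifs <;> omega

end QRep

theorem cartan_edge {I E : Type} [Finite E] [DecidableEq I] (s t : E → I) {e : E}
    (h : s e ≠ t e) : cartanMatrix s t (s e) (t e) < 0 := by
  unfold cartanMatrix
  have : 0 < Nat.card {e' : E // s e' = s e ∧ t e' = t e} := by
    have : Nonempty {e' : E // s e' = s e ∧ t e' = t e} := ⟨⟨e, rfl, rfl⟩⟩
    exact Nat.card_pos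
  rw [if_neg h]
  omega

theorem cartan_two {I E : Type} [DecidableEq I] (s t : E → I) {i : I}
    (hl : ∀ e, ¬ (s e = i ∧ t e = i)) : cartanMatrix s t i i = 2 := by
  unfold cartanMatrix
  have : IsEmpty {e : E // s e = i ∧ t e = i} := ⟨fun e => hl e.1 e.2⟩
  simp

theorem simpleRefl_neg {I : Type} [Fintype I] [DecidableEq I] (C : I → I → ℤ) (i : I)
    (x : I → ℤ) : simpleRefl C i (-x) = - simpleRefl C i x := by
  funext j
  simp only [simpleRefl, Pi.neg_apply, mul_neg, Finset.sum_neg_distrib]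
  split_ifs <;> ring

theorem simpleRefl_invol {I : Type} [Fintype I] [DecidableEq I] (C : I → I → ℤ) (i : I)
    (h : C i i = 2) (x : I → ℤ) : simpleRefl C i (simpleRefl C i x) = x := by
  funext j
  simp only [simpleRefl, mul_sub, Finset.sum_sub_distrib, mul_ite, mul_zero, Finset.sum_ite_eq',
    Finset.mem_univ, if_true, h]
  split_ifs <;> ring

namespace QRep

variable {k : Type} [Field k] {I E : Type} {s t : E → I}

theorem indec_supp [Finite E] [DecidableEq I] {M : QRep k I E s t} (hM : M.Indecomposable) :
    SuppConnected (cartanMatrix s t) (fun i => (M.dimVec i : ℤ)) := by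
  classical
  intro i j hi hj
  obtain ⟨R, hR⟩ : ∃ R : I → Prop, R = Relation.ReflTransGen (fun a b => (M.dimVec a : ℤ) ≠ 0 ∧
    (M.dimVec b : ℤ) ≠ 0 ∧ cartanMatrix s t a b < 0) i := ⟨_, rfl⟩
  have hstep : ∀ a b, R a → M.dimVec a ≠ 0 → M.dimVec b ≠ 0 → cartanMatrix s t a b < 0 → R b := by
    intro a b ha h1 h2 h3
    rw [hR] at ha ⊢
    exact ha.tail ⟨Nat.cast_ne_zero.2 h1, Nat.cast_ne_zero.2 h2, h3⟩
  have hz : ∀ a, M.dimVec a = 0 → ∀ v : M.V a, v = 0 := by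
    intro a ha v
    have := Module.finrank_zero_iff.1 ha
    exact Subsingleton.elim _ _
  suffices R j by rw [hR] at this; exact this
  have hnz : ∀ a, (M.dimVec a : ℤ) ≠ 0 → ∃ v : M.V a, v ≠ 0 := by
    intro a ha
    by_contra hh
    push Not at hh
    have : Subsingleton (M.V a) := ⟨fun v w => by rw [hh v, hh w]⟩
    exact ha (Nat.cast_eq_zero.2 (Module.finrank_zero_iff.2 this))
  have hp := ((indec_iff M).1 hM).2 (fun a => if R a then LinearMap.id else 0) (by
    intro e v
    by_cases h1 : M.dimVec (s e) = 0
    · rw [hz _ h1 v]; simp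
    by_cases h2 : M.dimVec (t e) = 0
    · rw [hz _ h2 (M.f e v), hz _ h2 (M.f e _), map_zero]
    have : R (s e) ↔ R (t e) := by
      by_cases h3 : s e = t e
      · rw [h3]
      · have h4 := cartan_edge s t h3
        exact ⟨fun h => hstep _ _ h h1 h2 h4, fun h => hstep _ _ h h2 h1 (by rwa [cartan_symm])⟩
    by_cases h5 : R (s e)
    · simp [h5, this.1 h5]
    · have h6 : ¬ R (t e) := fun h => h5 (this.2 h)
      simp [h5, h6]) (by
    intro a v
    by_cases h5 : R a <;> simp [h5])
  have hRi : R i := by rw [hR]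
  rcases hp with h | h
  · obtain ⟨v, hv⟩ := hnz i hi
    have := h i v
    simp only [hRi, if_true] at this
    exact absurd this hv
  · obtain ⟨v, hv⟩ := hnz j hj
    by_contra hRj
    have := h j v
    simp only [hRj, if_false] at this
    exact hv this.symm

theorem HasInd.ne_zero {α : I → ℕ} (h : HasInd k s t α) : α ≠ 0 := by
  obtain ⟨M, hM, rfl⟩ := h
  exact fun h0 => hM.1 ((isTrivial_iff M).2 h0)

theorem isPosRoot_of_hasInd [Fintype I] [Fintype E] [DecidableEq I] {p : ℕ} [Fact p.Prime]
    [Algebra (ZMod p) k] [Algebra.IsAlgebraic (ZMod p) k] [IsAlgClosed k] : ∀ (n : ℕ) (α : I → ℕ), ∑ i, α i = n → HasInd k s t α →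
    IsPosRoot (cartanMatrix s t) (fun i => (α i : ℤ)) := by
  intro n
  induction n using Nat.strong_induction_on with
  | _ n ih =>
  intro α hn h
  have hz : (fun i => (α i : ℤ)) ≠ 0 := by
    intro h0
    exact h.ne_zero (funext fun i => Nat.cast_eq_zero.1 (congrFun h0 i))
  refine ⟨fun i => Int.natCast_nonneg _, hz, ?_⟩
  by_cases hall : ∀ i, ∑ l, cartanMatrix s t i l * (α l : ℤ) ≤ 0
  · right
    refine ⟨_, fun i => Int.natCast_nonneg _, hz, ?_, hall, Relation.ReflTransGen.refl⟩
    obtain ⟨M, hM, rfl⟩ := h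
    exact indec_supp hM
  push Not at hall
  obtain ⟨i, hi⟩ := hall
  have hl : ∀ e, ¬ (s e = i ∧ t e = i) := by
    rintro e ⟨h1, h2⟩
    have hC : ∀ j, cartanMatrix s t i j ≤ 0 := by
      intro j
      by_cases hj : i = j
      · subst hj; exact cartan_loop h1 h2
      · exact cartan_nonpos s t hj
    have hle : ∑ j, cartanMatrix s t i j * (α j : ℤ) ≤ 0 :=
      Finset.sum_nonpos fun j _ => mul_nonpos_of_nonpos_of_nonneg (hC j) (by positivity)
    omega
  by_cases hα : α = fun j => if j = i then 1 else 0
  · left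
    refine ⟨i, ?_⟩
    have : (fun j => (α j : ℤ)) = fun j => if j = i then 1 else 0 := by
      funext j; rw [hα]; simp
    rw [this]
    exact Relation.ReflTransGen.refl
  obtain ⟨α', hα', he⟩ := refl_ind (p := p) i hl h hα
  have hlt : ∑ j, α' j < n := by
    have h1 : ∑ j, (α' j : ℤ) = ∑ j, (α j : ℤ) - ∑ l, cartanMatrix s t i l * (α l : ℤ) := by
      rw [Finset.sum_congr rfl fun j _ => congrFun he j]
      unfold simpleRefl
      rw [Finset.sum_sub_distrib]
      simp
    have h2 : ((∑ j, α' j : ℕ) : ℤ) < ((∑ j, α j : ℕ) : ℤ) := by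
      push_cast
      linarith
    rw [← hn]
    exact_mod_cast h2
  obtain ⟨_, _, hw⟩ := ih _ hlt α' rfl hα'
  have hback : (fun j => (α j : ℤ)) = simpleRefl (cartanMatrix s t) i (fun j => (α' j : ℤ)) := by
    rw [he, simpleRefl_invol _ _ (cartan_two s t hl)]
  rcases hw with ⟨j, hj⟩ | ⟨β, h1, h2, h3, h4, h5⟩
  · exact Or.inl ⟨j, hj.tail ⟨i, hback⟩⟩
  · exact Or.inr ⟨β, h1, h2, h3, h4, h5.tail ⟨i, hback⟩⟩

variable (k s t) in
def PM (γ : I → ℤ) : Prop :=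
  ∃ a : I → ℕ, HasInd k s t a ∧ (γ = (fun i => (a i : ℤ)) ∨ γ = -(fun i => (a i : ℤ)))

theorem hasInd_simple [Fintype I] [DecidableEq I] (i : I) : HasInd k s t (fun j => if j = i then 1 else 0) :=
  ⟨ofMat _ (fun _ => 0), indec_simple (dimVec_ofMat _ _), dimVec_ofMat _ _⟩

theorem PM.neg {γ : I → ℤ} (h : PM k s t γ) : PM k s t (-γ) := by
  obtain ⟨a, ha, rfl | rfl⟩ := h
  · exact ⟨a, ha, Or.inr rfl⟩
  · exact ⟨a, ha, Or.inl (neg_neg _)⟩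

theorem PM.refl [Fintype I] [Fintype E] [DecidableEq I] {p : ℕ} [Fact p.Prime]
    [Algebra (ZMod p) k] [Algebra.IsAlgebraic (ZMod p) k] [IsAlgClosed k] {γ : I → ℤ} (i : I) (h : PM k s t γ) :
    PM k s t (simpleRefl (cartanMatrix s t) i γ) := by
  have key : ∀ a : I → ℕ, HasInd k s t a →
      PM k s t (simpleRefl (cartanMatrix s t) i (fun j => (a j : ℤ))) := by
    intro a ha
    by_cases hl : ∀ e, ¬ (s e = i ∧ t e = i)
    · by_cases hα : a = fun j => if j = i then 1 else 0
      · refine ⟨a, ha, Or.inr ?_⟩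
        funext j
        have e : ∀ j, (a j : ℤ) = if j = i then 1 else 0 := by intro j; rw [hα]; simp
        unfold simpleRefl
        simp only [e, Pi.neg_apply]
        simp only [mul_ite, mul_one, mul_zero, Finset.sum_ite_eq', Finset.mem_univ, if_true,
          cartan_two s t hl]
        split_ifs <;> norm_num
      · obtain ⟨a', h1, h2⟩ := refl_ind (p := p) i hl ha hα
        exact ⟨a', h1, Or.inl h2.symm⟩
    · push Not at hl
      obtain ⟨e, h1, h2⟩ := hl
      obtain ⟨a', h1, h2⟩ := loop_refl (p := p) h1 h2 ha
      exact ⟨a', h1, Or.inl h2.symm⟩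
  obtain ⟨a, ha, rfl | rfl⟩ := h
  · exact key a ha
  · rw [simpleRefl_neg]
    exact (key a ha).neg

theorem kac_alg [Fintype I] [Fintype E] [DecidableEq I] {p : ℕ} [Fact p.Prime]
    [Algebra (ZMod p) k] [Algebra.IsAlgebraic (ZMod p) k] [IsAlgClosed k] (α : I → ℕ) : HasInd k s t α ↔
    IsPosRoot (cartanMatrix s t) (fun i => (α i : ℤ)) := by
  refine ⟨isPosRoot_of_hasInd (p := p) _ α rfl, ?_⟩
  rintro ⟨_, h0, h⟩
  have hw : ∀ β γ : I → ℤ, PM k s t β → WeylEquiv (cartanMatrix s t) β γ → PM k s t γ := by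
    intro β γ hβ hw
    induction hw with
    | refl => exact hβ
    | tail _ hab ih =>
      obtain ⟨i, rfl⟩ := hab
      exact PM.refl (p := p) i ih
  have hα : PM k s t (fun i => (α i : ℤ)) := by
    rcases h with ⟨i, hi⟩ | ⟨β, h1, h2, h3, h4, h5⟩
    · refine hw _ _ ⟨_, hasInd_simple i, Or.inl ?_⟩ hi
      funext j; simp
    · obtain ⟨b, rfl⟩ : ∃ b : I → ℕ, β = fun i => (b i : ℤ) :=
        ⟨fun i => (β i).toNat, funext fun i => (Int.toNat_of_nonneg (h1 i)).symm⟩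
      refine hw _ _ ⟨b, hasInd_fund ?_ h3 h4, Or.inl rfl⟩ h5
      rintro rfl
      exact h2 (by funext i; simp)
  obtain ⟨a, ha, h | h⟩ := hα
  · have : α = a := funext fun i => by exact_mod_cast congrFun h i
    rwa [this]
  · exfalso
    apply h0
    funext i
    have := congrFun h i
    simp only [Pi.neg_apply] at this
    simp only [Pi.zero_apply]
    omega

end QRep

section transfer
open FirstOrder

def FOInd (K : Type) [CommRing K] {X Y A B D : Type} (P : A → FreeCommRing (X ⊕ Y))
    (Q : B → FreeCommRing (X ⊕ Y)) (R : D → FreeCommRing (X ⊕ Y)) : Prop :=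
  ∃ x : X → K, ∀ y : Y → K, (∀ a, FreeCommRing.lift (Sum.elim x y) (P a) = 0) →
    (∀ a, FreeCommRing.lift (Sum.elim x y) (Q a) = 0) ∨
    (∀ a, FreeCommRing.lift (Sum.elim x y) (R a) = 0)

theorem fo_exists {X Y A B D : Type} [Finite X] [Finite Y] [Finite A] [Finite B] [Finite D]
    (P : A → FreeCommRing (X ⊕ Y))
    (Q : B → FreeCommRing (X ⊕ Y)) (R : D → FreeCommRing (X ⊕ Y)) :
    ∃ φ : Language.ring.Sentence, ∀ (K : Type) [Field K] [Ring.CompatibleRing K],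
      K ⊨ φ ↔ FOInd K P Q R := by
  obtain ⟨g, hg⟩ : ∃ g : FreeCommRing (X ⊕ Y) → Language.ring.Formula ((Empty ⊕ X) ⊕ Y),
      ∀ (f : FreeCommRing (X ⊕ Y)) (K : Type) [Field K] [Ring.CompatibleRing K] (v : Empty → K)
        (x : X → K) (y : Y → K), (g f).Realize (Sum.elim (Sum.elim v x) y) ↔
          FreeCommRing.lift (Sum.elim x y) f = 0 := by
    refine ⟨fun f => Language.Term.equal
      ((Ring.termOfFreeCommRing f).relabel (Sum.map Sum.inr id)) 0, ?_⟩
    intro f K _ _ v x y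
    rw [Language.Formula.realize_equal]
    have : (Sum.elim (Sum.elim v x) y) ∘ (Sum.map Sum.inr id) = Sum.elim x y := by
      funext a; cases a <;> rfl
    simp [this]
  refine ⟨Language.Formula.iExs X (Language.Formula.iAlls Y
    ((Language.Formula.iInf fun a => g (P a)).imp
      ((Language.Formula.iInf fun a => g (Q a)) ⊔ (Language.Formula.iInf fun a => g (R a))))), ?_⟩
  intro K _ _
  unfold FOInd
  rw [Language.Sentence.Realize, Language.Formula.realize_iExs]
  refine exists_congr fun x => ?_
  rw [Language.Formula.realize_iAlls]
  refine forall_congr' fun y => ?_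
  rw [Language.Formula.realize_imp, Language.Formula.realize_sup,
    Language.Formula.realize_iInf, Language.Formula.realize_iInf, Language.Formula.realize_iInf]
  simp only [hg]

theorem fo_transfer {X Y A B D : Type} [Finite X] [Finite Y] [Finite A] [Finite B] [Finite D]
    (P : A → FreeCommRing (X ⊕ Y))
    (Q : B → FreeCommRing (X ⊕ Y)) (R : D → FreeCommRing (X ⊕ Y)) (S : Prop)
    (h : ∀ (p : ℕ) [Fact p.Prime], FOInd (AlgebraicClosure (ZMod p)) P Q R ↔ S)
    (K : Type) [Field K] [IsAlgClosed K] : FOInd K P Q R ↔ S := by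
  obtain ⟨φ, hφ⟩ := fo_exists P Q R
  have hp : ∀ (p : ℕ) [Fact p.Prime], Language.Theory.ACF p ⊨ᵇ φ ↔ S := by
    intro p hp
    let _ := Ring.compatibleRingOfRing (AlgebraicClosure (ZMod p))
    rw [← h p, ← hφ]
    exact (((Field.ACF_isComplete (Or.inl hp.out)).realize_sentence_iff φ
      (AlgebraicClosure (ZMod p)))).symm
  let _ := Ring.compatibleRingOfRing K
  rw [← hφ]
  obtain ⟨q, hq⟩ := CharP.exists K
  rcases CharP.char_is_prime_or_zero K q with hq' | rfl
  · have : Fact q.Prime := ⟨hq'⟩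
    rw [← hp q]
    exact (Field.ACF_isComplete (Or.inl hq')).realize_sentence_iff φ K
  · rw [(Field.ACF_isComplete (Or.inr rfl)).realize_sentence_iff φ K,
      Field.ACF_zero_realize_iff_infinite_ACF_prime_realize]
    have : ∀ p : Nat.Primes, Language.Theory.ACF p ⊨ᵇ φ ↔ S := by
      intro p
      have : Fact (p : ℕ).Prime := ⟨p.2⟩
      exact hp p
    simp only [this]
    by_cases hS : S
    · simp only [hS, Set.ofPred_true, iff_true]
      exact Set.infinite_univ
    · simp [hS]

end transfer

namespace QRep

variable {k : Type} [Field k] {I E : Type} {s t : E → I}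

section polys
variable (s t) (α : I → ℕ)

abbrev VX : Type := Σ e : E, Fin (α (t e)) × Fin (α (s e))
abbrev VY : Type := Σ i : I, Fin (α i) × Fin (α i)

noncomputable def pX (e : E) : Matrix (Fin (α (t e))) (Fin (α (s e))) (FreeCommRing (VX s t α ⊕ VY α)) :=
  Matrix.of fun a b => FreeCommRing.of (Sum.inl ⟨e, a, b⟩)
noncomputable def pY (i : I) : Matrix (Fin (α i)) (Fin (α i)) (FreeCommRing (VX s t α ⊕ VY α)) :=
  Matrix.of fun a b => FreeCommRing.of (Sum.inr ⟨i, a, b⟩)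

noncomputable def polP : VX s t α ⊕ VY α → FreeCommRing (VX s t α ⊕ VY α)
  | Sum.inl ⟨e, a, b⟩ => (pY s t α (t e) * pX s t α e - pX s t α e * pY s t α (s e)) a b
  | Sum.inr ⟨i, a, b⟩ => (pY s t α i * pY s t α i - pY s t α i) a b
noncomputable def polQ : VY α → FreeCommRing (VX s t α ⊕ VY α)
  | ⟨i, a, b⟩ => pY s t α i a b
noncomputable def polR : VY α → FreeCommRing (VX s t α ⊕ VY α)
  | ⟨i, a, b⟩ => (pY s t α i - 1) a b

theorem foInd_iff (K : Type) [Field K] : FOInd K (polP s t α) (polQ s t α) (polR s t α) ↔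
    ∃ x : Mats K s t α, ∀ θ : ∀ i, Matrix (Fin (α i)) (Fin (α i)) K,
      (∀ e, θ (t e) * x e = x e * θ (s e)) → (∀ i, θ i * θ i = θ i) →
        (∀ i, θ i = 0) ∨ (∀ i, θ i = 1) := by
  have key : ∀ (x : VX s t α → K) (y : VY α → K) (x' : Mats K s t α)
      (θ : ∀ i, Matrix (Fin (α i)) (Fin (α i)) K) (_ : ∀ e a b, x ⟨e, a, b⟩ = x' e a b)
      (_ : ∀ i a b, y ⟨i, a, b⟩ = θ i a b),
      (((∀ a, FreeCommRing.lift (Sum.elim x y) (polP s t α a) = 0) →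
      (∀ a, FreeCommRing.lift (Sum.elim x y) (polQ s t α a) = 0) ∨
      (∀ a, FreeCommRing.lift (Sum.elim x y) (polR s t α a) = 0)) ↔
      ((∀ e, θ (t e) * x' e = x' e * θ (s e)) → (∀ i, θ i * θ i = θ i) →
        (∀ i, θ i = 0) ∨ (∀ i, θ i = 1))) := by
    intro x y x' θ hx hy
    obtain ⟨L, hL⟩ : ∃ L, L = FreeCommRing.lift (Sum.elim x y) := ⟨_, rfl⟩
    rw [← hL]
    have mX : ∀ e, (pX s t α e).map L = x' e := by
      intro e; ext a b
      simp [pX, hL, hx]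
    have mY : ∀ i, (pY s t α i).map L = θ i := by
      intro e; ext a b
      simp [pY, hL, hy]
    have z : ∀ {m n : ℕ} (A : Matrix (Fin m) (Fin n) (FreeCommRing (VX s t α ⊕ VY α))),
        (∀ a b, L (A a b) = 0) ↔ A.map L = 0 := by
      intro m n A
      exact ⟨fun h => Matrix.ext h, fun h a b => congrFun (congrFun h a) b⟩
    have hP : (∀ a, L (polP s t α a) = 0) ↔
        (∀ e, θ (t e) * x' e = x' e * θ (s e)) ∧ (∀ i, θ i * θ i = θ i) := by
      rw [Sum.forall, Sigma.forall, Sigma.forall]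
      refine and_congr (forall_congr' fun e => ?_) (forall_congr' fun i => ?_)
      · rw [Prod.forall]
        refine (z (pY s t α (t e) * pX s t α e - pX s t α e * pY s t α (s e))).trans ?_
        rw [Matrix.map_sub _ (map_sub L), Matrix.map_mul, Matrix.map_mul, mX, mY, mY, sub_eq_zero]
      · rw [Prod.forall]
        refine (z (pY s t α i * pY s t α i - pY s t α i)).trans ?_
        rw [Matrix.map_sub _ (map_sub L), Matrix.map_mul, mY, sub_eq_zero]
    have hQ : (∀ a, L (polQ s t α a) = 0) ↔ (∀ i, θ i = 0) := by
      rw [Sigma.forall]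
      refine forall_congr' fun i => ?_
      rw [Prod.forall]
      refine (z (pY s t α i)).trans ?_
      rw [mY]
    have hR : (∀ a, L (polR s t α a) = 0) ↔ (∀ i, θ i = 1) := by
      rw [Sigma.forall]
      refine forall_congr' fun i => ?_
      rw [Prod.forall]
      refine (z (pY s t α i - 1)).trans ?_
      rw [Matrix.map_sub _ (map_sub L), Matrix.map_one L (map_zero L) (map_one L), mY, sub_eq_zero]
    rw [hP, hQ, hR, and_imp]
  constructor
  · rintro ⟨x, hx⟩
    refine ⟨fun e a b => x ⟨e, a, b⟩, fun θ => ?_⟩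
    exact (key x (fun v => θ v.1 v.2.1 v.2.2) _ θ (fun _ _ _ => rfl) (fun _ _ _ => rfl)).1 (hx _)
  · rintro ⟨x, hx⟩
    refine ⟨fun v => x v.1 v.2.1 v.2.2, fun y => ?_⟩
    exact (key _ y x (fun i => Matrix.of fun a b => y ⟨i, a, b⟩) (fun _ _ _ => rfl)
      (fun _ _ _ => rfl)).2
      (hx (fun i => Matrix.of fun a b => y ⟨i, a, b⟩))

end polys

theorem hasInd_iff_fo {α : I → ℕ} (h0 : α ≠ 0) :
    HasInd k s t α ↔ FOInd k (polP s t α) (polQ s t α) (polR s t α) := by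
  rw [hasInd_iff, foInd_iff]
  refine exists_congr fun x => ?_
  rw [indec_ofMat_iff]
  exact ⟨fun h => h.2, fun h => ⟨h0, h⟩⟩

theorem kac (k : Type) [Field k] [IsAlgClosed k] [Fintype I] [Fintype E]
    [DecidableEq I] (s t : E → I) (α : I → ℕ) :
    HasInd k s t α ↔ IsPosRoot (cartanMatrix s t) (fun i => (α i : ℤ)) := by
  by_cases h0 : α = 0
  · refine ⟨fun h => absurd h0 h.ne_zero, fun h => absurd ?_ h.2.1⟩
    funext i; simp [h0]
  rw [hasInd_iff_fo h0]
  refine fo_transfer _ _ _ _ (fun p _ => ?_) k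
  rw [← hasInd_iff_fo h0]
  exact kac_alg (p := p) α

end QRep

theorem stmt12 (k : Type) [Field k] [IsAlgClosed k] (I E : Type) [Fintype I] [Fintype E]
    [DecidableEq I] (s t : E → I) (α : I → ℕ) :
    ((∃ M : QRep k I E s t, M.Indecomposable ∧ QRep.dimVec M = α) ↔
      IsPosRoot (cartanMatrix s t) (fun i => (α i : ℤ))) ∧
    -- independence of orientation: any quiver with the same underlying graph has the same
    -- dimension vectors of indecomposables
    (∀ (E' : Type) (_ : Fintype E') (s' t' : E' → I),
      (∀ i j, cartanMatrix s t i j = cartanMatrix s' t' i j) →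
      ((∃ M : QRep k I E s t, M.Indecomposable ∧ QRep.dimVec M = α) ↔
        (∃ M' : QRep k I E' s' t', M'.Indecomposable ∧ QRep.dimVec M' = α))) := by
  have hK : ∀ (E : Type) [Fintype E] (s t : E → I),
      (∃ M : QRep k I E s t, M.Indecomposable ∧ QRep.dimVec M = α) ↔
      IsPosRoot (cartanMatrix s t) (fun i => (α i : ℤ)) := fun E _ s t => QRep.kac k s t α
  refine ⟨hK E s t, fun E' _ s' t' h => ?_⟩
  have e : cartanMatrix s t = cartanMatrix s' t' := funext fun i => funext fun j => h i j
  rw [hK E s t, hK E' s' t', e]
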